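/- arXiv:1309.4710 — 5 statements merged into one kernel-verified Lean document; each statement's English description precedes it below -/
import Mathlib

section
/- Let d₁ ≥ … ≥ dₙ > 0 and c₁ ≥ … ≥ c_m > 0 be integers and d, c ∈ ℕ. There exists a monomorphism of Kronecker representations I_{d₁} ⊕ … ⊕ I_{dₙ} ⊕ d·I₀ → I_{c₁} ⊕ … ⊕ I_{c_m} ⊕ c·I₀ if and only if d ≤ c and for every i ∈ {1,…,n}, dᵢ + dᵢ₊₁ + … + dₙ ≤ Σ_{j : c_j ≤ dᵢ} c_j (the empty sum being 0). -/
open Matrix Finset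

/-- A finite-dimensional representation of the Kronecker quiver over `k`:
two vector spaces `k^{d1}`, `k^{d2}` and two linear maps `k^{d2} → k^{d1}`
given by the matrices `A` and `B`. -/
structure KRep (k : Type) [Field k] where
  d1 : ℕ
  d2 : ℕ
  A : Matrix (Fin d1) (Fin d2) k
  B : Matrix (Fin d1) (Fin d2) k

/-- A morphism of Kronecker representations `M → N`. -/
structure KHom {k : Type} [Field k] (M N : KRep k) where
  f1 : Matrix (Fin N.d1) (Fin M.d1) k
  f2 : Matrix (Fin N.d2) (Fin M.d2) k
  comm_a : f1 * M.A = N.A * f2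
  comm_b : f1 * M.B = N.B * f2

variable {k : Type} [Field k]

/-- A monomorphism: both components injective. -/
def KHom.Mono {M N : KRep k} (f : KHom M N) : Prop :=
  Function.Injective f.f1.mulVecLin ∧ Function.Injective f.f2.mulVecLin

/-- An epimorphism: both components surjective. -/
def KHom.Epi {M N : KRep k} (f : KHom M N) : Prop :=
  Function.Surjective f.f1.mulVecLin ∧ Function.Surjective f.f2.mulVecLin

/-- Isomorphism of Kronecker representations. -/
def KIso (M N : KRep k) : Prop :=
  ∃ f : KHom M N, Function.Bijective f.f1.mulVecLin ∧ Function.Bijective f.f2.mulVecLin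

/-- `SES N Y M` : there is a short exact sequence `0 → N → Y → M → 0`. -/
def SES (N Y M : KRep k) : Prop :=
  ∃ (f : KHom N Y) (g : KHom Y M), f.Mono ∧ g.Epi ∧
    LinearMap.range f.f1.mulVecLin = LinearMap.ker g.f1.mulVecLin ∧
    LinearMap.range f.f2.mulVecLin = LinearMap.ker g.f2.mulVecLin

/-- The zero representation. -/
def KRep.zero : KRep k := ⟨0, 0, 0, 0⟩

/-- Direct sum of two Kronecker representations (block diagonal matrices). -/
def KRep.dsum (M N : KRep k) : KRep k where
  d1 := M.d1 + N.d1
  d2 := M.d2 + N.d2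
  A := Matrix.reindex finSumFinEquiv finSumFinEquiv (Matrix.fromBlocks M.A 0 0 N.A)
  B := Matrix.reindex finSumFinEquiv finSumFinEquiv (Matrix.fromBlocks M.B 0 0 N.B)

/-- Direct sum of a list of Kronecker representations. -/
def KRep.dsumList (l : List (KRep k)) : KRep k := l.foldr KRep.dsum KRep.zero

/-- The preprojective indecomposable `P n`, with maps `k^n → k^{n+1}`
given by the matrices `(I_n ; 0)` and `(0 ; I_n)`. -/
def KRep.P (k : Type) [Field k] (n : ℕ) : KRep k where
  d1 := n + 1
  d2 := n
  A := Matrix.of fun i j => if (i : ℕ) = (j : ℕ) then 1 else 0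
  B := Matrix.of fun i j => if (i : ℕ) = (j : ℕ) + 1 then 1 else 0

/-- The preinjective indecomposable `I n`, with maps `k^{n+1} → k^n`
given by the matrices `(I_n  0)` and `(0  I_n)`. -/
def KRep.Inj (k : Type) [Field k] (n : ℕ) : KRep k where
  d1 := n
  d2 := n + 1
  A := Matrix.of fun i j => if (i : ℕ) = (j : ℕ) then 1 else 0
  B := Matrix.of fun i j => if (i : ℕ) + 1 = (j : ℕ) then 1 else 0

/-- `M` is indecomposable: nonzero, and any decomposition as a direct sum
of two subrepresentations has a zero summand. -/
def KRep.Indecomposable (M : KRep k) : Prop :=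
  0 < M.d1 + M.d2 ∧
    ∀ N₁ N₂ : KRep k, KIso M (N₁.dsum N₂) → N₁.d1 + N₁.d2 = 0 ∨ N₂.d1 + N₂.d2 = 0

/-- The preinjective representation `a 0 · I₀ ⊕ a 1 · I₁ ⊕ ⋯ ⊕ a n · Iₙ`. -/
def KRep.multi (k : Type) [Field k] (a : ℕ → ℕ) (n : ℕ) : KRep k :=
  KRep.dsumList (((List.range (n + 1)).flatMap fun i => List.replicate (a i) (KRep.Inj k i)))

/-- `M'` is a subfactor of `M`: there is a linking module `L` with
`M' ↪ L ↞ M`. -/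
def IsSubfactor (M' M : KRep k) : Prop :=
  ∃ L : KRep k, (∃ f : KHom M' L, f.Mono) ∧ (∃ g : KHom M L, g.Epi)

namespace KRep

/-- `M` is, up to a choice of bases, the direct sum of the representations `Inj k (w i)`:
in the bases indexed by pairs `(i, a)`, the two maps are restriction to the first and to the last
`w i` coordinates of each summand. -/
def IsSumInj (M : KRep k) {ι : Type} (w : ι → ℕ) : Prop :=
  ∃ (e₁ : (Σ i, Fin (w i)) ≃ Fin M.d1) (e₂ : (Σ i, Fin (w i + 1)) ≃ Fin M.d2),
    (∀ v s, (M.A *ᵥ v) (e₁ s) = v (e₂ ⟨s.1, s.2.castSucc⟩)) ∧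
      ∀ v s, (M.B *ᵥ v) (e₁ s) = v (e₂ ⟨s.1, s.2.succ⟩)

theorem isSumInj_zero (w : Empty → ℕ) : (KRep.zero : KRep k).IsSumInj w := by
  have h : IsEmpty (Fin (KRep.zero : KRep k).d1) := inferInstanceAs (IsEmpty (Fin 0))
  have h' : IsEmpty (Fin (KRep.zero : KRep k).d2) := inferInstanceAs (IsEmpty (Fin 0))
  exact ⟨Equiv.equivOfIsEmpty _ _, Equiv.equivOfIsEmpty _ _,
    fun _ s => s.1.elim, fun _ s => s.1.elim⟩

theorem isSumInj_Inj (n : ℕ) : (KRep.Inj k n).IsSumInj (fun _ : Unit => n) := by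
  refine ⟨Equiv.uniqueSigma (fun _ : Unit => Fin n),
    Equiv.uniqueSigma (fun _ : Unit => Fin (n + 1)), ?_, ?_⟩
  · rintro v ⟨_, a⟩
    change ∑ b : Fin (n + 1), (if (a : ℕ) = (b : ℕ) then (1 : k) else 0) * v b = v a.castSucc
    rw [Finset.sum_eq_single a.castSucc]
    · simp
    · intro b _ hb
      rw [if_neg fun h => hb (Fin.ext h.symm), zero_mul]
    · simp
  · rintro v ⟨_, a⟩
    change ∑ b : Fin (n + 1), (if (a : ℕ) + 1 = (b : ℕ) then (1 : k) else 0) * v b = v a.succ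
    rw [Finset.sum_eq_single a.succ]
    · simp
    · intro b _ hb
      rw [if_neg fun h => hb (Fin.ext h.symm), zero_mul]
    · simp

theorem reindex_fromBlocks_mulVec {a b a' b' : ℕ} (X : Matrix (Fin a) (Fin b) k)
    (Y : Matrix (Fin a') (Fin b') k) (v : Fin (b + b') → k) (s : Fin a ⊕ Fin a') :
    (Matrix.reindex finSumFinEquiv finSumFinEquiv (Matrix.fromBlocks X 0 0 Y) *ᵥ v)
        (finSumFinEquiv s) =
      Sum.elim (X *ᵥ fun i => v (finSumFinEquiv (Sum.inl i)))
        (Y *ᵥ fun i => v (finSumFinEquiv (Sum.inr i))) s := by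
  rw [Matrix.reindex_apply, Matrix.submatrix_mulVec_equiv, Function.comp_apply,
    Equiv.symm_apply_apply, Equiv.symm_symm, Matrix.fromBlocks_mulVec]
  simp only [Matrix.zero_mulVec, add_zero, zero_add]
  rfl

theorem IsSumInj.dsum {M N : KRep k} {ι ι' : Type} {w : ι → ℕ} {w' : ι' → ℕ}
    (hM : M.IsSumInj w) (hN : N.IsSumInj w') : (M.dsum N).IsSumInj (Sum.elim w w') := by
  obtain ⟨e₁, e₂, hA, hB⟩ := hM
  obtain ⟨e₁', e₂', hA', hB'⟩ := hN
  refine ⟨(Equiv.sumSigmaDistrib fun i => Fin (Sum.elim w w' i)).trans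
      ((Equiv.sumCongr e₁ e₁').trans finSumFinEquiv),
    (Equiv.sumSigmaDistrib fun i => Fin (Sum.elim w w' i + 1)).trans
      ((Equiv.sumCongr e₂ e₂').trans finSumFinEquiv), ?_, ?_⟩
  · rintro v ⟨i | i, a⟩
    · exact (reindex_fromBlocks_mulVec M.A N.A v (Sum.inl (e₁ ⟨i, a⟩))).trans (hA _ ⟨i, a⟩)
    · exact (reindex_fromBlocks_mulVec M.A N.A v (Sum.inr (e₁' ⟨i, a⟩))).trans (hA' _ ⟨i, a⟩)
  · rintro v ⟨i | i, a⟩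
    · exact (reindex_fromBlocks_mulVec M.B N.B v (Sum.inl (e₁ ⟨i, a⟩))).trans (hB _ ⟨i, a⟩)
    · exact (reindex_fromBlocks_mulVec M.B N.B v (Sum.inr (e₁' ⟨i, a⟩))).trans (hB' _ ⟨i, a⟩)

theorem IsSumInj.comp_equiv {M : KRep k} {ι ι' : Type} {w : ι → ℕ} (hM : M.IsSumInj w)
    (σ : ι' ≃ ι) : M.IsSumInj (w ∘ σ) := by
  obtain ⟨e₁, e₂, hA, hB⟩ := hM
  exact ⟨(Equiv.sigmaCongrLeft (β := fun i => Fin (w i)) σ).trans e₁,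
    (Equiv.sigmaCongrLeft (β := fun i => Fin (w i + 1)) σ).trans e₂,
    fun v s => hA v ⟨σ s.1, s.2⟩, fun v s => hB v ⟨σ s.1, s.2⟩⟩

theorem isSumInj_dsumList_ofFn_append {ι : Type} {w : ι → ℕ} {l : List (KRep k)}
    (hl : (dsumList l).IsSumInj w) {n : ℕ} (u : Fin n → ℕ) :
    (dsumList (List.ofFn (fun i => KRep.Inj k (u i)) ++ l)).IsSumInj
      (Sum.elim u w : Fin n ⊕ ι → ℕ) := by
  induction n with
  | zero =>
    have h := hl.comp_equiv (Equiv.emptySum (Fin 0) ι)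
    convert h using 1
    · rw [List.ofFn_zero, List.nil_append]
    · funext i
      rcases i with i | i
      · exact i.elim0
      · rfl
  | succ n ih =>
    rw [List.ofFn_succ]
    have h := ((isSumInj_Inj (k := k) (u 0)).dsum (ih fun i => u i.succ)).comp_equiv
      (((finSuccEquiv n).trans ((Equiv.optionEquivSumPUnit (Fin n)).trans
        (Equiv.sumComm _ _))).sumCongr (Equiv.refl ι) |>.trans (Equiv.sumAssoc _ _ _))
    convert h using 1
    · rfl
    · funext i
      rcases i with i | i
      · refine Fin.cases ?_ (fun i => ?_) i <;> simp
      · rfl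

theorem isSumInj_dsumList_ofFn_append_replicate {n : ℕ} (u : Fin n → ℕ) (d : ℕ) :
    (dsumList (List.ofFn (fun i => KRep.Inj k (u i)) ++
      List.replicate d (KRep.Inj k 0))).IsSumInj
      (Sum.elim u (fun _ => 0) : Fin n ⊕ Fin d → ℕ) := by
  have h := isSumInj_dsumList_ofFn_append (k := k) (l := []) (isSumInj_zero fun _ => 0)
    (fun _ : Fin d => 0)
  rw [List.append_nil, List.ofFn_const] at h
  have h' := h.comp_equiv (Equiv.sumEmpty (Fin d) Empty).symm
  exact isSumInj_dsumList_ofFn_append h' u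

end KRep

/-- An embedding of `⨁ Inj k (w i)` into `⨁ Inj k (w' j)`, in coordinates. -/
structure SumInjEmbedding (k : Type) [Field k] {ι ι' : Type} (w : ι → ℕ) (w' : ι' → ℕ) where
  map₁ : ((Σ i, Fin (w i)) → k) →ₗ[k] ((Σ j, Fin (w' j)) → k)
  map₂ : ((Σ i, Fin (w i + 1)) → k) →ₗ[k] ((Σ j, Fin (w' j + 1)) → k)
  map₁_castSucc : ∀ v t, map₁ (fun s => v ⟨s.1, s.2.castSucc⟩) t = map₂ v ⟨t.1, t.2.castSucc⟩
  map₁_succ : ∀ v t, map₁ (fun s => v ⟨s.1, s.2.succ⟩) t = map₂ v ⟨t.1, t.2.succ⟩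
  injective₁ : Function.Injective map₁
  injective₂ : Function.Injective map₂

theorem KRep.IsSumInj.exists_mono_iff {M N : KRep k} {ι ι' : Type} {w : ι → ℕ} {w' : ι' → ℕ}
    (hM : M.IsSumInj w) (hN : N.IsSumInj w') :
    (∃ f : KHom M N, f.Mono) ↔ Nonempty (SumInjEmbedding k w w') := by
  obtain ⟨e₁, e₂, hA, hB⟩ := hM
  obtain ⟨e₁', e₂', hA', hB'⟩ := hN
  have hMA : ∀ v, M.A *ᵥ v = fun x => v (e₂ ⟨(e₁.symm x).1, (e₁.symm x).2.castSucc⟩) := by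
    intro v; funext x; simpa using hA v (e₁.symm x)
  have hMB : ∀ v, M.B *ᵥ v = fun x => v (e₂ ⟨(e₁.symm x).1, (e₁.symm x).2.succ⟩) := by
    intro v; funext x; simpa using hB v (e₁.symm x)
  constructor
  · rintro ⟨f, h₁, h₂⟩
    refine ⟨⟨(LinearMap.funLeft k k e₁').comp
        (f.f1.mulVecLin.comp (LinearMap.funLeft k k e₁.symm)),
      (LinearMap.funLeft k k e₂').comp
        (f.f2.mulVecLin.comp (LinearMap.funLeft k k e₂.symm)), ?_, ?_, ?_, ?_⟩⟩
    · intro v t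
      have h := congrFun (congrArg (· *ᵥ (v ∘ e₂.symm)) f.comm_a) (e₁' t)
      simp only [← Matrix.mulVec_mulVec] at h
      rw [hA', hMA] at h
      simp only [Function.comp_apply, Equiv.symm_apply_apply] at h
      exact h
    · intro v t
      have h := congrFun (congrArg (· *ᵥ (v ∘ e₂.symm)) f.comm_b) (e₁' t)
      simp only [← Matrix.mulVec_mulVec] at h
      rw [hB', hMB] at h
      simp only [Function.comp_apply, Equiv.symm_apply_apply] at h
      exact h
    · exact (LinearMap.funLeft_injective_of_surjective k k _ e₁'.surjective).comp
        (h₁.comp (LinearMap.funLeft_injective_of_surjective k k _ e₁.symm.surjective))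
    · exact (LinearMap.funLeft_injective_of_surjective k k _ e₂'.surjective).comp
        (h₂.comp (LinearMap.funLeft_injective_of_surjective k k _ e₂.symm.surjective))
  · rintro ⟨g⟩
    set G₁ := (LinearMap.funLeft k k e₁'.symm).comp (g.map₁.comp (LinearMap.funLeft k k e₁))
      with hG₁
    set G₂ := (LinearMap.funLeft k k e₂'.symm).comp (g.map₂.comp (LinearMap.funLeft k k e₂))
      with hG₂
    have hG₁' : (LinearMap.toMatrix' G₁).mulVecLin = G₁ := by
      rw [← Matrix.toLin'_apply', Matrix.toLin'_toMatrix']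
    have hG₂' : (LinearMap.toMatrix' G₂).mulVecLin = G₂ := by
      rw [← Matrix.toLin'_apply', Matrix.toLin'_toMatrix']
    refine ⟨⟨LinearMap.toMatrix' G₁, LinearMap.toMatrix' G₂, ?_, ?_⟩, ?_, ?_⟩
    · refine Matrix.ext_iff_mulVec.mpr fun v => ?_
      rw [← Matrix.mulVec_mulVec, ← Matrix.mulVec_mulVec, LinearMap.toMatrix'_mulVec,
        LinearMap.toMatrix'_mulVec, hMA]
      funext x
      obtain ⟨t, rfl⟩ := e₁'.surjective x
      rw [hA']
      simp only [hG₁, hG₂, LinearMap.comp_apply, LinearMap.funLeft_apply,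
        Equiv.symm_apply_apply]
      refine Eq.trans (congrArg (fun u => g.map₁ u t) (funext fun s => ?_))
        (g.map₁_castSucc (fun s => v (e₂ s)) t)
      rw [LinearMap.funLeft_apply, Equiv.symm_apply_apply]
    · refine Matrix.ext_iff_mulVec.mpr fun v => ?_
      rw [← Matrix.mulVec_mulVec, ← Matrix.mulVec_mulVec, LinearMap.toMatrix'_mulVec,
        LinearMap.toMatrix'_mulVec, hMB]
      funext x
      obtain ⟨t, rfl⟩ := e₁'.surjective x
      rw [hB']
      simp only [hG₁, hG₂, LinearMap.comp_apply, LinearMap.funLeft_apply,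
        Equiv.symm_apply_apply]
      refine Eq.trans (congrArg (fun u => g.map₁ u t) (funext fun s => ?_))
        (g.map₁_succ (fun s => v (e₂ s)) t)
      rw [LinearMap.funLeft_apply, Equiv.symm_apply_apply]
    · change Function.Injective (LinearMap.toMatrix' G₁).mulVecLin
      rw [hG₁']
      exact (LinearMap.funLeft_injective_of_surjective k k _ e₁'.symm.surjective).comp
        (g.injective₁.comp (LinearMap.funLeft_injective_of_surjective k k _ e₁.surjective))
    · change Function.Injective (LinearMap.toMatrix' G₂).mulVecLin
      rw [hG₂']
      exact (LinearMap.funLeft_injective_of_surjective k k _ e₂'.symm.surjective).comp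
        (g.injective₂.comp (LinearMap.funLeft_injective_of_surjective k k _ e₂.surjective))

/-- A linear embedding of function spaces that maps functions supported in `P` to functions
supported in `Q` forces `Q` to have at least as many points as `P`. -/
theorem card_filter_le_of_injective {σ τ : Type*} [Fintype σ] [Fintype τ]
    (f : (σ → k) →ₗ[k] (τ → k)) (hf : Function.Injective f) (P : σ → Prop) (Q : τ → Prop)
    [DecidablePred P] [DecidablePred Q]
    (h : ∀ v : σ → k, (∀ s, ¬ P s → v s = 0) → ∀ t, ¬ Q t → f v t = 0) :
    (univ.filter P).card ≤ (univ.filter Q).card := by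
  let g : ({s // P s} → k) →ₗ[k] ({t // Q t} → k) :=
    (LinearMap.funLeft k k Subtype.val).comp
      (f.comp (Function.ExtendByZero.linearMap k Subtype.val))
  have hg : Function.Injective g := by
    rw [injective_iff_map_eq_zero]
    intro v hv
    have hfv : f (Function.extend Subtype.val v 0) = 0 := by
      funext t
      by_cases ht : Q t
      · exact congrFun hv ⟨t, ht⟩
      · refine h _ (fun s hs => ?_) t ht
        rw [Function.extend_apply' _ _ _ fun ⟨a, ha⟩ => hs (ha ▸ a.2)]
        rfl
    have hv' := (injective_iff_map_eq_zero f).mp hf _ hfv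
    funext s
    simpa [Subtype.val_injective.extend_apply] using congrFun hv' s.1
  simpa [Fintype.card_subtype] using LinearMap.finrank_le_finrank_of_injective hg

theorem card_filter_sigma_fin {ι : Type*} [Fintype ι] (w : ι → ℕ) (P : ι → Prop)
    [DecidablePred P] :
    (univ.filter fun s : Σ i, Fin (w i) => P s.1).card = ∑ i with P i, w i := by
  have h : (univ.filter fun s : Σ i, Fin (w i) => P s.1) =
      (univ.filter P).sigma fun _ => univ := by
    ext s; simp
  rw [h, Finset.card_sigma]
  simp

namespace SumInjEmbedding

variable {ι ι' : Type} {w : ι → ℕ} {w' : ι' → ℕ}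

/-- There are no nonzero morphisms `Inj k a → Inj k b` with `a < b`. -/
theorem map₂_single_eq_zero [DecidableEq ι] (g : SumInjEmbedding k w w') {i : ι} {j : ι'}
    (h : w i < w' j) (l : Fin (w i + 1)) (p : Fin (w' j + 1)) :
    g.map₂ (Pi.single ⟨i, l⟩ 1) ⟨j, p⟩ = 0 := by
  have shift : ∀ (a : Fin (w i)) (q : Fin (w' j)),
      g.map₂ (Pi.single ⟨i, a.castSucc⟩ 1) ⟨j, q.castSucc⟩ =
        g.map₂ (Pi.single ⟨i, a.succ⟩ 1) ⟨j, q.succ⟩ := by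
    intro a q
    rw [← g.map₁_castSucc _ ⟨j, q⟩, ← g.map₁_succ _ ⟨j, q⟩]
    refine congrFun (congrArg g.map₁ (funext ?_)) _
    rintro ⟨i', b⟩
    by_cases hi : i' = i
    · subst hi
      simp [Pi.single_apply]
    · simp [hi]
  have bottom : ∀ q : Fin (w' j), g.map₂ (Pi.single ⟨i, 0⟩ 1) ⟨j, q.succ⟩ = 0 := by
    intro q
    rw [← g.map₁_succ _ ⟨j, q⟩]
    refine (congrFun (congrArg g.map₁ (funext ?_)) _).trans (congrFun (map_zero g.map₁) _)
    rintro ⟨i', b⟩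
    by_cases hi : i' = i
    · subst hi
      simp
    · simp [hi]
  have top : ∀ q : Fin (w' j),
      g.map₂ (Pi.single ⟨i, Fin.last _⟩ 1) ⟨j, q.castSucc⟩ = 0 := by
    intro q
    rw [← g.map₁_castSucc _ ⟨j, q⟩]
    refine (congrFun (congrArg g.map₁ (funext ?_)) _).trans (congrFun (map_zero g.map₁) _)
    rintro ⟨i', b⟩
    by_cases hi : i' = i
    · subst hi
      simp [(Fin.castSucc_lt_last b).ne]
    · simp [hi]
  have upper : ∀ (l : Fin (w i + 1)) (p : Fin (w' j + 1)), (l : ℕ) < p →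
      g.map₂ (Pi.single ⟨i, l⟩ 1) ⟨j, p⟩ = 0 := by
    intro l
    induction l using Fin.induction with
    | zero =>
      intro p hp
      obtain ⟨q, rfl⟩ := Fin.exists_succ_eq.mpr (show p ≠ 0 by rintro rfl; simp at hp)
      exact bottom q
    | succ a ih =>
      intro p hp
      obtain ⟨q, rfl⟩ := Fin.exists_succ_eq.mpr (show p ≠ 0 by rintro rfl; simp at hp)
      rw [← shift]
      exact ih _ (by simpa using hp)
  have lower : ∀ (l : Fin (w i + 1)) (p : Fin (w' j + 1)), (p : ℕ) + w i < l + w' j →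
      g.map₂ (Pi.single ⟨i, l⟩ 1) ⟨j, p⟩ = 0 := by
    intro l
    induction l using Fin.reverseInduction with
    | last =>
      intro p hp
      obtain ⟨q, rfl⟩ := Fin.exists_castSucc_eq.mpr
        (show p ≠ Fin.last _ by rintro rfl; simp at hp; omega)
      exact top q
    | cast a ih =>
      intro p hp
      have ha := a.2
      obtain ⟨q, rfl⟩ := Fin.exists_castSucc_eq.mpr
        (show p ≠ Fin.last _ by rintro rfl; simp at hp; omega)
      rw [shift]
      refine ih _ ?_
      simp at hp ⊢
      omega
  by_cases hlp : (l : ℕ) < p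
  · exact upper l p hlp
  · exact lower l p (by omega)

theorem map₂_eq_zero_of_support [Fintype ι] (g : SumInjEmbedding k w w') (D : ℕ)
    (v : (Σ i, Fin (w i + 1)) → k) (hv : ∀ s, ¬ w s.1 ≤ D → v s = 0)
    (t : Σ j, Fin (w' j + 1)) (ht : ¬ w' t.1 ≤ D) : g.map₂ v t = 0 := by
  classical
  conv_lhs => rw [← Finset.univ_sum_single v]
  rw [map_sum, Finset.sum_apply]
  refine Finset.sum_eq_zero fun s _ => ?_
  by_cases hs : w s.1 ≤ D
  · have h : (Pi.single s (v s) : (Σ i, Fin (w i + 1)) → k) = v s • Pi.single s 1 := by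
      rw [← Pi.single_smul, smul_eq_mul, mul_one]
    rw [h, map_smul, Pi.smul_apply, g.map₂_single_eq_zero (by omega), smul_zero]
  · rw [hv s hs, Pi.single_zero, map_zero, Pi.zero_apply]

theorem map₁_eq_zero_of_support [Fintype ι] (g : SumInjEmbedding k w w') (D : ℕ)
    (v : (Σ i, Fin (w i)) → k) (hv : ∀ s, ¬ w s.1 ≤ D → v s = 0)
    (t : Σ j, Fin (w' j)) (ht : ¬ w' t.1 ≤ D) : g.map₁ v t = 0 := by
  have h := g.map₁_castSucc
    (fun s => if h : (s.2 : ℕ) < w s.1 then v ⟨s.1, ⟨s.2, h⟩⟩ else 0) t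
  simp only [Fin.val_castSucc, Fin.is_lt, dif_pos, Fin.eta, Sigma.eta] at h
  rw [h]
  refine g.map₂_eq_zero_of_support D _ (fun s hs => ?_) ⟨t.1, t.2.castSucc⟩ ht
  split_ifs
  · exact hv _ hs
  · rfl

theorem sum_le_sum₁ [Fintype ι] [Fintype ι'] (g : SumInjEmbedding k w w') (D : ℕ) :
    ∑ i with w i ≤ D, w i ≤ ∑ j with w' j ≤ D, w' j := by
  simpa only [card_filter_sigma_fin _ fun i => w i ≤ D,
    card_filter_sigma_fin _ fun j => w' j ≤ D] using
    card_filter_le_of_injective g.map₁ g.injective₁ (fun s => w s.1 ≤ D) (fun t => w' t.1 ≤ D)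
      (g.map₁_eq_zero_of_support D)

theorem sum_le_sum₂ [Fintype ι] [Fintype ι'] (g : SumInjEmbedding k w w') (D : ℕ) :
    ∑ i with w i ≤ D, (w i + 1) ≤ ∑ j with w' j ≤ D, (w' j + 1) := by
  simpa only [card_filter_sigma_fin (fun i => w i + 1) fun i => w i ≤ D,
    card_filter_sigma_fin (fun j => w' j + 1) fun j => w' j ≤ D] using
    card_filter_le_of_injective g.map₂ g.injective₂ (fun s => w s.1 ≤ D) (fun t => w' t.1 ≤ D)
      (g.map₂_eq_zero_of_support D)

end SumInjEmbedding

section Windows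

variable {n m : ℕ} {dv : Fin n → ℕ} {cv : Fin m → ℕ}

/-- Lay out blocks of lengths `u i` consecutively, the last one first; `blockStart u i` is the
first position of the `i`-th block. -/
def blockStart (u : Fin n → ℕ) (i : Fin n) : ℕ := ∑ j ∈ Ioi i, u j

theorem blockStart_add (u : Fin n → ℕ) (i : Fin n) : blockStart u i + u i = ∑ j ∈ Ici i, u j := by
  rw [blockStart, ← Finset.Ioi_insert, Finset.sum_insert (by simp), add_comm]

theorem blockStart_add_le (u : Fin n → ℕ) {i j : Fin n} (h : i < j) :
    blockStart u j + u j ≤ blockStart u i := by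
  rw [blockStart_add]
  exact Finset.sum_le_sum_of_subset fun x hx => by
    simp only [mem_Ici, mem_Ioi] at hx ⊢
    exact h.trans_le hx

theorem exists_block {u : Fin n → ℕ} {x : ℕ} (hx : x < ∑ i, u i) :
    ∃ i, blockStart u i ≤ x ∧ x < blockStart u i + u i := by
  induction n generalizing x with
  | zero => simp at hx
  | succ n ih =>
    have hsucc : ∀ i : Fin n, blockStart u i.succ = blockStart (fun i => u i.succ) i := by
      intro i
      rw [blockStart, blockStart, ← Fin.map_succEmb_Ioi, Finset.sum_map]
      rfl
    have hzero : blockStart u 0 = ∑ i : Fin n, u i.succ := by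
      rw [blockStart, Fin.Ioi_zero_eq_map, Finset.sum_map]
      rfl
    by_cases h : x < ∑ i : Fin n, u i.succ
    · obtain ⟨i, hi⟩ := ih h
      exact ⟨i.succ, by rwa [hsucc]⟩
    · rw [Fin.sum_univ_succ] at hx
      exact ⟨0, by omega, by omega⟩

/-- The `i`-th block of `dv` and the `j`-th block of `cv` overlap. -/
def BlocksMeet (dv : Fin n → ℕ) (cv : Fin m → ℕ) (i : Fin n) (j : Fin m) : Prop :=
  blockStart cv j < blockStart dv i + dv i ∧ blockStart dv i < blockStart cv j + cv j

instance (i : Fin n) (j : Fin m) : Decidable (BlocksMeet dv cv i j) :=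
  inferInstanceAs (Decidable (_ ∧ _))

/-- The offset at which a window of length `cv j` is placed in the `i`-th block of `dv`: the
position closest to the `j`-th block of `cv` at which the window fits. -/
def windowOffset (dv : Fin n → ℕ) (cv : Fin m → ℕ) (i : Fin n) (j : Fin m) : ℕ :=
  min (blockStart cv j - blockStart dv i) (dv i - cv j)

theorem BlocksMeet.le (hcv : Antitone cv)
    (h : ∀ i, ∑ j with i ≤ j, dv j ≤ ∑ j with cv j ≤ dv i, cv j)
    {i : Fin n} {j : Fin m} (hij : BlocksMeet dv cv i j) : cv j ≤ dv i := by
  by_contra! hlt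
  have hle : ∑ j with cv j ≤ dv i, cv j ≤ blockStart cv j :=
    Finset.sum_le_sum_of_subset fun x hx => by
      simp only [mem_filter, mem_univ, true_and, mem_Ioi] at hx ⊢
      by_contra! hxj
      have := hcv hxj
      omega
  have hi : ∑ j with i ≤ j, dv j = blockStart dv i + dv i := by
    rw [blockStart_add]
    congr 1
    ext; simp
  have := h i
  have := hij.1
  omega

/-- A family of vectors all of whose window sums vanish is zero. -/
theorem eq_zero_of_window_sums {K : Type*} [AddCommGroup K] (hcv : Antitone cv)
    (h : ∀ i, ∑ j with i ≤ j, dv j ≤ ∑ j with cv j ≤ dv i, cv j) (v : Fin n → ℕ → K)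
    (hv : ∀ j, ∀ l < cv j,
      ∑ i, (if BlocksMeet dv cv i j then v i (windowOffset dv cv i j + l) else 0) = 0)
    (i : Fin n) (p : ℕ) (hp : p < dv i) : v i p = 0 := by
  have cover : ∀ i, ∀ p < dv i, ∃ j, blockStart cv j ≤ blockStart dv i + p ∧
      blockStart dv i + p < blockStart cv j + cv j := by
    intro i p hp
    refine exists_block (lt_of_lt_of_le ?_ ((h i).trans
      (Finset.sum_le_sum_of_subset (Finset.filter_subset _ _))))
    have : ∑ j with i ≤ j, dv j = blockStart dv i + dv i := by
      rw [blockStart_add]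
      congr 1
      ext; simp
    omega
  have solve : ∀ i p j, BlocksMeet dv cv i j → windowOffset dv cv i j ≤ p →
      p < windowOffset dv cv i j + cv j →
      (∀ i', i' ≠ i → BlocksMeet dv cv i' j →
        v i' (windowOffset dv cv i' j + (p - windowOffset dv cv i j)) = 0) → v i p = 0 := by
    intro i p j hij hle hlt hz
    have hsum := hv j (p - windowOffset dv cv i j) (by omega)
    rw [Finset.sum_eq_single i, if_pos hij, Nat.add_sub_cancel' hle] at hsum
    · exact hsum
    · intro i' _ hi'
      split_ifs with hi'j
      · exact hz i' hi' hi'j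
      · rfl
    · simp
  have inner : ∀ x i p j, x = blockStart dv i + p → p < dv i → blockStart cv j ≤ x →
      x < blockStart cv j + cv j → blockStart cv j + cv j ≤ blockStart dv i + dv i →
      v i p = 0 := by
    intro x
    induction x using Nat.strong_induction_on with
    | _ x ih =>
      intro i p j hx hp hjx hxj hend
      have hij : BlocksMeet dv cv i j := ⟨by omega, by omega⟩
      have hoff : windowOffset dv cv i j = blockStart cv j - blockStart dv i := by
        have := hij.le hcv h
        rw [windowOffset]
        omega
      refine solve i p j hij (by omega) (by omega) fun i' hne hi'j => ?_
      have hi'le := hi'j.le hcv h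
      obtain ⟨hi'₁, hi'₂⟩ := hi'j
      rcases lt_or_gt_of_ne hne with hlt | hlt
      · have := blockStart_add_le dv hlt
        omega
      · have hblock := blockStart_add_le dv hlt
        have hoff' : windowOffset dv cv i' j = dv i' - cv j := by
          rw [windowOffset]
          omega
        have hq : windowOffset dv cv i' j + (p - windowOffset dv cv i j) < dv i' := by omega
        obtain ⟨j', hj'₁, hj'₂⟩ := cover i' _ hq
        have hjj' : j < j' := by
          by_contra! hle
          rcases hle.eq_or_lt with rfl | hlt'
          · omega
          · have := blockStart_add_le cv hlt'
            omega
        have := blockStart_add_le cv hjj'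
        exact ih _ (by omega) i' _ j' rfl hq hj'₁ hj'₂ (by omega)
  induction i using WellFoundedLT.induction generalizing p with
  | _ i ih =>
    obtain ⟨j, hj₁, hj₂⟩ := cover i p hp
    by_cases hend : blockStart cv j + cv j ≤ blockStart dv i + dv i
    · exact inner _ i p j rfl hp hj₁ hj₂ hend
    · have hij : BlocksMeet dv cv i j := ⟨by omega, by omega⟩
      have hle := hij.le hcv h
      have hoff : windowOffset dv cv i j = dv i - cv j := by
        rw [windowOffset]
        omega
      refine solve i p j hij (by omega) (by omega) fun i' hne hi'j => ?_
      have hi'le := hi'j.le hcv h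
      rcases lt_or_gt_of_ne hne with hlt | hlt
      · refine ih i' hlt _ ?_
        have hblock := blockStart_add_le dv hlt
        have hoff' : windowOffset dv cv i' j ≤ dv i' - cv j := min_le_right _ _
        omega
      · have := blockStart_add_le dv hlt
        have := hi'j.2
        have := hi'j.1
        omega

end Windows

section WindowMap

variable {ι ι' : Type} [Fintype ι] {u : ι → ℕ} {u' : ι' → ℕ} {T : ι → ι' → Prop}
  [∀ i j, Decidable (T i j)] {s : ι → ι' → ℕ}

/-- The map whose component from the `i`-th to the `j`-th summand, for `T i j`, cuts out the window
of length `u' j` at offset `s i j`. -/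
def windowMap (k : Type) [Field k] (hT : ∀ i j, T i j → s i j + u' j ≤ u i) :
    ((Σ i, Fin (u i)) → k) →ₗ[k] ((Σ j, Fin (u' j)) → k) :=
  LinearMap.pi fun t => ∑ i, if h : T i t.1 then
    LinearMap.proj ⟨i, ⟨s i t.1 + t.2, by have := hT i t.1 h; have := t.2.2; omega⟩⟩ else 0

theorem windowMap_apply (hT : ∀ i j, T i j → s i j + u' j ≤ u i) (v : (Σ i, Fin (u i)) → k)
    (t : Σ j, Fin (u' j)) :
    windowMap k hT v t = ∑ i, if h : T i t.1 then
      v ⟨i, ⟨s i t.1 + t.2, by have := hT i t.1 h; have := t.2.2; omega⟩⟩ else 0 := by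
  simp only [windowMap, LinearMap.pi_apply, LinearMap.sum_apply]
  refine Finset.sum_congr rfl fun i _ => ?_
  split_ifs <;> rfl

end WindowMap

/-- The components of the embedding: windows between the positive summands, and the inclusion of
the first `d` summands `Inj k 0`. -/
def Linked {n m d c : ℕ} (dv : Fin n → ℕ) (cv : Fin m → ℕ) : Fin n ⊕ Fin d → Fin m ⊕ Fin c → Prop
  | Sum.inl i, Sum.inl j => BlocksMeet dv cv i j
  | Sum.inr i, Sum.inr j => (i : ℕ) = j
  | _, _ => False

/-- The offsets of the components of the embedding. -/
def linkOffset {n m d c : ℕ} (dv : Fin n → ℕ) (cv : Fin m → ℕ) : Fin n ⊕ Fin d → Fin m ⊕ Fin c → ℕ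
  | Sum.inl i, Sum.inl j => windowOffset dv cv i j
  | _, _ => 0

theorem nonempty_sumInjEmbedding {n m d c : ℕ} {dv : Fin n → ℕ} {cv : Fin m → ℕ}
    (hcv : Antitone cv) (hdc : d ≤ c)
    (h : ∀ i, ∑ j with i ≤ j, dv j ≤ ∑ j with cv j ≤ dv i, cv j) (hdv0 : ∀ i, 0 < dv i) :
    Nonempty (SumInjEmbedding k (Sum.elim dv (fun _ => 0) : Fin n ⊕ Fin d → ℕ)
      (Sum.elim cv (fun _ => 0) : Fin m ⊕ Fin c → ℕ)) := by
  classical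
  set w : Fin n ⊕ Fin d → ℕ := Sum.elim dv fun _ => 0 with hw
  set w' : Fin m ⊕ Fin c → ℕ := Sum.elim cv fun _ => 0 with hw'
  have fit : ∀ i j, Linked dv cv i j → linkOffset dv cv i j + w' j ≤ w i := by
    rintro (i | i) (j | j) hij
    · have := BlocksMeet.le hcv h hij
      have : windowOffset dv cv i j ≤ dv i - cv j := min_le_right _ _
      simp only [linkOffset, hw, hw', Sum.elim_inl]
      omega
    · exact hij.elim
    · exact hij.elim
    · exact le_rfl
  have fit' : ∀ i j, Linked dv cv i j → linkOffset dv cv i j + (w' j + 1) ≤ w i + 1 :=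
    fun i j hij => Nat.succ_le_succ (fit i j hij)
  have comm₁ : ∀ v t, windowMap k fit (fun s => v ⟨s.1, s.2.castSucc⟩) t =
      windowMap k fit' v ⟨t.1, t.2.castSucc⟩ := by
    intro v t
    rw [windowMap_apply, windowMap_apply]
    rfl
  have comm₂ : ∀ v t, windowMap k fit (fun s => v ⟨s.1, s.2.succ⟩) t =
      windowMap k fit' v ⟨t.1, t.2.succ⟩ := by
    intro v t
    rw [windowMap_apply, windowMap_apply]
    rfl
  have inj₁ : Function.Injective (windowMap k fit) := by
    rw [injective_iff_map_eq_zero]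
    intro v hv
    have hwin := eq_zero_of_window_sums hcv h
      (fun i p => if hp : p < dv i then v ⟨Sum.inl i, ⟨p, hp⟩⟩ else 0) fun j l hl => by
        have hjl := congrFun hv ⟨Sum.inl j, ⟨l, hl⟩⟩
        rw [windowMap_apply, Fintype.sum_sum_type] at hjl
        rw [Finset.sum_eq_zero (s := (univ : Finset (Fin d))) fun i _ => dif_neg id,
          add_zero] at hjl
        refine Eq.trans (Finset.sum_congr rfl fun i _ => ?_) hjl
        by_cases hij : BlocksMeet dv cv i j
        · have := fit (Sum.inl i) (Sum.inl j) hij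
          rw [if_pos hij, dif_pos (show Linked dv cv (Sum.inl i) (Sum.inl j) from hij)]
          exact dif_pos _
        · rw [if_neg hij, dif_neg (show ¬ Linked dv cv (Sum.inl i) (Sum.inl j) from hij)]
    funext ⟨i, p⟩
    rcases i with i | i
    · exact (dif_pos p.2).symm.trans (hwin i p p.2)
    · exact p.elim0
  refine ⟨⟨windowMap k fit, windowMap k fit', comm₁, comm₂, inj₁, ?_⟩⟩
  rw [injective_iff_map_eq_zero]
  intro v hv
  have hA := (injective_iff_map_eq_zero _).mp inj₁ (fun s => v ⟨s.1, s.2.castSucc⟩) (by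
    funext t; rw [comm₁, hv]; rfl)
  have hB := (injective_iff_map_eq_zero _).mp inj₁ (fun s => v ⟨s.1, s.2.succ⟩) (by
    funext t; rw [comm₂, hv]; rfl)
  funext ⟨i, p⟩
  rcases i with i | i
  · refine Fin.cases ?_ (fun q => ?_) p
    · exact congrFun hA ⟨Sum.inl i, ⟨0, hdv0 i⟩⟩
    · exact congrFun hB ⟨Sum.inl i, q⟩
  · have hi := congrFun hv ⟨Sum.inr (Fin.castLE hdc i), 0⟩
    rw [windowMap_apply, Finset.sum_eq_single (Sum.inr i),
      dif_pos (show Linked dv cv (Sum.inr i) (Sum.inr (Fin.castLE hdc i)) from rfl)] at hi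
    · rw [Subsingleton.elim (α := Fin 1) p 0]
      exact hi
    · rintro (i' | i') _ hne
      · exact dif_neg id
      · exact dif_neg fun hlink => hne (congrArg Sum.inr (Fin.ext hlink))
    · simp

theorem sum_filter_elim_zero {ι ι' : Type*} [Fintype ι] [Fintype ι'] (u : ι → ℕ) (D : ℕ) :
    ∑ i with (Sum.elim u (fun _ => 0) : ι ⊕ ι' → ℕ) i ≤ D,
      (Sum.elim u (fun _ => 0) : ι ⊕ ι' → ℕ) i = ∑ i with u i ≤ D, u i := by
  rw [Finset.sum_filter, Finset.sum_filter, Fintype.sum_sum_type]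
  exact (congrArg₂ (· + ·) rfl (Finset.sum_eq_zero fun _ _ => ite_self _)).trans (add_zero _)

/-- Numerical criterion for the existence of a monomorphism
`I_{d₁} ⊕ … ⊕ I_{dₙ} ⊕ d·I₀ → I_{c₁} ⊕ … ⊕ I_{c_m} ⊕ c·I₀`
between preinjective Kronecker representations. -/
theorem preinjective_embedding_criterion (n m d c : ℕ)
    (dv : Fin n → ℕ) (cv : Fin m → ℕ)
    (hdv : Antitone dv) (hcv : Antitone cv)
    (hdv0 : ∀ i, 0 < dv i) (hcv0 : ∀ j, 0 < cv j) :
    (∃ f : KHom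
        (KRep.dsumList (List.ofFn (fun i => KRep.Inj k (dv i)) ++
          List.replicate d (KRep.Inj k 0)))
        (KRep.dsumList (List.ofFn (fun j => KRep.Inj k (cv j)) ++
          List.replicate c (KRep.Inj k 0))), f.Mono) ↔
      d ≤ c ∧ ∀ i : Fin n,
        (∑ j ∈ Finset.univ.filter (fun j => i ≤ j), dv j) ≤
          ∑ j ∈ Finset.univ.filter (fun j => cv j ≤ dv i), cv j := by
  rw [(KRep.isSumInj_dsumList_ofFn_append_replicate dv d).exists_mono_iff
    (KRep.isSumInj_dsumList_ofFn_append_replicate cv c)]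
  constructor
  · rintro ⟨g⟩
    refine ⟨?_, fun i => ?_⟩
    · have h := g.sum_le_sum₂ 0
      simpa [Finset.sum_filter, Fintype.sum_sum_type, (hdv0 _).ne', (hcv0 _).ne'] using h
    · have h := g.sum_le_sum₁ (dv i)
      rw [sum_filter_elim_zero, sum_filter_elim_zero] at h
      refine le_trans (Finset.sum_le_sum_of_subset fun x hx => ?_) h
      simp only [mem_filter, mem_univ, true_and] at hx ⊢
      exact hdv hx
  · rintro ⟨hdc, h⟩
    exact nonempty_sumInjEmbedding hcv hdc h hdv0
end

section
/- Let I′ = a₀I₀ ⊕ a₁I₁ ⊕ … ⊕ aₙIₙ and I = b₀I₀ ⊕ b₁I₁ ⊕ … ⊕ bₙIₙ be preinjective Kronecker representations (aᵢ, bᵢ ∈ ℕ multiplicities). There exists a monomorphism I′ → I if and only if a₀ ≤ b₀ and for every t with 1 ≤ t ≤ n, Σ_{i=1}^{t} i·aᵢ ≤ Σ_{i=1}^{t} i·bᵢ. -/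
open Matrix Finset

variable {k : Type} [Field k]

namespace KHom

variable {L M N : KRep k}

theorem mono_iff (f : KHom M N) :
    f.Mono ↔ (∀ v, f.f1 *ᵥ v = 0 → v = 0) ∧ ∀ v, f.f2 *ᵥ v = 0 → v = 0 := by
  simp only [KHom.Mono, injective_iff_map_eq_zero, Matrix.mulVecLin_apply]

/-- The zero morphism. -/
def zero (M N : KRep k) : KHom M N := ⟨0, 0, by simp, by simp⟩

/-- The sum of two morphisms. -/
def add (f g : KHom M N) : KHom M N where
  f1 := f.f1 + g.f1
  f2 := f.f2 + g.f2
  comm_a := by rw [Matrix.add_mul, Matrix.mul_add, f.comm_a, g.comm_a]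
  comm_b := by rw [Matrix.add_mul, Matrix.mul_add, f.comm_b, g.comm_b]

/-- The composite of two morphisms. -/
def comp (g : KHom M N) (f : KHom L M) : KHom L N where
  f1 := g.f1 * f.f1
  f2 := g.f2 * f.f2
  comm_a := by rw [Matrix.mul_assoc, f.comm_a, ← Matrix.mul_assoc, g.comm_a, Matrix.mul_assoc]
  comm_b := by rw [Matrix.mul_assoc, f.comm_b, ← Matrix.mul_assoc, g.comm_b, Matrix.mul_assoc]

theorem comp_f1_mulVec (g : KHom M N) (f : KHom L M) (v : Fin L.d1 → k) :
    (g.comp f).f1 *ᵥ v = g.f1 *ᵥ (f.f1 *ᵥ v) :=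
  (Matrix.mulVec_mulVec _ _ _).symm

theorem comp_f2_mulVec (g : KHom M N) (f : KHom L M) (v : Fin L.d2 → k) :
    (g.comp f).f2 *ᵥ v = g.f2 *ᵥ (f.f2 *ᵥ v) :=
  (Matrix.mulVec_mulVec _ _ _).symm

theorem add_f1_mulVec (f g : KHom M N) (v : Fin M.d1 → k) :
    (f.add g).f1 *ᵥ v = f.f1 *ᵥ v + g.f1 *ᵥ v :=
  Matrix.add_mulVec _ _ _

theorem Mono.comp {g : KHom M N} {f : KHom L M} (hg : g.Mono) (hf : f.Mono) :
    (g.comp f).Mono := by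
  rw [mono_iff] at *
  refine ⟨fun v hv => hf.1 v (hg.1 _ ?_), fun v hv => hf.2 v (hg.2 _ ?_)⟩ <;>
    simpa [KHom.comp, Matrix.mulVec_mulVec] using hv

/-- The matrix of the first projection `k ^ (p + q) → k ^ p`. -/
def fstMatrix (k : Type) [Field k] (p q : ℕ) : Matrix (Fin p) (Fin (p + q)) k :=
  (Matrix.fromCols 1 0).submatrix id finSumFinEquiv.symm

/-- The matrix of the second projection `k ^ (p + q) → k ^ q`. -/
def sndMatrix (k : Type) [Field k] (p q : ℕ) : Matrix (Fin q) (Fin (p + q)) k :=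
  (Matrix.fromCols 0 1).submatrix id finSumFinEquiv.symm

/-- The matrix of the first inclusion `k ^ p → k ^ (p + q)`. -/
def inlMatrix (k : Type) [Field k] (p q : ℕ) : Matrix (Fin (p + q)) (Fin p) k :=
  (Matrix.fromRows 1 0).submatrix finSumFinEquiv.symm id

/-- The matrix of the second inclusion `k ^ q → k ^ (p + q)`. -/
def inrMatrix (k : Type) [Field k] (p q : ℕ) : Matrix (Fin (p + q)) (Fin q) k :=
  (Matrix.fromRows 0 1).submatrix finSumFinEquiv.symm id

section

variable {p q r s : ℕ} (C : Matrix (Fin p) (Fin q) k) (D : Matrix (Fin r) (Fin s) k)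

theorem fstMatrix_comm :
    fstMatrix k p r * Matrix.reindex finSumFinEquiv finSumFinEquiv (Matrix.fromBlocks C 0 0 D) =
      C * fstMatrix k q s := by
  ext i j
  cases h : finSumFinEquiv.symm j <;>
    simp [fstMatrix, Matrix.mul_apply, Fin.sum_univ_add, Matrix.one_apply, h]

theorem sndMatrix_comm :
    sndMatrix k p r * Matrix.reindex finSumFinEquiv finSumFinEquiv (Matrix.fromBlocks C 0 0 D) =
      D * sndMatrix k q s := by
  ext i j
  cases h : finSumFinEquiv.symm j <;>
    simp [sndMatrix, Matrix.mul_apply, Fin.sum_univ_add, Matrix.one_apply, h]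

theorem inlMatrix_comm :
    inlMatrix k p r * C =
      Matrix.reindex finSumFinEquiv finSumFinEquiv (Matrix.fromBlocks C 0 0 D) *
        inlMatrix k q s := by
  ext i j
  cases h : finSumFinEquiv.symm i <;>
    simp [inlMatrix, Matrix.mul_apply, Fin.sum_univ_add, Matrix.one_apply, h]

theorem inrMatrix_comm :
    inrMatrix k p r * D =
      Matrix.reindex finSumFinEquiv finSumFinEquiv (Matrix.fromBlocks C 0 0 D) *
        inrMatrix k q s := by
  ext i j
  cases h : finSumFinEquiv.symm i <;>
    simp [inrMatrix, Matrix.mul_apply, Fin.sum_univ_add, Matrix.one_apply, h]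

end

/-- The first projection of a direct sum. -/
def fst (M N : KRep k) : KHom (M.dsum N) M where
  f1 := fstMatrix k M.d1 N.d1
  f2 := fstMatrix k M.d2 N.d2
  comm_a := fstMatrix_comm M.A N.A
  comm_b := fstMatrix_comm M.B N.B

/-- The second projection of a direct sum. -/
def snd (M N : KRep k) : KHom (M.dsum N) N where
  f1 := sndMatrix k M.d1 N.d1
  f2 := sndMatrix k M.d2 N.d2
  comm_a := sndMatrix_comm M.A N.A
  comm_b := sndMatrix_comm M.B N.B

/-- The first inclusion into a direct sum. -/
def inl (M N : KRep k) : KHom M (M.dsum N) where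
  f1 := inlMatrix k M.d1 N.d1
  f2 := inlMatrix k M.d2 N.d2
  comm_a := inlMatrix_comm M.A N.A
  comm_b := inlMatrix_comm M.B N.B

/-- The second inclusion into a direct sum. -/
def inr (M N : KRep k) : KHom N (M.dsum N) where
  f1 := inrMatrix k M.d1 N.d1
  f2 := inrMatrix k M.d2 N.d2
  comm_a := inrMatrix_comm M.A N.A
  comm_b := inrMatrix_comm M.B N.B

/-- The morphism into a direct sum with given components. -/
def pair (f : KHom L M) (g : KHom L N) : KHom L (M.dsum N) :=
  ((inl M N).comp f).add ((inr M N).comp g)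

theorem fstMatrix_mulVec {p q : ℕ} (v : Fin (p + q) → k) :
    fstMatrix k p q *ᵥ v = fun i => v (Fin.castAdd q i) := by
  ext i
  simp [fstMatrix, Matrix.mulVec, dotProduct, Fin.sum_univ_add, Matrix.one_apply]

theorem sndMatrix_mulVec {p q : ℕ} (v : Fin (p + q) → k) :
    sndMatrix k p q *ᵥ v = fun i => v (Fin.natAdd p i) := by
  ext i
  simp [sndMatrix, Matrix.mulVec, dotProduct, Fin.sum_univ_add, Matrix.one_apply]

theorem fst_f1_mulVec (v : Fin (M.d1 + N.d1) → k) :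
    (fst M N).f1 *ᵥ v = fun i => v (Fin.castAdd _ i) :=
  fstMatrix_mulVec v

theorem fst_f2_mulVec (v : Fin (M.d2 + N.d2) → k) :
    (fst M N).f2 *ᵥ v = fun i => v (Fin.castAdd _ i) :=
  fstMatrix_mulVec v

theorem snd_f1_mulVec (v : Fin (M.d1 + N.d1) → k) :
    (snd M N).f1 *ᵥ v = fun i => v (Fin.natAdd _ i) :=
  sndMatrix_mulVec v

theorem snd_f2_mulVec (v : Fin (M.d2 + N.d2) → k) :
    (snd M N).f2 *ᵥ v = fun i => v (Fin.natAdd _ i) :=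
  sndMatrix_mulVec v

theorem eq_zero_of_fst_snd_f1 {v : Fin (M.d1 + N.d1) → k} (h₁ : (fst M N).f1 *ᵥ v = 0)
    (h₂ : (snd M N).f1 *ᵥ v = 0) : v = 0 := by
  rw [fst_f1_mulVec] at h₁
  rw [snd_f1_mulVec] at h₂
  ext i
  exact Fin.addCases (fun i => congrFun h₁ i) (fun i => congrFun h₂ i) i

theorem eq_zero_of_fst_snd_f2 {v : Fin (M.d2 + N.d2) → k} (h₁ : (fst M N).f2 *ᵥ v = 0)
    (h₂ : (snd M N).f2 *ᵥ v = 0) : v = 0 := by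
  rw [fst_f2_mulVec] at h₁
  rw [snd_f2_mulVec] at h₂
  ext i
  exact Fin.addCases (fun i => congrFun h₁ i) (fun i => congrFun h₂ i) i

theorem inlMatrix_add_inrMatrix_mulVec_eq_zero {m p q : ℕ}
    {C : Matrix (Fin p) (Fin m) k} {D : Matrix (Fin q) (Fin m) k} {v : Fin m → k}
    (h : (inlMatrix k p q * C + inrMatrix k p q * D) *ᵥ v = 0) : C *ᵥ v = 0 ∧ D *ᵥ v = 0 := by
  rw [Matrix.add_mulVec, ← Matrix.mulVec_mulVec, ← Matrix.mulVec_mulVec] at h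
  generalize C *ᵥ v = c at h ⊢
  generalize D *ᵥ v = d at h ⊢
  constructor <;> ext i
  · simpa [inlMatrix, inrMatrix, Matrix.mulVec, dotProduct, Matrix.one_apply] using
      congrFun h (Fin.castAdd q i)
  · simpa [inlMatrix, inrMatrix, Matrix.mulVec, dotProduct, Matrix.one_apply] using
      congrFun h (Fin.natAdd p i)

theorem pair_f1_eq_zero {f : KHom L M} {g : KHom L N} {v : Fin L.d1 → k}
    (h : (pair f g).f1 *ᵥ v = 0) : f.f1 *ᵥ v = 0 ∧ g.f1 *ᵥ v = 0 :=
  inlMatrix_add_inrMatrix_mulVec_eq_zero h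

theorem pair_f2_eq_zero {f : KHom L M} {g : KHom L N} {v : Fin L.d2 → k}
    (h : (pair f g).f2 *ᵥ v = 0) : f.f2 *ᵥ v = 0 ∧ g.f2 *ᵥ v = 0 :=
  inlMatrix_add_inrMatrix_mulVec_eq_zero h

/-- Both components of the morphism vanish. -/
def IsZero (f : KHom M N) : Prop := f.f1 = 0 ∧ f.f2 = 0

theorem eq_zero_of_mul_inlMatrix_inrMatrix {m p q : ℕ}
    {C : Matrix (Fin m) (Fin (p + q)) k} (h₁ : C * inlMatrix k p q = 0)
    (h₂ : C * inrMatrix k p q = 0) : C = 0 := by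
  ext i j
  refine Fin.addCases (fun j => ?_) (fun j => ?_) j
  · simpa [inlMatrix, Matrix.mul_apply, Fin.sum_univ_add, Matrix.one_apply] using
      congrFun (congrFun h₁ i) j
  · simpa [inrMatrix, Matrix.mul_apply, Fin.sum_univ_add, Matrix.one_apply] using
      congrFun (congrFun h₂ i) j

theorem IsZero.of_inl_inr {f : KHom (L.dsum M) N} (h₁ : (f.comp (inl L M)).IsZero)
    (h₂ : (f.comp (inr L M)).IsZero) : f.IsZero :=
  ⟨eq_zero_of_mul_inlMatrix_inrMatrix h₁.1 h₂.1, eq_zero_of_mul_inlMatrix_inrMatrix h₁.2 h₂.2⟩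

end KHom

namespace KRep

/-- The matrix `A` of `I n`, with its dimensions made explicit. -/
def injA (k : Type) [Field k] (n : ℕ) : Matrix (Fin n) (Fin (n + 1)) k := (Inj k n).A

/-- The matrix `B` of `I n`, with its dimensions made explicit. -/
def injB (k : Type) [Field k] (n : ℕ) : Matrix (Fin n) (Fin (n + 1)) k := (Inj k n).B

theorem injA_mul {n m : ℕ} (C : Matrix (Fin (n + 1)) (Fin m) k) (i : Fin n) (j : Fin m) :
    (injA k n * C) i j = C i.castSucc j := by
  change ∑ x : Fin (n + 1), (if (i : ℕ) = (x : ℕ) then (1 : k) else 0) * C x j = _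
  rw [Finset.sum_eq_single i.castSucc]
  · simp
  · intro x _ hx
    rw [if_neg (fun h => hx (Fin.ext h.symm)), zero_mul]
  · simp

theorem injB_mul {n m : ℕ} (C : Matrix (Fin (n + 1)) (Fin m) k) (i : Fin n) (j : Fin m) :
    (injB k n * C) i j = C i.succ j := by
  change ∑ x : Fin (n + 1), (if (i : ℕ) + 1 = (x : ℕ) then (1 : k) else 0) * C x j = _
  rw [Finset.sum_eq_single i.succ]
  · simp
  · intro x _ hx
    rw [if_neg (fun h => hx (Fin.ext h.symm)), zero_mul]
  · simp

theorem mul_injA_castSucc {n m : ℕ} (C : Matrix (Fin m) (Fin n) k) (i : Fin m) (j : Fin n) :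
    (C * injA k n) i j.castSucc = C i j := by
  change ∑ x : Fin n, C i x * (if (x : ℕ) = (j : ℕ) then (1 : k) else 0) = _
  simp [← Fin.ext_iff]

theorem mul_injA_last {n m : ℕ} (C : Matrix (Fin m) (Fin n) k) (i : Fin m) :
    (C * injA k n) i (Fin.last n) = 0 := by
  change ∑ x : Fin n, C i x * (if (x : ℕ) = n then (1 : k) else 0) = _
  exact Finset.sum_eq_zero fun x _ => by rw [if_neg x.2.ne, mul_zero]

theorem mul_injB_succ {n m : ℕ} (C : Matrix (Fin m) (Fin n) k) (i : Fin m) (j : Fin n) :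
    (C * injB k n) i j.succ = C i j := by
  change ∑ x : Fin n, C i x * (if (x : ℕ) + 1 = (j : ℕ) + 1 then (1 : k) else 0) = _
  simp [← Fin.ext_iff]

theorem mul_injB_zero {n m : ℕ} (C : Matrix (Fin m) (Fin n) k) (i : Fin m) :
    (C * injB k n) i 0 = 0 := by
  change ∑ x : Fin n, C i x * (if (x : ℕ) + 1 = 0 then (1 : k) else 0) = _
  simp

/-- The morphism `I l → I j` that selects `j` consecutive coordinates starting at `s`. -/
def window (k : Type) [Field k] (l j s : ℕ) (h : s + j ≤ l) : KHom (Inj k l) (Inj k j) where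
  f1 := fun p q => if (q : ℕ) = p + s then 1 else 0
  f2 := fun p q => if (q : ℕ) = p + s then 1 else 0
  comm_a := by
    ext p q
    refine Eq.trans ?_ (injA_mul _ p q).symm
    refine Fin.lastCases ?_ (fun q => ?_) q
    · refine (mul_injA_last _ p).trans ?_
      have := p.2
      change p.1 < j at this
      rw [if_neg]
      simp only [Fin.val_last, Fin.val_castSucc]
      omega
    · exact mul_injA_castSucc _ p q
  comm_b := by
    ext p q
    refine Eq.trans ?_ (injB_mul _ p q).symm
    refine Fin.cases ?_ (fun q => ?_) q
    · refine (mul_injB_zero _ p).trans ?_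
      refine (if_neg ?_).symm
      change ¬0 = p.1 + 1 + s
      omega
    · refine (mul_injB_succ _ p q).trans ?_
      simp only [Fin.val_succ]
      congr 1
      apply propext
      omega

theorem window_f1_mulVec {l j s : ℕ} (h : s + j ≤ l) (v : Fin l → k) (p : Fin j) :
    ((window k l j s h).f1 *ᵥ v : Fin j → k) p = v ⟨p + s, by omega⟩ := by
  change ∑ q : Fin l, (if (q : ℕ) = p + s then (1 : k) else 0) * v q = _
  rw [Finset.sum_eq_single ⟨p + s, by omega⟩]
  · simp
  · intro x _ hx
    rw [if_neg (fun h => hx (Fin.ext h)), zero_mul]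
  · simp

theorem isZero_hom_Inj_of_lt {i j : ℕ} (hij : i < j) (f : KHom (Inj k i) (Inj k j)) :
    f.IsZero := by
  obtain ⟨F, G, ha, hb⟩ := f
  change Matrix (Fin j) (Fin i) k at F
  change Matrix (Fin (j + 1)) (Fin (i + 1)) k at G
  have a1 (p : Fin j) (q : Fin i) : F p q = G p.castSucc q.castSucc :=
    (mul_injA_castSucc F p q).symm.trans
      ((congrFun (congrFun ha p) q.castSucc).trans (injA_mul G p q.castSucc))
  have a2 (p : Fin j) : G p.castSucc (Fin.last i) = 0 :=
    (injA_mul G p (Fin.last i)).symm.trans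
      ((congrFun (congrFun ha p) (Fin.last i)).symm.trans (mul_injA_last F p))
  have b1 (p : Fin j) (q : Fin i) : F p q = G p.succ q.succ :=
    (mul_injB_succ F p q).symm.trans
      ((congrFun (congrFun hb p) q.succ).trans (injB_mul G p q.succ))
  have b2 (p : Fin j) : G p.succ 0 = 0 :=
    (injB_mul G p 0).symm.trans
      ((congrFun (congrFun hb p) (0 : Fin (i + 1))).symm.trans (mul_injB_zero F p))
  have below : ∀ (q p : ℕ) (hq : q < i + 1) (hp : p < j + 1), q < p → G ⟨p, hp⟩ ⟨q, hq⟩ = 0 := by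
    intro q
    induction q with
    | zero =>
      intro p hq hp h
      obtain ⟨p, rfl⟩ := Nat.exists_eq_succ_of_ne_zero h.ne'
      exact b2 ⟨p, by omega⟩
    | succ q ih =>
      intro p hq hp h
      obtain ⟨p, rfl⟩ := Nat.exists_eq_succ_of_ne_zero (Nat.ne_zero_of_lt h)
      have e := (b1 ⟨p, by omega⟩ ⟨q, by omega⟩).symm.trans (a1 ⟨p, by omega⟩ ⟨q, by omega⟩)
      exact e.trans (ih p (by omega) (by omega) (by omega))
  have above : ∀ (d q p : ℕ) (hq : q < i + 1) (hp : p < j + 1), q + d = i → p ≤ q →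
      G ⟨p, hp⟩ ⟨q, hq⟩ = 0 := by
    intro d
    induction d with
    | zero =>
      intro q p hq hp h hpq
      obtain rfl : q = i := h
      exact a2 ⟨p, by omega⟩
    | succ d ih =>
      intro q p hq hp h hpq
      have e := (a1 ⟨p, by omega⟩ ⟨q, by omega⟩).symm.trans (b1 ⟨p, by omega⟩ ⟨q, by omega⟩)
      exact e.trans (ih (q + 1) (p + 1) (by omega) (by omega) (by omega) (by omega))
  have hG : G = 0 := by
    ext p q
    rcases lt_or_ge q.1 p.1 with h | h
    · exact below q p q.2 p.2 h
    · exact above (i - q) q p q.2 p.2 (by omega) h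
  refine ⟨?_, hG⟩
  ext p q
  exact (a1 p q).trans (by rw [hG]; rfl)

/-- The direct sum of the preinjective indecomposables indexed by a list. -/
def injSum (k : Type) [Field k] (l : List ℕ) : KRep k := dsumList (l.map (Inj k))

theorem injSum_d1 (l : List ℕ) : (injSum k l).d1 = l.sum := by
  induction l with
  | nil => rfl
  | cons x l ih => exact (congrArg (x + ·) ih).trans (List.sum_cons).symm

theorem injSum_replicate_zero_d2 (m : ℕ) : (injSum k (List.replicate m 0)).d2 = m := by
  induction m with
  | zero => rfl
  | succ m ih => exact (congrArg (1 + ·) ih).trans (add_comm _ _)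

theorem exists_mono_dsum_right {X Y Z : KRep k} (h : ∃ f : KHom X Y, f.Mono) :
    ∃ f : KHom (Z.dsum X) (Z.dsum Y), f.Mono := by
  obtain ⟨f, hf⟩ := h
  rw [KHom.mono_iff] at hf
  refine ⟨KHom.pair (KHom.fst Z X) (f.comp (KHom.snd Z X)),
    (KHom.mono_iff _).2 ⟨fun v hv => ?_, fun v hv => ?_⟩⟩
  · obtain ⟨h₁, h₂⟩ := KHom.pair_f1_eq_zero hv
    rw [KHom.comp_f1_mulVec] at h₂
    exact KHom.eq_zero_of_fst_snd_f1 h₁ (hf.1 _ h₂)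
  · obtain ⟨h₁, h₂⟩ := KHom.pair_f2_eq_zero hv
    rw [KHom.comp_f2_mulVec] at h₂
    exact KHom.eq_zero_of_fst_snd_f2 h₁ (hf.2 _ h₂)

theorem exists_mono_injSum_append (l l' : List ℕ) :
    ∃ f : KHom (injSum k l) (injSum k (l ++ l')), f.Mono := by
  induction l with
  | nil =>
    refine ⟨KHom.zero _ _, (KHom.mono_iff _).2 ⟨fun v _ => ?_, fun v _ => ?_⟩⟩ <;>
      exact funext fun i => Fin.elim0 i
  | cons x l ih => exact exists_mono_dsum_right (Z := Inj k x) ih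

theorem isZero_injSum_hom {l : List ℕ} {N : KRep k}
    (h : ∀ x ∈ l, ∀ f : KHom (Inj k x) N, f.IsZero) (f : KHom (injSum k l) N) : f.IsZero := by
  induction l with
  | nil => exact ⟨by ext _ j; exact Fin.elim0 j, by ext _ j; exact Fin.elim0 j⟩
  | cons x l ih =>
    exact KHom.IsZero.of_inl_inr (L := Inj k x) (M := injSum k l) (h x (by simp) _)
      (ih (fun y hy => h y (by simp [hy])) _)

theorem eq_zero_of_hom_injSum {l : List ℕ} {M : KRep k}
    (h : ∀ x ∈ l, ∀ f : KHom M (Inj k x), f.IsZero) (f : KHom M (injSum k l)) :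
    (∀ v, f.f1 *ᵥ v = 0) ∧ ∀ v, f.f2 *ᵥ v = 0 := by
  induction l with
  | nil => exact ⟨fun v => funext fun i => Fin.elim0 i, fun v => funext fun i => Fin.elim0 i⟩
  | cons x l ih =>
    have h₁ := h x (by simp) ((KHom.fst (Inj k x) (injSum k l)).comp f)
    have h₂ := ih (fun y hy => h y (by simp [hy])) ((KHom.snd (Inj k x) (injSum k l)).comp f)
    refine ⟨fun v => KHom.eq_zero_of_fst_snd_f1 ?_ ?_, fun v => KHom.eq_zero_of_fst_snd_f2 ?_ ?_⟩
    · exact (KHom.comp_f1_mulVec _ _ v).symm.trans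
        ((congrArg (· *ᵥ v) h₁.1).trans (Matrix.zero_mulVec v))
    · exact (KHom.comp_f1_mulVec _ _ v).symm.trans (h₂.1 v)
    · exact (KHom.comp_f2_mulVec _ _ v).symm.trans
        ((congrArg (· *ᵥ v) h₁.2).trans (Matrix.zero_mulVec v))
    · exact (KHom.comp_f2_mulVec _ _ v).symm.trans (h₂.2 v)

theorem exists_hom_injSum_of_append {l l' : List ℕ} {M : KRep k}
    (h : ∀ x ∈ l', ∀ f : KHom M (Inj k x), f.IsZero) (f : KHom M (injSum k (l ++ l'))) :
    ∃ g : KHom M (injSum k l), (∀ v, g.f1 *ᵥ v = 0 → f.f1 *ᵥ v = 0) ∧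
      ∀ v, g.f2 *ᵥ v = 0 → f.f2 *ᵥ v = 0 := by
  induction l with
  | nil =>
    obtain ⟨h₁, h₂⟩ := eq_zero_of_hom_injSum h f
    exact ⟨KHom.zero _ _, fun v _ => h₁ v, fun v _ => h₂ v⟩
  | cons x l ih =>
    obtain ⟨g, hg₁, hg₂⟩ := ih ((KHom.snd (Inj k x) (injSum k (l ++ l'))).comp f)
    refine ⟨KHom.pair ((KHom.fst (Inj k x) (injSum k (l ++ l'))).comp f) g,
      fun v hv => ?_, fun v hv => ?_⟩
    · obtain ⟨h₁, h₂⟩ := KHom.pair_f1_eq_zero hv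
      exact KHom.eq_zero_of_fst_snd_f1 ((KHom.comp_f1_mulVec _ _ v).symm.trans h₁)
        ((KHom.comp_f1_mulVec _ _ v).symm.trans (hg₁ v h₂))
    · obtain ⟨h₁, h₂⟩ := KHom.pair_f2_eq_zero hv
      exact KHom.eq_zero_of_fst_snd_f2 ((KHom.comp_f2_mulVec _ _ v).symm.trans h₁)
        ((KHom.comp_f2_mulVec _ _ v).symm.trans (hg₂ v h₂))

theorem exists_mono_injSum_of_append {l₁ l₂ m₁ m₂ : List ℕ} (h : ∀ x ∈ l₁, ∀ y ∈ m₂, x < y)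
    {f : KHom (injSum k (l₁ ++ l₂)) (injSum k (m₁ ++ m₂))} (hf : f.Mono) :
    ∃ g : KHom (injSum k l₁) (injSum k m₁), g.Mono := by
  obtain ⟨i, hi⟩ := exists_mono_injSum_append (k := k) l₁ l₂
  obtain ⟨g, hg₁, hg₂⟩ := exists_hom_injSum_of_append
    (fun y hy => isZero_injSum_hom fun x hx => isZero_hom_Inj_of_lt (h x hx y hy)) (f.comp i)
  have hfi := (KHom.mono_iff _).1 (hf.comp hi)
  exact ⟨g, (KHom.mono_iff _).2 ⟨fun v hv => hfi.1 v (hg₁ v hv), fun v hv => hfi.2 v (hg₂ v hv)⟩⟩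

end KRep

theorem KHom.Mono.d1_le {M N : KRep k} {f : KHom M N} (hf : f.Mono) : M.d1 ≤ N.d1 := by
  simpa using LinearMap.finrank_le_finrank_of_injective hf.1

theorem KHom.Mono.d2_le {M N : KRep k} {f : KHom M N} (hf : f.Mono) : M.d2 ≤ N.d2 := by
  simpa using LinearMap.finrank_le_finrank_of_injective hf.2

namespace KRep

/-- Greedy construction of a map injective on the first component: consecutive blocks of the
target are matched with consecutive coordinates of the source, the first `r` coordinates of the
source being already accounted for. -/
theorem exists_hom_of_dominated (c : ℕ) : ∀ (x r : ℕ) (l m : List ℕ), l.length + m.length ≤ c →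
    r ≤ x → (x :: l).Pairwise (· ≤ ·) → m.Pairwise (· ≤ ·) →
    (∀ t, x ≤ t → x + (l.filter (· ≤ t)).sum ≤ (m.filter (· ≤ t)).sum + r) →
    ∃ f : KHom (injSum k (x :: l)) (injSum k m), ∀ v, f.f1 *ᵥ v = 0 →
      (∀ i : Fin x, (i : ℕ) < r → ((KHom.fst (Inj k x) (injSum k l)).f1 *ᵥ v : Fin x → k) i = 0) →
      v = 0 := by
  induction c using Nat.strong_induction_on with
  | _ c ih =>
  intro x r l m hc hr hl hm hd
  rcases hr.eq_or_lt with rfl | hr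
  · cases l with
    | nil =>
      refine ⟨KHom.zero _ _, fun v _ hv => ?_⟩
      exact KHom.eq_zero_of_fst_snd_f1 (funext fun i => hv i i.2) (funext fun i => Fin.elim0 i)
    | cons y l =>
      simp only [List.length_cons] at hc
      obtain ⟨hxy, hl⟩ := List.pairwise_cons.1 hl
      obtain ⟨f, hf⟩ := ih (l.length + m.length) (by omega) y 0 l m le_rfl (Nat.zero_le _) hl hm
        (fun t ht => by
          have := hd t ((hxy y (by simp)).trans ht)
          rw [List.filter_cons_of_pos (by simpa using ht), List.sum_cons] at this
          omega)
      refine ⟨f.comp (KHom.snd (Inj k r) (injSum k (y :: l))), fun v hv hv' => ?_⟩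
      exact KHom.eq_zero_of_fst_snd_f1 (funext fun i => hv' i i.2)
        (hf _ ((KHom.comp_f1_mulVec f _ v).symm.trans hv) fun i hi => absurd hi (Nat.not_lt_zero _))
  · cases m with
    | nil =>
      have := hd x le_rfl
      simp only [List.filter_nil, List.sum_nil] at this
      omega
    | cons j m =>
      simp only [List.length_cons] at hc
      obtain ⟨hjm, hm⟩ := List.pairwise_cons.1 hm
      have hjx : j ≤ x := by
        by_contra! hlt
        have := hd x le_rfl
        rw [List.filter_eq_nil_iff (l := j :: m) |>.2 (by
          intro y hy
          rcases List.mem_cons.1 hy with rfl | hy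
          · simpa using hlt
          · simpa using hlt.trans_le (hjm y hy))] at this
        simp only [List.sum_nil] at this
        omega
      have hd' : ∀ t, x ≤ t →
          x + (l.filter (· ≤ t)).sum ≤ j + (m.filter (· ≤ t)).sum + r := fun t ht => by
        have := hd t ht
        rwa [List.filter_cons_of_pos (by simpa using hjx.trans ht), List.sum_cons] at this
      by_cases hrj : r + j ≤ x
      · obtain ⟨f, hf⟩ := ih (l.length + m.length) (by omega) x (r + j) l m le_rfl hrj hl hm
          (fun t ht => by have := hd' t ht; omega)
        refine ⟨KHom.pair ((window k x j r hrj).comp (KHom.fst (Inj k x) (injSum k l))) f,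
          fun v hv hv' => ?_⟩
        obtain ⟨h₁, h₂⟩ := KHom.pair_f1_eq_zero hv
        refine hf v h₂ fun i hi => ?_
        rcases lt_or_ge i.1 r with hir | hir
        · exact hv' i hir
        · have h := (window_f1_mulVec hrj _ ⟨i - r, by omega⟩).symm.trans
            (congrFun ((KHom.comp_f1_mulVec _ _ v).symm.trans h₁) _)
          exact (congrArg _ (Fin.ext (Nat.sub_add_cancel hir).symm)).trans h
      · have hw : x - j + j ≤ x := by omega
        cases l with
        | nil =>
          refine ⟨KHom.pair ((window k x j (x - j) hw).comp (KHom.fst (Inj k x) (injSum k [])))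
            (KHom.zero _ (injSum k m)), fun v hv hv' => ?_⟩
          have h₁ := (KHom.pair_f1_eq_zero hv).1
          refine KHom.eq_zero_of_fst_snd_f1 (M := Inj k x) (N := injSum k [])
            (funext fun i => ?_) (funext fun i => Fin.elim0 i)
          change Fin x at i
          rcases lt_or_ge i.1 r with hir | hir
          · exact hv' i hir
          · have h := (window_f1_mulVec hw _ ⟨i - (x - j), by omega⟩).symm.trans
              (congrFun ((KHom.comp_f1_mulVec _ _ v).symm.trans h₁) _)
            exact (congrArg _ (Fin.ext (Nat.sub_add_cancel (by omega)).symm)).trans h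
        | cons y l =>
          simp only [List.length_cons] at hc
          obtain ⟨hxy, hl⟩ := List.pairwise_cons.1 hl
          replace hxy := hxy y (by simp)
          obtain ⟨f, hf⟩ := ih (l.length + m.length) (by omega) y (j - (x - r)) l m le_rfl
            (by omega) hl hm (fun t ht => by
              have := hd' t (hxy.trans ht)
              rw [List.filter_cons_of_pos (by simpa using ht), List.sum_cons] at this
              omega)
          have hw' : 0 + j ≤ y := by omega
          refine ⟨KHom.pair (((window k x j (x - j) hw).comp
            (KHom.fst (Inj k x) (injSum k (y :: l)))).add
            ((window k y j 0 hw').comp ((KHom.fst (Inj k y) (injSum k l)).comp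
              (KHom.snd (Inj k x) (injSum k (y :: l))))))
            (f.comp (KHom.snd (Inj k x) (injSum k (y :: l)))), fun v hv hv' => ?_⟩
          obtain ⟨h₁, h₂⟩ := KHom.pair_f1_eq_zero hv
          replace h₁ := (congrArg₂ (· + ·) (KHom.comp_f1_mulVec _ _ v)
            ((KHom.comp_f1_mulVec _ _ v).trans (congrArg _ (KHom.comp_f1_mulVec _ _ v)))).symm.trans
              ((KHom.add_f1_mulVec _ _ v).symm.trans h₁)
          replace h₂ := (KHom.comp_f1_mulVec f _ v).symm.trans h₂
          have key (i : Fin j) :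
              ((KHom.fst (Inj k x) (injSum k (y :: l))).f1 *ᵥ v : Fin x → k)
                ⟨i + (x - j), by omega⟩ +
              ((KHom.fst (Inj k y) (injSum k l)).f1 *ᵥ
                ((KHom.snd (Inj k x) (injSum k (y :: l))).f1 *ᵥ v) : Fin y → k)
                ⟨i, by omega⟩ = 0 :=
            (congrArg₂ (· + ·) (window_f1_mulVec hw _ i) (window_f1_mulVec hw' _ i)).symm.trans
              (congrFun h₁ i)
          have hsnd := hf _ h₂ fun i hi => by
            have h := key ⟨i, by omega⟩
            rwa [hv' ⟨i + (x - j), by omega⟩ (by simp only; omega), zero_add] at h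
          refine KHom.eq_zero_of_fst_snd_f1 (funext fun i => ?_) hsnd
          change Fin x at i
          rcases lt_or_ge i.1 r with hir | hir
          · exact hv' i hir
          · have h := congrFun ((congrArg (fun w => (KHom.fst (Inj k y) (injSum k l)).f1 *ᵥ w)
              hsnd).trans (Matrix.mulVec_zero _)) ⟨i - (x - j), by change _ < y; omega⟩
            exact (congrArg _ (Fin.ext (Nat.sub_add_cancel (by omega)).symm)).trans
              ((eq_neg_of_add_eq_zero_left (key ⟨i - (x - j), by omega⟩)).trans
                (neg_eq_zero.2 h))

theorem eq_zero_of_Inj_A_B {x : ℕ} (hx : 0 < x) {v : Fin (x + 1) → k}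
    (ha : (Inj k x).A *ᵥ v = 0) (hb : (Inj k x).B *ᵥ v = 0) : v = 0 := by
  have hA (i : Fin x) : v i.castSucc = 0 := by
    refine Eq.trans ?_ (congrFun ha i)
    exact (injA_mul (fun i (_ : Fin 1) => v i) i 0).symm
  have hB (i : Fin x) : v i.succ = 0 := by
    refine Eq.trans ?_ (congrFun hb i)
    exact (injB_mul (fun i (_ : Fin 1) => v i) i 0).symm
  exact funext fun i => Fin.cases (hA ⟨0, hx⟩) hB i

theorem eq_zero_of_injSum_A_B {l : List ℕ} (hl : ∀ x ∈ l, 0 < x) {v : Fin (injSum k l).d2 → k}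
    (ha : (injSum k l).A *ᵥ v = 0) (hb : (injSum k l).B *ᵥ v = 0) : v = 0 := by
  induction l with
  | nil => exact funext fun i => Fin.elim0 i
  | cons x l ih =>
    have hA {N : KRep k} (f : KHom (injSum k (x :: l)) N) : N.A *ᵥ (f.f2 *ᵥ v) = 0 := by
      rw [Matrix.mulVec_mulVec, ← f.comm_a, ← Matrix.mulVec_mulVec, ha, Matrix.mulVec_zero]
    have hB {N : KRep k} (f : KHom (injSum k (x :: l)) N) : N.B *ᵥ (f.f2 *ᵥ v) = 0 := by
      rw [Matrix.mulVec_mulVec, ← f.comm_b, ← Matrix.mulVec_mulVec, hb, Matrix.mulVec_zero]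
    exact KHom.eq_zero_of_fst_snd_f2 (M := Inj k x) (N := injSum k l)
      (eq_zero_of_Inj_A_B (hl x (by simp)) (hA (KHom.fst _ _)) (hB (KHom.fst _ _)))
      (ih (fun y hy => hl y (by simp [hy])) (hA (KHom.snd _ _)) (hB (KHom.snd _ _)))

theorem mono_of_injective_f1 {l : List ℕ} {N : KRep k} (hl : ∀ x ∈ l, 0 < x)
    {f : KHom (injSum k l) N} (hf : ∀ v, f.f1 *ᵥ v = 0 → v = 0) : f.Mono := by
  refine (KHom.mono_iff f).2 ⟨hf, fun v hv => eq_zero_of_injSum_A_B hl (hf _ ?_) (hf _ ?_)⟩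
  · rw [Matrix.mulVec_mulVec, f.comm_a, ← Matrix.mulVec_mulVec, hv, Matrix.mulVec_zero]
  · rw [Matrix.mulVec_mulVec, f.comm_b, ← Matrix.mulVec_mulVec, hv, Matrix.mulVec_zero]

theorem exists_mono_of_dominated {l m : List ℕ} (hl₀ : ∀ x ∈ l, 0 < x)
    (hl : l.Pairwise (· ≤ ·)) (hm : m.Pairwise (· ≤ ·))
    (hd : ∀ t, (l.filter (· ≤ t)).sum ≤ (m.filter (· ≤ t)).sum) :
    ∃ f : KHom (injSum k l) (injSum k m), f.Mono := by
  cases l with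
  | nil => exact ⟨KHom.zero _ _, mono_of_injective_f1 hl₀ fun v _ => funext fun i => Fin.elim0 i⟩
  | cons x l =>
    obtain ⟨f, hf⟩ := exists_hom_of_dominated (k := k) _ x 0 l m le_rfl (Nat.zero_le _) hl hm
      (fun t ht => by
        have := hd t
        rwa [List.filter_cons_of_pos (by simpa using ht), List.sum_cons] at this)
    exact ⟨f, mono_of_injective_f1 hl₀ fun v hv =>
      hf v hv fun i hi => absurd hi (Nat.not_lt_zero _)⟩

theorem exists_mono_into_dsum {X Y Z : KRep k} (h : ∃ f : KHom X Y, f.Mono) :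
    ∃ f : KHom X (Z.dsum Y), f.Mono := by
  obtain ⟨f, hf⟩ := h
  rw [KHom.mono_iff] at hf
  exact ⟨KHom.pair (KHom.zero X Z) f, (KHom.mono_iff _).2
    ⟨fun v hv => hf.1 v (KHom.pair_f1_eq_zero hv).2,
      fun v hv => hf.2 v (KHom.pair_f2_eq_zero hv).2⟩⟩

theorem exists_mono_replicate_append {l m : List ℕ} {p q : ℕ} (hpq : p ≤ q) (x : ℕ)
    (h : ∃ f : KHom (injSum k l) (injSum k m), f.Mono) :
    ∃ f : KHom (injSum k (List.replicate p x ++ l)) (injSum k (List.replicate q x ++ m)),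
      f.Mono := by
  induction q generalizing p with
  | zero =>
    obtain rfl : p = 0 := by omega
    exact h
  | succ q ih =>
    cases p with
    | zero => exact exists_mono_into_dsum (Z := Inj k x) (ih (Nat.zero_le _))
    | succ p => exact exists_mono_dsum_right (Z := Inj k x) (ih (by omega))

/-- The sorted list containing `a i` copies of `i` for `1 ≤ i ≤ n`. -/
def posList (a : ℕ → ℕ) (n : ℕ) : List ℕ :=
  (List.range n).flatMap fun i => List.replicate (a (i + 1)) (i + 1)

theorem posList_succ (a : ℕ → ℕ) (n : ℕ) :
    posList a (n + 1) = posList a n ++ List.replicate (a (n + 1)) (n + 1) := by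
  simp [posList, List.range_succ]

theorem multi_eq_injSum (a : ℕ → ℕ) (n : ℕ) :
    multi k a n = injSum k (List.replicate (a 0) 0 ++ posList a n) := by
  simp [multi, injSum, posList, List.range_succ_eq_map, List.flatMap_map, List.map_flatMap]

theorem mem_posList {a : ℕ → ℕ} {n x : ℕ} (hx : x ∈ posList a n) : 0 < x ∧ x ≤ n := by
  simp only [posList, List.mem_flatMap, List.mem_range, List.mem_replicate] at hx
  omega

theorem pairwise_posList (a : ℕ → ℕ) (n : ℕ) : (posList a n).Pairwise (· ≤ ·) := by
  induction n with
  | zero => simp [posList]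
  | succ n ih =>
    rw [posList_succ, List.pairwise_append]
    refine ⟨ih, by simp [List.pairwise_replicate], fun x hx y hy => ?_⟩
    rw [List.eq_of_mem_replicate hy]
    exact (mem_posList hx).2.trans (Nat.le_succ n)

theorem sum_posList (a : ℕ → ℕ) (n : ℕ) : (posList a n).sum = ∑ i ∈ Finset.Icc 1 n, i * a i := by
  induction n with
  | zero => simp [posList]
  | succ n ih =>
    rw [posList_succ, List.sum_append, ih, Finset.sum_Icc_succ_top (by omega), List.sum_replicate,
      smul_eq_mul, mul_comm]

theorem exists_posList_eq_append (a : ℕ → ℕ) {t n : ℕ} (h : t ≤ n) :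
    ∃ l, posList a n = posList a t ++ l ∧ ∀ x ∈ l, t < x := by
  induction n, h using Nat.le_induction with
  | base => exact ⟨[], by simp⟩
  | succ n h ih =>
    obtain ⟨l, hl, hlt⟩ := ih
    refine ⟨l ++ List.replicate (a (n + 1)) (n + 1), by rw [posList_succ, hl, List.append_assoc],
      fun x hx => ?_⟩
    rcases List.mem_append.1 hx with hx | hx
    · exact hlt x hx
    · rw [List.eq_of_mem_replicate hx]
      omega

theorem filter_posList (a : ℕ → ℕ) (n t : ℕ) :
    (posList a n).filter (· ≤ t) = posList a (min t n) := by
  obtain ⟨l, hl, hlt⟩ := exists_posList_eq_append a (min_le_right t n)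
  rcases le_total t n with h | h
  · rw [min_eq_left h] at *
    rw [hl, List.filter_append, List.filter_eq_self.2, List.filter_eq_nil_iff.2, List.append_nil]
    · simpa using hlt
    · intro x hx
      simpa using (mem_posList hx).2
  · rw [min_eq_right h, List.filter_eq_self.2]
    intro x hx
    simpa using (mem_posList hx).2.trans h

theorem exists_mono_multi_of_le {n t : ℕ} (h : t ≤ n) {a b : ℕ → ℕ}
    {f : KHom (multi k a n) (multi k b n)} (hf : f.Mono) :
    ∃ g : KHom (injSum k (List.replicate (a 0) 0 ++ posList a t))
      (injSum k (List.replicate (b 0) 0 ++ posList b t)), g.Mono := by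
  obtain ⟨l, hl, -⟩ := exists_posList_eq_append a h
  obtain ⟨m, hm, hmt⟩ := exists_posList_eq_append b h
  revert f
  rw [multi_eq_injSum, multi_eq_injSum, hl, hm, ← List.append_assoc, ← List.append_assoc]
  intro f hf
  refine exists_mono_injSum_of_append (fun x hx y hy => lt_of_le_of_lt ?_ (hmt y hy)) hf
  rcases List.mem_append.1 hx with hx | hx
  · rw [List.eq_of_mem_replicate hx]
    exact Nat.zero_le t
  · exact (mem_posList hx).2

end KRep

/-- Weighted dominance criterion (multiplicative form) for the existence of a
monomorphism `a₀I₀ ⊕ ⋯ ⊕ aₙIₙ → b₀I₀ ⊕ ⋯ ⊕ bₙIₙ`. -/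
theorem preinjective_embedding_multiplicative (n : ℕ) (a b : ℕ → ℕ) :
    (∃ f : KHom (KRep.multi k a n) (KRep.multi k b n), f.Mono) ↔
      a 0 ≤ b 0 ∧ ∀ t, 1 ≤ t → t ≤ n →
        (∑ i ∈ Finset.Icc 1 t, i * a i) ≤ ∑ i ∈ Finset.Icc 1 t, i * b i := by
  constructor
  · rintro ⟨f, hf⟩
    refine ⟨?_, fun t _ ht => ?_⟩
    · obtain ⟨g, hg⟩ := KRep.exists_mono_multi_of_le (Nat.zero_le n) hf
      simpa [KRep.posList, KRep.injSum_replicate_zero_d2] using hg.d2_le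
    · obtain ⟨g, hg⟩ := KRep.exists_mono_multi_of_le ht hf
      simpa [KRep.injSum_d1, KRep.sum_posList] using hg.d1_le
  · rintro ⟨h₀, h⟩
    rw [KRep.multi_eq_injSum, KRep.multi_eq_injSum]
    refine KRep.exists_mono_replicate_append h₀ 0 (KRep.exists_mono_of_dominated
      (fun x hx => (KRep.mem_posList hx).1) (KRep.pairwise_posList a n) (KRep.pairwise_posList b n)
      fun t => ?_)
    rw [KRep.filter_posList, KRep.filter_posList, KRep.sum_posList, KRep.sum_posList]
    rcases Nat.eq_zero_or_pos (min t n) with h' | h'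
    · simp [h']
    · exact h _ h' (min_le_right t n)
end

section
/- Let I′ = a₀I₀ ⊕ … ⊕ aₙIₙ and I = b₀I₀ ⊕ … ⊕ bₙIₙ be preinjective Kronecker representations. There exists a short exact sequence 0 → I′ → I → βI₀ → 0 for some β ∈ ℕ if and only if a₀ ≤ b₀, Σ_{i=1}^{t} i·aᵢ ≤ Σ_{i=1}^{t} i·bᵢ for all 1 ≤ t < n, and Σ_{i=1}^{n} i·aᵢ = Σ_{i=1}^{n} i·bᵢ. -/
open Matrix Finset

variable {k : Type} [Field k]

theorem KRep.dsum_A (M N : KRep k) (x : Fin M.d1 ⊕ Fin N.d1) (y : Fin M.d2 ⊕ Fin N.d2) :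
    (M.dsum N).A (finSumFinEquiv x) (finSumFinEquiv y) = Matrix.fromBlocks M.A 0 0 N.A x y := by
  simp [KRep.dsum]

theorem KRep.dsum_B (M N : KRep k) (x : Fin M.d1 ⊕ Fin N.d1) (y : Fin M.d2 ⊕ Fin N.d2) :
    (M.dsum N).B (finSumFinEquiv x) (finSumFinEquiv y) = Matrix.fromBlocks M.B 0 0 N.B x y := by
  simp [KRep.dsum]

/-- The representation `⨁ p, I_{l p}` in coordinates: bases of the two spaces of `M` indexed by
`Σ p, Fin (l p)` and `Σ p, Fin (l p + 1)`, on which `A` and `B` act by the two shifts. -/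
structure PreinjBasis (M : KRep k) {ι : Type} (l : ι → ℕ) where
  e1 : (Σ p, Fin (l p)) ≃ Fin M.d1
  e2 : (Σ p, Fin (l p + 1)) ≃ Fin M.d2
  A_eq : ∀ x y, M.A (e1 x) (e2 y) = open Classical in
    if (⟨x.1, x.2.castSucc⟩ : Σ p, Fin (l p + 1)) = y then 1 else 0
  B_eq : ∀ x y, M.B (e1 x) (e2 y) = open Classical in
    if (⟨x.1, x.2.succ⟩ : Σ p, Fin (l p + 1)) = y then 1 else 0

namespace PreinjBasis

variable {ι : Type} {l : ι → ℕ} {M : KRep k}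

/-- Bases indexed by `ι` give bases indexed by any type in bijection with `ι`. -/
def congr {ι' : Type} (l' : ι' → ℕ) (e : ι ≃ ι')
    (b : PreinjBasis M fun p => l' (e p)) : PreinjBasis M l' where
  e1 := (Equiv.sigmaCongrLeft (β := fun p => Fin (l' p)) e).symm.trans b.e1
  e2 := (Equiv.sigmaCongrLeft (β := fun p => Fin (l' p + 1)) e).symm.trans b.e2
  A_eq := by
    intro x y
    obtain ⟨x, rfl⟩ := (Equiv.sigmaCongrLeft (β := fun p => Fin (l' p)) e).surjective x
    obtain ⟨y, rfl⟩ := (Equiv.sigmaCongrLeft (β := fun p => Fin (l' p + 1)) e).surjective y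
    simp only [Equiv.trans_apply, Equiv.symm_apply_apply, b.A_eq]
    classical
    refine if_congr ?_ rfl rfl
    rw [← (Equiv.sigmaCongrLeft (β := fun p => Fin (l' p + 1)) e).apply_eq_iff_eq]
    rfl
  B_eq := by
    intro x y
    obtain ⟨x, rfl⟩ := (Equiv.sigmaCongrLeft (β := fun p => Fin (l' p)) e).surjective x
    obtain ⟨y, rfl⟩ := (Equiv.sigmaCongrLeft (β := fun p => Fin (l' p + 1)) e).surjective y
    simp only [Equiv.trans_apply, Equiv.symm_apply_apply, b.B_eq]
    classical
    refine if_congr ?_ rfl rfl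
    rw [← (Equiv.sigmaCongrLeft (β := fun p => Fin (l' p + 1)) e).apply_eq_iff_eq]
    rfl

/-- A sigma type over `Option ι` splits off the fibre over `none`. -/
def sigmaOptionEquiv (β : Option ι → Type) : (Σ p, β p) ≃ β none ⊕ Σ p, β (some p) where
  toFun x := match x with
    | ⟨none, c⟩ => Sum.inl c
    | ⟨some p, c⟩ => Sum.inr ⟨p, c⟩
  invFun x := match x with
    | Sum.inl c => ⟨none, c⟩
    | Sum.inr ⟨p, c⟩ => ⟨some p, c⟩
  left_inv := by rintro ⟨_ | p, c⟩ <;> rfl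
  right_inv := by rintro (c | ⟨p, c⟩) <;> rfl

/-- Adding a summand `I_{l none}`. -/
def cons (l : Option ι → ℕ) (b : PreinjBasis M fun p => l (some p)) :
    PreinjBasis ((KRep.Inj k (l none)).dsum M) l where
  e1 := (sigmaOptionEquiv _).trans (((Equiv.refl _).sumCongr b.e1).trans finSumFinEquiv)
  e2 := (sigmaOptionEquiv _).trans (((Equiv.refl _).sumCongr b.e2).trans finSumFinEquiv)
  A_eq := by
    rintro ⟨_ | p, c⟩ ⟨_ | q, d⟩
    · refine (KRep.dsum_A (KRep.Inj k (l none)) M (.inl c) (.inl d)).trans ?_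
      change (if (c : ℕ) = d then (1 : k) else 0) = _
      simp [Fin.ext_iff]
    · refine (KRep.dsum_A (KRep.Inj k (l none)) M (.inl c) (.inr (b.e2 ⟨q, d⟩))).trans ?_
      change (0 : k) = _
      simp
    · refine (KRep.dsum_A (KRep.Inj k (l none)) M (.inr (b.e1 ⟨p, c⟩)) (.inl d)).trans ?_
      change (0 : k) = _
      simp
    · refine (KRep.dsum_A (KRep.Inj k (l none)) M (.inr (b.e1 ⟨p, c⟩)) (.inr (b.e2 ⟨q, d⟩))).trans ?_
      rw [Matrix.fromBlocks_apply₂₂, b.A_eq]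
      split_ifs with h1 h2 h2
      · rfl
      · exact absurd (by cases h1; rfl) h2
      · exact absurd (by cases h2; rfl) h1
      · rfl
  B_eq := by
    rintro ⟨_ | p, c⟩ ⟨_ | q, d⟩
    · refine (KRep.dsum_B (KRep.Inj k (l none)) M (.inl c) (.inl d)).trans ?_
      change (if (c : ℕ) + 1 = d then (1 : k) else 0) = _
      simp [Fin.ext_iff]
    · refine (KRep.dsum_B (KRep.Inj k (l none)) M (.inl c) (.inr (b.e2 ⟨q, d⟩))).trans ?_
      change (0 : k) = _
      simp
    · refine (KRep.dsum_B (KRep.Inj k (l none)) M (.inr (b.e1 ⟨p, c⟩)) (.inl d)).trans ?_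
      change (0 : k) = _
      simp
    · refine (KRep.dsum_B (KRep.Inj k (l none)) M (.inr (b.e1 ⟨p, c⟩)) (.inr (b.e2 ⟨q, d⟩))).trans ?_
      rw [Matrix.fromBlocks_apply₂₂, b.B_eq]
      split_ifs with h1 h2 h2
      · rfl
      · exact absurd (by cases h1; rfl) h2
      · exact absurd (by cases h2; rfl) h1
      · rfl

theorem nonempty_dsumList (L : List ℕ) {ι : Type} [Finite ι] (l : ι → ℕ)
    (h : ∀ i, Nat.card {p // l p = i} = L.count i) :
    Nonempty (PreinjBasis (KRep.dsumList (L.map (KRep.Inj k))) l) := by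
  induction L generalizing ι with
  | nil =>
    have : IsEmpty ι := ⟨fun p => by
      have := h (l p)
      rw [List.count_nil, Nat.card_eq_zero] at this
      rcases this with h | h
      · exact h.elim ⟨p, rfl⟩
      · exact not_finite {q // l q = l p}⟩
    exact ⟨⟨Equiv.equivOfIsEmpty _ (Fin 0), Equiv.equivOfIsEmpty _ (Fin 0),
      fun x => (this.false x.1).elim, fun x => (this.false x.1).elim⟩⟩
  | cons x L ih =>
    classical
    obtain ⟨⟨p₀, rfl⟩⟩ : Nonempty {p // l p = x} := by
      apply (Nat.card_pos_iff.1 _).1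
      rw [h, List.count_cons_self]
      omega
    let e : Option {p // p ≠ p₀} ≃ ι := Equiv.optionSubtypeNe p₀
    have key : ∀ i, Nat.card {p : {p // p ≠ p₀} // l p = i} = L.count i := by
      intro i
      have h1 := h i
      have : Nat.card {p // l p = i} =
          Nat.card {p : {p // p ≠ p₀} // l p = i} + if l p₀ = i then 1 else 0 := by
        have := Fintype.ofFinite ι
        simp only [Nat.card_eq_fintype_card, Fintype.card_subtype, Finset.card_filter]
        rw [← e.sum_comp, Fintype.sum_option, add_comm]
        rfl
      rw [List.count_cons] at h1
      simp only [beq_iff_eq] at h1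
      omega
    obtain ⟨b⟩ := ih (fun p : {p // p ≠ p₀} => l p) key
    exact ⟨congr l e (cons (fun p => l (e p)) b)⟩

variable (b : PreinjBasis M l) {m : ℕ}

theorem A_mulVec (v : Fin M.d2 → k) (p : ι) (c : Fin (l p)) :
    (M.A *ᵥ v) (b.e1 ⟨p, c⟩) = v (b.e2 ⟨p, c.castSucc⟩) := by
  classical
  have := Fintype.ofEquiv _ b.e2.symm
  rw [Matrix.mulVec, dotProduct, ← b.e2.sum_comp]
  simp [b.A_eq]

theorem A_mul (X : Matrix (Fin M.d2) (Fin m) k) (p : ι) (c : Fin (l p)) (j : Fin m) :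
    (M.A * X) (b.e1 ⟨p, c⟩) j = X (b.e2 ⟨p, c.castSucc⟩) j :=
  b.A_mulVec (fun x => X x j) p c

theorem B_mulVec (v : Fin M.d2 → k) (p : ι) (c : Fin (l p)) :
    (M.B *ᵥ v) (b.e1 ⟨p, c⟩) = v (b.e2 ⟨p, c.succ⟩) := by
  classical
  have := Fintype.ofEquiv _ b.e2.symm
  rw [Matrix.mulVec, dotProduct, ← b.e2.sum_comp]
  simp [b.B_eq]

theorem B_mul (X : Matrix (Fin M.d2) (Fin m) k) (p : ι) (c : Fin (l p)) (j : Fin m) :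
    (M.B * X) (b.e1 ⟨p, c⟩) j = X (b.e2 ⟨p, c.succ⟩) j :=
  b.B_mulVec (fun x => X x j) p c

theorem mul_A_castSucc (X : Matrix (Fin m) (Fin M.d1) k) (p : ι) (c : Fin (l p)) (i : Fin m) :
    (X * M.A) i (b.e2 ⟨p, c.castSucc⟩) = X i (b.e1 ⟨p, c⟩) := by
  classical
  have := Fintype.ofEquiv _ b.e1.symm
  rw [Matrix.mul_apply, ← b.e1.sum_comp, Finset.sum_eq_single ⟨p, c⟩]
  · simp [b.A_eq]
  · rintro ⟨q, d⟩ - hne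
    rw [b.A_eq, if_neg, mul_zero]
    intro h
    obtain ⟨rfl, h⟩ := Sigma.mk.inj_iff.1 h
    exact hne (by simpa using h)
  · simp

theorem mul_A_last (X : Matrix (Fin m) (Fin M.d1) k) (p : ι) (i : Fin m) :
    (X * M.A) i (b.e2 ⟨p, Fin.last _⟩) = 0 := by
  classical
  have := Fintype.ofEquiv _ b.e1.symm
  rw [Matrix.mul_apply, ← b.e1.sum_comp]
  refine Finset.sum_eq_zero ?_
  rintro ⟨q, d⟩ -
  rw [b.A_eq, if_neg, mul_zero]
  intro h
  obtain ⟨rfl, h⟩ := Sigma.mk.inj_iff.1 h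
  exact d.castSucc_ne_last (eq_of_heq h)

theorem mul_B_succ (X : Matrix (Fin m) (Fin M.d1) k) (p : ι) (c : Fin (l p)) (i : Fin m) :
    (X * M.B) i (b.e2 ⟨p, c.succ⟩) = X i (b.e1 ⟨p, c⟩) := by
  classical
  have := Fintype.ofEquiv _ b.e1.symm
  rw [Matrix.mul_apply, ← b.e1.sum_comp, Finset.sum_eq_single ⟨p, c⟩]
  · simp [b.B_eq]
  · rintro ⟨q, d⟩ - hne
    rw [b.B_eq, if_neg, mul_zero]
    intro h
    obtain ⟨rfl, h⟩ := Sigma.mk.inj_iff.1 h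
    exact hne (by simpa using h)
  · simp

theorem mul_B_zero (X : Matrix (Fin m) (Fin M.d1) k) (p : ι) (i : Fin m) :
    (X * M.B) i (b.e2 ⟨p, 0⟩) = 0 := by
  classical
  have := Fintype.ofEquiv _ b.e1.symm
  rw [Matrix.mul_apply, ← b.e1.sum_comp]
  refine Finset.sum_eq_zero ?_
  rintro ⟨q, d⟩ -
  rw [b.B_eq, if_neg, mul_zero]
  intro h
  obtain ⟨rfl, h⟩ := Sigma.mk.inj_iff.1 h
  exact d.succ_ne_zero (eq_of_heq h)

end PreinjBasis

theorem KRep.dsumList_replicate_Inj_zero_dims (β : ℕ) :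
    (KRep.dsumList (List.replicate β (KRep.Inj k 0))).d1 = 0 ∧
      (KRep.dsumList (List.replicate β (KRep.Inj k 0))).d2 = β := by
  induction β with
  | zero => exact ⟨rfl, rfl⟩
  | succ β ih =>
    rw [List.replicate_succ]
    change 0 + (KRep.dsumList (List.replicate β (KRep.Inj k 0))).d1 = 0 ∧
      0 + 1 + (KRep.dsumList (List.replicate β (KRep.Inj k 0))).d2 = β + 1
    omega

theorem exists_ses_semisimple_iff (N Y : KRep k) :
    (∃ β : ℕ, SES N Y (KRep.dsumList (List.replicate β (KRep.Inj k 0)))) ↔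
      ∃ f : KHom N Y, Function.Bijective f.f1.mulVecLin ∧ Function.Injective f.f2.mulVecLin := by
  constructor
  · rintro ⟨β, f, g, hf, -, h1, -⟩
    refine ⟨f, ⟨hf.1, ?_⟩, hf.2⟩
    rw [← LinearMap.range_eq_top, h1, LinearMap.ker_eq_top]
    ext v i
    exact (Fin.cast (KRep.dsumList_replicate_Inj_zero_dims β).1 i).elim0
  · rintro ⟨f, h1, h2⟩
    let R := LinearMap.range f.f2.mulVecLin
    refine ⟨Module.finrank k ((Fin Y.d2 → k) ⧸ R), ?_⟩
    obtain ⟨hd1, hd2⟩ :=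
      KRep.dsumList_replicate_Inj_zero_dims (k := k) (Module.finrank k ((Fin Y.d2 → k) ⧸ R))
    set Z := KRep.dsumList (List.replicate (Module.finrank k ((Fin Y.d2 → k) ⧸ R)) (KRep.Inj k 0))
    have hZ : IsEmpty (Fin Z.d1) := by rw [hd1]; infer_instance
    have e : ((Fin Y.d2 → k) ⧸ R) ≃ₗ[k] (Fin Z.d2 → k) :=
      LinearEquiv.ofFinrankEq _ _ (by simp [hd2])
    let φ : (Fin Y.d2 → k) →ₗ[k] (Fin Z.d2 → k) := e.toLinearMap ∘ₗ R.mkQ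
    have hφ : (LinearMap.toMatrix' φ).mulVecLin = φ := Matrix.toLin'_toMatrix' φ
    refine ⟨f, ⟨0, LinearMap.toMatrix' φ, by ext i; exact hZ.elim i, by ext i; exact hZ.elim i⟩,
      ⟨h1.1, h2⟩, ⟨fun v => ⟨0, Subsingleton.elim _ _⟩, ?_⟩, ?_, ?_⟩
    · rw [hφ]
      exact e.surjective.comp R.mkQ_surjective
    · rw [LinearMap.range_eq_top.2 h1.2, eq_comm, LinearMap.ker_eq_top]
      exact Subsingleton.elim _ _
    · rw [hφ, LinearEquiv.ker_comp, Submodule.ker_mkQ]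

theorem card_le_card_of_mulVecLin_injective {m n : Type*} [Fintype m] [Fintype n]
    (X : Matrix m n k) (hX : Function.Injective X.mulVecLin) (S : Finset n) (T : Finset m)
    (h : ∀ j ∈ S, ∀ i ∉ T, X i j = 0) : #S ≤ #T := by
  classical
  have hinj : Function.Injective (X.submatrix ((↑) : T → m) ((↑) : S → n)).mulVecLin := by
    rw [← LinearMap.ker_eq_bot, LinearMap.ker_eq_bot'] at hX ⊢
    intro v hv
    have h0 := hX (fun j => if hj : j ∈ S then v ⟨j, hj⟩ else 0) ?_
    · ext ⟨j, hj⟩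
      simpa [hj] using congrFun h0 j
    · ext i
      have hsum : ∀ i, ∑ j, X i j * (if hj : j ∈ S then v ⟨j, hj⟩ else 0)
          = ∑ j : S, X i j * v j := by
        intro i
        rw [← Finset.sum_subset (Finset.subset_univ S), ← Finset.sum_coe_sort S]
        · simp
        · intro j _ hj
          simp [hj]
      simp only [Matrix.mulVecLin_apply, Matrix.mulVec, dotProduct, Pi.zero_apply, hsum]
      by_cases hi : i ∈ T
      · exact congrFun hv ⟨i, hi⟩
      · exact Finset.sum_eq_zero fun j _ => by rw [h j j.2 i hi, zero_mul]
  simpa using LinearMap.finrank_le_finrank_of_injective hinj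

/-- If two tilings of `[0, N)` by intervals, with lengths `a` and `b`, are such that every
`b`-interval is at most as long as any `a`-interval it meets, then the linear system placing in
each `a`-interval the `b`-intervals that meet it (pushed inside when they stick out) has only the
zero solution. -/
theorem eq_zero_of_tilings {ι κ : Type} [Fintype ι] {N : ℕ} (s a : ι → ℕ) (u b : κ → ℕ)
    (row : ∀ x < N, ∃ p, s p ≤ x ∧ x < s p + a p)
    (row_lt : ∀ p x, s p ≤ x → x < s p + a p → x < N)
    (row_inj : ∀ p p' x, s p ≤ x → x < s p + a p → s p' ≤ x → x < s p' + a p' → p = p')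
    (col : ∀ x < N, ∃ q, u q ≤ x ∧ x < u q + b q)
    (col_lt : ∀ q x, u q ≤ x → x < u q + b q → x < N)
    (col_inj : ∀ q q' x, u q ≤ x → x < u q + b q → u q' ≤ x → x < u q' + b q' → q = q')
    (le : ∀ p q x, s p ≤ x → x < s p + a p → u q ≤ x → x < u q + b q → b q ≤ a p)
    (meets : κ → ι → Prop) [∀ q p, Decidable (meets q p)]
    (hmeets : ∀ q p, 0 < b q → (meets q p ↔ ∃ x, (s p ≤ x ∧ x < s p + a p) ∧ u q ≤ x ∧ x < u q + b q))
    (w : ι → ℕ → k)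
    (hw : ∀ q, ∀ c < b q,
      (∑ p, if meets q p then w p (c + min (u q - s p) (a p - b q)) else 0) = 0) :
    ∀ p c, c < a p → w p c = 0 := by
  classical
  -- an interval contained in a row
  have inner : ∀ p q x, s p ≤ x → x < s p + a p → u q ≤ x → x < u q + b q → s p ≤ u q →
      u q + b q ≤ s p + a p → w p (x - s p) = 0 := by
    intro p q x h1 h2 h3 h4 h5 h6
    have := hw q (x - u q) (by omega)
    rw [Finset.sum_eq_single p] at this
    · rw [if_pos ((hmeets q p (by omega)).2 ⟨x, ⟨h1, h2⟩, h3, h4⟩)] at this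
      rwa [show x - s p = x - u q + min (u q - s p) (a p - b q) by omega]
    · intro p' _ hne
      rw [if_neg]
      rw [hmeets q p' (by omega)]
      rintro ⟨y, ⟨h7, h8⟩, h9, h10⟩
      exact hne (row_inj p' p y h7 h8 (by omega) (by omega))
    · simp
  -- an interval that meets two consecutive rows
  have split : ∀ p p' q x, s p ≤ x → x < s p + a p → u q ≤ x → x < u q + b q →
      s p' = s p + a p → s p' < u q + b q → 0 < a p' → ∀ c < b q,
      w p (c + (a p - b q)) + w p' c = 0 := by
    intro p p' q x h1 h2 h3 h4 h5 h6 h7 c hc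
    have l1 := le p q x h1 h2 h3 h4
    have l2 := le p' q (s p') (by omega) (by omega) (by omega) (by omega)
    have hne : p ≠ p' := by rintro rfl; omega
    have := hw q c hc
    rw [Finset.sum_eq_add p p' hne] at this
    · rw [if_pos ((hmeets q p (by omega)).2 ⟨x, ⟨h1, h2⟩, h3, h4⟩),
        if_pos ((hmeets q p' (by omega)).2 ⟨s p', ⟨by omega, by omega⟩, by omega, by omega⟩)] at this
      rwa [show min (u q - s p) (a p - b q) = a p - b q by omega,
        show min (u q - s p') (a p' - b q) = 0 by omega, add_zero] at this
    · rintro p'' - ⟨hn, hn'⟩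
      rw [if_neg]
      rw [hmeets q p'' (by omega)]
      rintro ⟨y, ⟨h7, h8⟩, h9, h10⟩
      by_cases hy : y < s p'
      · exact hn (row_inj p'' p y h7 h8 (by omega) (by omega))
      · exact hn' (row_inj p'' p' y h7 h8 (by omega) (by omega))
    · simp
    · simp
  have adj : ∀ p p' x, s p ≤ x → x < s p + a p → s p' ≤ s p + a p → s p + a p < s p' + a p' →
      s p' = s p + a p := by
    intro p p' x h1 h2 h3 h4
    by_contra hne
    have := row_inj p p' (s p + a p - 1) (by omega) (by omega) (by omega) (by omega)
    subst this
    omega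
  have right : ∀ d p q x, N - x ≤ d → s p ≤ x → x < s p + a p → u q ≤ x → x < u q + b q →
      s p ≤ u q → w p (x - s p) = 0 := by
    intro d
    induction d with
    | zero =>
      intro p q x hd h1 h2
      have := row_lt p x h1 h2
      omega
    | succ d ih =>
      intro p q x hd h1 h2 h3 h4 h5
      by_cases h6 : u q + b q ≤ s p + a p
      · exact inner p q x h1 h2 h3 h4 h5 h6
      obtain ⟨p', h7, h8⟩ := row (s p + a p) (col_lt q _ (by omega) (by omega))
      have hs := adj p p' x h1 h2 h7 h8
      have l2 := le p' q (s p') (by omega) (by omega) (by omega) (by omega)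
      have l1 := le p q x (by omega) (by omega) (by omega) (by omega)
      have hsp := split p p' q x h1 h2 h3 h4 hs (by omega) (by omega)
        (x + b q - s p') (by omega)
      obtain ⟨q', h9, h10⟩ := col (x + b q) (row_lt p' _ (by omega) (by omega))
      have h11 : s p' ≤ u q' := by
        by_contra hlt
        have := col_inj q q' (s p') (by omega) (by omega) (by omega) (by omega)
        subst this
        omega
      have := ih p' q' (x + b q) (by have := row_lt p x h1 h2; omega) (by omega) (by omega) h9 h10 h11
      rw [this, add_zero] at hsp
      rwa [show x - s p = x + b q - s p' + (a p - b q) by omega]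
  have left : ∀ x p q, s p ≤ x → x < s p + a p → u q ≤ x → x < u q + b q →
      u q + b q ≤ s p + a p → w p (x - s p) = 0 := by
    intro x
    induction x using Nat.strong_induction_on with
    | _ x ih =>
      intro p' q h1 h2 h3 h4 h5
      by_cases h6 : s p' ≤ u q
      · exact inner p' q x h1 h2 h3 h4 h6 h5
      obtain ⟨p, h7, h8⟩ := row (s p' - 1) (col_lt q _ (by omega) (by omega))
      have hs : s p' = s p + a p := by
        by_contra hne
        have := row_inj p p' (s p') (by omega) (by omega) (by omega) (by omega)
        subst this
        omega
      have l2 := le p' q x (by omega) (by omega) (by omega) (by omega)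
      have l1 := le p q (s p' - 1) (by omega) (by omega) (by omega) (by omega)
      have hsp := split p p' q (s p' - 1) h7 h8 (by omega) (by omega) hs (by omega) (by omega)
        (x - s p') (by omega)
      obtain ⟨q', h9, h10⟩ := col (x - b q) (row_lt p _ (by omega) (by omega))
      have h11 : u q' + b q' ≤ s p + a p := by
        by_contra hlt
        have := col_inj q q' (s p') (by omega) (by omega) (by omega) (by omega)
        subst this
        omega
      have := ih (x - b q) (by omega) p q' (by omega) (by omega) h9 h10 h11
      rw [show x - s p' + (a p - b q) = x - b q - s p by omega, this, zero_add] at hsp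
      exact hsp
  intro p c hc
  obtain ⟨q, h1, h2⟩ := col (s p + c) (row_lt p _ (by omega) (by omega))
  have l := le p q (s p + c) (by omega) (by omega) h1 h2
  rw [show c = s p + c - s p by omega]
  by_cases h : s p ≤ u q
  · exact right _ p q (s p + c) le_rfl (by omega) (by omega) h1 h2 h
  · exact left (s p + c) p q (by omega) (by omega) h1 h2 (by omega)

namespace PreinjBasis

variable {ι κ : Type} {l : ι → ℕ} {l' : κ → ℕ} {N Y : KRep k}
  (bN : PreinjBasis N l) (bY : PreinjBasis Y l') (f : KHom N Y)

include bN bY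

theorem f1_eq_castSucc (p : ι) (c : Fin (l p)) (q : κ) (d : Fin (l' q)) :
    f.f1 (bY.e1 ⟨q, d⟩) (bN.e1 ⟨p, c⟩) =
      f.f2 (bY.e2 ⟨q, d.castSucc⟩) (bN.e2 ⟨p, c.castSucc⟩) :=
  (bN.mul_A_castSucc f.f1 p c _).symm.trans ((congr_fun₂ f.comm_a _ _).trans (bY.A_mul f.f2 q d _))

theorem f1_eq_succ (p : ι) (c : Fin (l p)) (q : κ) (d : Fin (l' q)) :
    f.f1 (bY.e1 ⟨q, d⟩) (bN.e1 ⟨p, c⟩) = f.f2 (bY.e2 ⟨q, d.succ⟩) (bN.e2 ⟨p, c.succ⟩) :=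
  (bN.mul_B_succ f.f1 p c _).symm.trans ((congr_fun₂ f.comm_b _ _).trans (bY.B_mul f.f2 q d _))

theorem f2_eq_zero_of_lt (p : ι) (c : Fin (l p + 1)) (q : κ) (d : Fin (l' q + 1))
    (h : (c : ℕ) < d) : f.f2 (bY.e2 ⟨q, d⟩) (bN.e2 ⟨p, c⟩) = 0 := by
  induction c using Fin.induction generalizing d with
  | zero =>
    obtain ⟨d, rfl⟩ := Fin.exists_succ_eq.2 (show d ≠ 0 by rintro rfl; simp at h)
    exact (bY.B_mul f.f2 q d _).symm.trans
      ((congr_fun₂ f.comm_b _ _).symm.trans (bN.mul_B_zero f.f1 p _))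
  | succ c ih =>
    obtain ⟨d, rfl⟩ := Fin.exists_succ_eq.2 (show d ≠ 0 by rintro rfl; simp at h)
    rw [← f1_eq_succ, f1_eq_castSucc]
    exact ih _ (by simpa using h)

theorem f2_eq_zero_of_sub_lt (p : ι) (c : Fin (l p + 1)) (q : κ) (d : Fin (l' q + 1))
    (h : l p + d < l' q + c) : f.f2 (bY.e2 ⟨q, d⟩) (bN.e2 ⟨p, c⟩) = 0 := by
  induction c using Fin.reverseInduction generalizing d with
  | last =>
    obtain ⟨d, rfl⟩ := Fin.exists_castSucc_eq.2
      (show d ≠ Fin.last _ by rintro rfl; simp at h; omega)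
    exact (bY.A_mul f.f2 q d _).symm.trans
      ((congr_fun₂ f.comm_a _ _).symm.trans (bN.mul_A_last f.f1 p _))
  | cast c ih =>
    obtain ⟨d, rfl⟩ := Fin.exists_castSucc_eq.2
      (show d ≠ Fin.last _ by rintro rfl; simp at h; omega)
    rw [← f1_eq_castSucc, f1_eq_succ]
    refine ih _ ?_
    simp at h ⊢
    omega

/-- There are no nonzero morphisms `I_m → I_n` for `m < n`, on the second spaces. -/
theorem f2_eq_zero (p : ι) (c : Fin (l p + 1)) (q : κ) (d : Fin (l' q + 1))
    (h : l p < l' q) : f.f2 (bY.e2 ⟨q, d⟩) (bN.e2 ⟨p, c⟩) = 0 := by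
  by_cases hc : (c : ℕ) < d
  · exact f2_eq_zero_of_lt bN bY f p c q d hc
  · exact f2_eq_zero_of_sub_lt bN bY f p c q d (by omega)

/-- There are no nonzero morphisms `I_m → I_n` for `m < n`, on the first spaces. -/
theorem f1_eq_zero (p : ι) (c : Fin (l p)) (q : κ) (d : Fin (l' q))
    (h : l p < l' q) : f.f1 (bY.e1 ⟨q, d⟩) (bN.e1 ⟨p, c⟩) = 0 := by
  rw [f1_eq_castSucc, f2_eq_zero bN bY f _ _ _ _ h]

theorem card_e1_le [Fintype ι] [Fintype κ] (hf : Function.Injective f.f1.mulVecLin) (t : ℕ) :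
    #{x : Σ p, Fin (l p) | l x.1 ≤ t} ≤ #{x : Σ q, Fin (l' q) | l' x.1 ≤ t} := by
  have := card_le_card_of_mulVecLin_injective f.f1 hf
    (Finset.map bN.e1.toEmbedding {x : Σ p, Fin (l p) | l x.1 ≤ t})
    (Finset.map bY.e1.toEmbedding {x : Σ q, Fin (l' q) | l' x.1 ≤ t}) ?_
  · simpa only [Finset.card_map] using this
  · intro j hj i hi
    obtain ⟨⟨p, c⟩, rfl⟩ := bN.e1.surjective j
    obtain ⟨⟨q, d⟩, rfl⟩ := bY.e1.surjective i
    simp at hi hj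
    exact f1_eq_zero bN bY f p c q d (by omega)

theorem card_e2_le [Fintype ι] [Fintype κ] (hf : Function.Injective f.f2.mulVecLin) (t : ℕ) :
    #{x : Σ p, Fin (l p + 1) | l x.1 ≤ t} ≤ #{x : Σ q, Fin (l' q + 1) | l' x.1 ≤ t} := by
  have := card_le_card_of_mulVecLin_injective f.f2 hf
    (Finset.map bN.e2.toEmbedding {x : Σ p, Fin (l p + 1) | l x.1 ≤ t})
    (Finset.map bY.e2.toEmbedding {x : Σ q, Fin (l' q + 1) | l' x.1 ≤ t}) ?_
  · simpa only [Finset.card_map] using this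
  · intro j hj i hi
    obtain ⟨⟨p, c⟩, rfl⟩ := bN.e2.surjective j
    obtain ⟨⟨q, d⟩, rfl⟩ := bY.e2.surjective i
    simp at hi hj
    exact f2_eq_zero bN bY f p c q d (by omega)

/-- A morphism between sums of preinjective indecomposables given by one monomial of degree
`l p - l' q`, with exponent `o q p`, for each pair related by `r`. -/
theorem exists_hom (r : κ → ι → Prop) [∀ q p, Decidable (r q p)] (o : κ → ι → ℕ)
    (h : ∀ q p, r q p → o q p + l' q ≤ l p) :
    ∃ f : KHom N Y,
      (∀ q d p c, f.f1 (bY.e1 ⟨q, d⟩) (bN.e1 ⟨p, c⟩) =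
        if r q p ∧ (c : ℕ) = d + o q p then 1 else 0) ∧
      (∀ q d p c, f.f2 (bY.e2 ⟨q, d⟩) (bN.e2 ⟨p, c⟩) =
        if r q p ∧ (c : ℕ) = d + o q p then 1 else 0) := by
  let g1 : Matrix (Σ q, Fin (l' q)) (Σ p, Fin (l p)) k := Matrix.of fun x y =>
    if r x.1 y.1 ∧ (y.2 : ℕ) = x.2 + o x.1 y.1 then 1 else 0
  let g2 : Matrix (Σ q, Fin (l' q + 1)) (Σ p, Fin (l p + 1)) k := Matrix.of fun x y =>
    if r x.1 y.1 ∧ (y.2 : ℕ) = x.2 + o x.1 y.1 then 1 else 0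
  let f1 := g1.submatrix bY.e1.symm bN.e1.symm
  let f2 := g2.submatrix bY.e2.symm bN.e2.symm
  have h1 : ∀ q d p c, f1 (bY.e1 ⟨q, d⟩) (bN.e1 ⟨p, c⟩) =
      if r q p ∧ (c : ℕ) = d + o q p then 1 else 0 := by
    intro q d p c
    simp only [f1, Matrix.submatrix_apply, Equiv.symm_apply_apply]
    rfl
  have h2 : ∀ q d p c, f2 (bY.e2 ⟨q, d⟩) (bN.e2 ⟨p, c⟩) =
      if r q p ∧ (c : ℕ) = d + o q p then 1 else 0 := by
    intro q d p c
    simp only [f2, Matrix.submatrix_apply, Equiv.symm_apply_apply]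
    rfl
  refine ⟨⟨f1, f2, ?_, ?_⟩, h1, h2⟩
  · ext i j
    obtain ⟨⟨q, d⟩, rfl⟩ := bY.e1.surjective i
    obtain ⟨⟨p, c⟩, rfl⟩ := bN.e2.surjective j
    rw [bY.A_mul, h2]
    induction c using Fin.lastCases with
    | last =>
      rw [bN.mul_A_last, if_neg]
      rintro ⟨hr, hc⟩
      have := h q p hr
      simp at hc
      omega
    | cast c => rw [bN.mul_A_castSucc, h1]; rfl
  · ext i j
    obtain ⟨⟨q, d⟩, rfl⟩ := bY.e1.surjective i
    obtain ⟨⟨p, c⟩, rfl⟩ := bN.e2.surjective j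
    rw [bY.B_mul, h2]
    induction c using Fin.cases with
    | zero =>
      rw [bN.mul_B_zero, if_neg]
      rintro ⟨hr, hc⟩
      simp at hc
      omega
    | succ c =>
      rw [bN.mul_B_succ, h1]
      refine if_congr (and_congr_right fun _ => ?_) rfl rfl
      simp
      omega

end PreinjBasis

theorem card_filter_sigma_le (a g : ℕ → ℕ) {n t : ℕ} (ht : t ≤ n) :
    #{x : Σ p : (Σ i : Fin (n + 1), Fin (a i)), Fin (g p.1) | (x.1.1 : ℕ) ≤ t} =
      ∑ i ∈ Finset.range (t + 1), g i * a i := by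
  rw [Finset.card_filter]
  simp only [Fintype.sum_sigma]
  change (∑ i : Fin (n + 1), ∑ _m : Fin (a i), ∑ _c : Fin (g i), if (i : ℕ) ≤ t then 1 else 0) = _
  simp only [Finset.sum_const, Finset.card_univ, Fintype.card_fin, smul_eq_mul]
  rw [Fin.sum_univ_eq_sum_range (fun i => a i * (g i * if i ≤ t then 1 else 0)) (n + 1),
    ← Finset.sum_subset (Finset.range_mono (by omega : t + 1 ≤ n + 1))]
  · refine Finset.sum_congr rfl fun i hi => ?_
    rw [if_pos (by simp at hi; omega), mul_one, mul_comm]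
  · intro i _ hi
    rw [if_neg (by simpa using hi), mul_zero, mul_zero]

theorem KRep.nonempty_preinjBasis_multi (a : ℕ → ℕ) (n : ℕ) :
    Nonempty (PreinjBasis (KRep.multi k a n)
      fun p : (Σ i : Fin (n + 1), Fin (a i)) => (p.1 : ℕ)) := by
  have hM : KRep.multi k a n = KRep.dsumList
      (((List.range (n + 1)).flatMap fun i => List.replicate (a i) i).map (KRep.Inj k)) := by
    simp [KRep.multi, List.map_flatMap]
  rw [hM]
  refine PreinjBasis.nonempty_dsumList _ _ fun i => ?_
  have hl : List.count i ((List.range (n + 1)).flatMap fun i => List.replicate (a i) i) =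
      ∑ j ∈ Finset.range (n + 1), a j * if j = i then 1 else 0 := by
    rw [List.count_flatMap]
    change _ = ((List.range (n + 1)).map _).sum
    congr 1
    refine List.map_congr_left fun j _ => ?_
    simp [List.count_replicate]
  rw [hl, Nat.card_eq_fintype_card, Fintype.card_subtype, Finset.card_filter]
  simp only [Fintype.sum_sigma]
  change (∑ j : Fin (n + 1), ∑ _m : Fin (a j), if (j : ℕ) = i then 1 else 0) = _
  simp only [Finset.sum_const, Finset.card_univ, Fintype.card_fin, smul_eq_mul]
  rw [Fin.sum_univ_eq_sum_range (fun j => a j * if j = i then 1 else 0) (n + 1)]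

/-- The position of the first cell of the row `p` when `a i` rows of length `i`, for `i ≤ n`, are
laid end to end by increasing length. -/
def rowStart (a : ℕ → ℕ) {n : ℕ} (p : Σ i : Fin (n + 1), Fin (a i)) : ℕ :=
  (∑ j ∈ Finset.range p.1, j * a j) + p.1 * p.2

theorem rowStart_add_le (a : ℕ → ℕ) {n : ℕ} (p : Σ i : Fin (n + 1), Fin (a i)) :
    rowStart a p + p.1 ≤ ∑ j ∈ Finset.range (p.1 + 1), j * a j := by
  obtain ⟨i, m⟩ := p
  rw [Finset.sum_range_succ, rowStart]
  have : (i : ℕ) * (m + 1) ≤ i * a i := Nat.mul_le_mul_left _ m.2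
  dsimp only
  linarith

theorem sum_range_mul_mono (a : ℕ → ℕ) : Monotone fun t => ∑ j ∈ Finset.range t, j * a j :=
  fun _ _ h => Finset.sum_le_sum_of_subset (Finset.range_mono h)

theorem lt_of_lt_rowStart_add (a : ℕ → ℕ) {n : ℕ} (p : Σ i : Fin (n + 1), Fin (a i)) (x : ℕ)
    (h : x < rowStart a p + p.1) : x < ∑ j ∈ Finset.range (n + 1), j * a j :=
  (h.trans_le (rowStart_add_le a p)).trans_le (sum_range_mul_mono a (by omega))

theorem exists_row (a : ℕ → ℕ) {n : ℕ} (x : ℕ) (hx : x < ∑ j ∈ Finset.range (n + 1), j * a j) :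
    ∃ p : (Σ i : Fin (n + 1), Fin (a i)), rowStart a p ≤ x ∧ x < rowStart a p + p.1 := by
  have key : ∀ t, x < ∑ j ∈ Finset.range t, j * a j → ∃ i < t,
      ∑ j ∈ Finset.range i, j * a j ≤ x ∧ x < ∑ j ∈ Finset.range (i + 1), j * a j := by
    intro t
    induction t with
    | zero => simp
    | succ t ih =>
      intro h
      by_cases h' : x < ∑ j ∈ Finset.range t, j * a j
      · obtain ⟨i, hi, h⟩ := ih h'
        exact ⟨i, by omega, h⟩
      · exact ⟨t, by omega, by omega, h⟩
  obtain ⟨i, hi, h1, h2⟩ := key _ hx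
  rw [Finset.sum_range_succ] at h2
  have hi0 : 0 < i := by
    rcases Nat.eq_zero_or_pos i with rfl | h
    · simp at h2
    · exact h
  set s := ∑ j ∈ Finset.range i, j * a j with hs
  have hm : (x - s) / i < a i := by
    rw [Nat.div_lt_iff_lt_mul hi0, mul_comm]
    omega
  refine ⟨⟨⟨i, hi⟩, ⟨(x - s) / i, hm⟩⟩, ?_⟩
  simp only [rowStart, ← hs]
  have h3 := Nat.div_add_mod (x - s) i
  have h4 := Nat.mod_lt (x - s) hi0
  omega

theorem row_unique (a : ℕ → ℕ) {n : ℕ} (p p' : Σ i : Fin (n + 1), Fin (a i)) (x : ℕ)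
    (h1 : rowStart a p ≤ x) (h2 : x < rowStart a p + p.1)
    (h3 : rowStart a p' ≤ x) (h4 : x < rowStart a p' + p'.1) : p = p' := by
  have key : ∀ p p' : Σ i : Fin (n + 1), Fin (a i), x < rowStart a p + p.1 →
      rowStart a p' ≤ x → ¬ (p.1 : ℕ) < p'.1 := by
    intro p p' h h' hlt
    have := rowStart_add_le a p
    have : _ ≤ _ := sum_range_mul_mono a (Nat.succ_le_of_lt hlt)
    have : ∑ j ∈ Finset.range p'.1, j * a j ≤ rowStart a p' := Nat.le_add_right _ _
    simp at *
    omega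
  have hi : (p.1 : ℕ) = p'.1 := by
    have := key p p' h2 h3
    have := key p' p h4 h1
    omega
  obtain ⟨i, m⟩ := p
  obtain ⟨i', m'⟩ := p'
  obtain rfl : i = i' := Fin.ext hi
  simp only [rowStart] at h1 h2 h3 h4
  congr 1
  have e1 : (i : ℕ) * m < i * (m' + 1) := by rw [mul_add]; omega
  have e2 : (i : ℕ) * m' < i * (m + 1) := by rw [mul_add]; omega
  have e1 := Nat.lt_of_mul_lt_mul_left e1
  have e2 := Nat.lt_of_mul_lt_mul_left e2
  exact Fin.ext (by omega)

theorem KHom.f2_mulVec_eq_zero {N Y : KRep k} (f : KHom N Y)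
    (hf : Function.Injective f.f1.mulVecLin) {v : Fin N.d2 → k} (hv : f.f2 *ᵥ v = 0) :
    N.A *ᵥ v = 0 ∧ N.B *ᵥ v = 0 := by
  constructor <;> apply hf
  · rw [Matrix.mulVecLin_apply, Matrix.mulVec_mulVec, f.comm_a, ← Matrix.mulVec_mulVec, hv]
    simp
  · rw [Matrix.mulVecLin_apply, Matrix.mulVec_mulVec, f.comm_b, ← Matrix.mulVec_mulVec, hv]
    simp

theorem PreinjBasis.eq_zero_of_mulVec_eq_zero {ι : Type} {l : ι → ℕ} {N : KRep k}
    (bN : PreinjBasis N l) {v : Fin N.d2 → k} (hA : N.A *ᵥ v = 0) (hB : N.B *ᵥ v = 0)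
    (p : ι) (hp : 0 < l p) (c : Fin (l p + 1)) : v (bN.e2 ⟨p, c⟩) = 0 := by
  by_cases hc : (c : ℕ) < l p
  · have := bN.A_mulVec v p ⟨c, hc⟩
    rw [hA] at this
    exact this.symm
  · have := bN.B_mulVec v p ⟨l p - 1, by omega⟩
    rw [hB] at this
    rw [show c = Fin.succ ⟨l p - 1, by omega⟩ from Fin.ext (by simp; omega)]
    exact this.symm

theorem exists_hom_multi (n : ℕ) (a b : ℕ → ℕ) (h0 : a 0 ≤ b 0)
    (hle : ∀ t ≤ n, ∑ i ∈ Finset.range (t + 1), i * a i ≤ ∑ i ∈ Finset.range (t + 1), i * b i)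
    (heq : ∑ i ∈ Finset.range (n + 1), i * a i = ∑ i ∈ Finset.range (n + 1), i * b i) :
    ∃ f : KHom (KRep.multi k a n) (KRep.multi k b n),
      Function.Injective f.f1.mulVecLin ∧ Function.Injective f.f2.mulVecLin := by
  classical
  obtain ⟨bN⟩ := KRep.nonempty_preinjBasis_multi (k := k) a n
  obtain ⟨bY⟩ := KRep.nonempty_preinjBasis_multi (k := k) b n
  have hmeet : ∀ (p : Σ i : Fin (n + 1), Fin (a i)) (q : Σ i : Fin (n + 1), Fin (b i)) (x : ℕ),
      rowStart a p ≤ x → x < rowStart a p + p.1 → rowStart b q ≤ x → x < rowStart b q + q.1 →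
      (q.1 : ℕ) ≤ p.1 := by
    intro p q x h1 h2 h3 h4
    by_contra hlt
    have e1 := rowStart_add_le a p
    have e2 := hle p.1 (by omega)
    have e3 : _ ≤ _ := sum_range_mul_mono b (show (p.1 : ℕ) + 1 ≤ q.1 by omega)
    have e4 : ∑ j ∈ Finset.range q.1, j * b j ≤ rowStart b q := Nat.le_add_right _ _
    dsimp only at e3
    omega
  let meets : (Σ i : Fin (n + 1), Fin (b i)) → (Σ i : Fin (n + 1), Fin (a i)) → Prop := fun q p =>
    ((p.1 : ℕ) = 0 ∧ (q.1 : ℕ) = 0 ∧ (p.2 : ℕ) = q.2) ∨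
      ∃ x, (rowStart a p ≤ x ∧ x < rowStart a p + p.1) ∧ rowStart b q ≤ x ∧ x < rowStart b q + q.1
  obtain ⟨f, hf1, hf2⟩ := PreinjBasis.exists_hom bN bY meets
    (fun q p => min (rowStart b q - rowStart a p) (p.1 - q.1)) (by
      rintro q p (⟨h1, h2, -⟩ | ⟨x, ⟨h1, h2⟩, h3, h4⟩)
      · omega
      · have := hmeet p q x h1 h2 h3 h4
        omega)
  have inj1 : Function.Injective f.f1.mulVecLin := by
    rw [← LinearMap.ker_eq_bot, LinearMap.ker_eq_bot']
    intro v hv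
    have key := eq_zero_of_tilings (k := k) (rowStart a)
      (fun p : Σ i : Fin (n + 1), Fin (a i) => (p.1 : ℕ)) (rowStart b)
      (fun p : Σ i : Fin (n + 1), Fin (b i) => (p.1 : ℕ)) (exists_row a)
      (fun p x _ h => lt_of_lt_rowStart_add a p x h) (row_unique a)
      (by rw [heq]; exact exists_row b)
      (by rw [heq]; exact fun p x _ h => lt_of_lt_rowStart_add b p x h) (row_unique b) hmeet meets
      (by
        intro q p hq
        refine ⟨?_, Or.inr⟩
        rintro (⟨-, h, -⟩ | h)
        · omega
        · exact h)
      (fun p c => if h : c < p.1 then v (bN.e1 ⟨p, ⟨c, h⟩⟩) else 0) ?_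
    · ext j
      obtain ⟨⟨p, c⟩, rfl⟩ := bN.e1.surjective j
      simpa using key p c c.2
    · intro q c hc
      have h := congrFun hv (bY.e1 ⟨q, ⟨c, hc⟩⟩)
      rw [Matrix.mulVecLin_apply, Matrix.mulVec, dotProduct, ← bN.e1.sum_comp,
        Fintype.sum_sigma, Pi.zero_apply] at h
      refine Eq.trans (Finset.sum_congr rfl fun p _ => ?_) h
      simp only [hf1]
      split_ifs with hm hlt
      · rw [Finset.sum_eq_single ⟨_, hlt⟩]
        · simp [hm]
        · intro d _ hd
          rw [if_neg, zero_mul]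
          rintro ⟨-, hd'⟩
          exact hd (Fin.ext hd')
        · simp
      · refine (Finset.sum_eq_zero fun d _ => ?_).symm
        rw [if_neg, zero_mul]
        rintro ⟨-, hd'⟩
        have := d.2
        omega
      · simp [hm]
  refine ⟨f, inj1, ?_⟩
  rw [← LinearMap.ker_eq_bot, LinearMap.ker_eq_bot']
  intro v hv
  obtain ⟨hA, hB⟩ := f.f2_mulVec_eq_zero inj1 hv
  have hpos := bN.eq_zero_of_mulVec_eq_zero hA hB
  ext j
  obtain ⟨⟨p, c⟩, rfl⟩ := bN.e2.surjective j
  by_cases hp : 0 < (p.1 : ℕ)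
  · exact hpos p hp c
  obtain ⟨i, m⟩ := p
  obtain rfl : i = 0 := Fin.ext (by simpa using hp)
  let q : Σ i : Fin (n + 1), Fin (b i) := ⟨0, ⟨m, m.2.trans_le h0⟩⟩
  have hc := c.2
  have h := congrFun hv (bY.e2 ⟨q, 0⟩)
  rw [Matrix.mulVecLin_apply, Matrix.mulVec, dotProduct, ← bN.e2.sum_comp,
    Finset.sum_eq_single ⟨⟨0, m⟩, c⟩, hf2, if_pos, one_mul] at h
  · exact h
  · refine ⟨Or.inl ⟨rfl, rfl, rfl⟩, ?_⟩
    simp at hc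
    simp [hc]
  · rintro ⟨p, d⟩ - hne
    by_cases hp : 0 < (p.1 : ℕ)
    · rw [hpos p hp d, mul_zero]
    obtain ⟨i, m'⟩ := p
    obtain rfl : i = 0 := Fin.ext (by simpa using hp)
    rw [hf2, if_neg, zero_mul]
    rintro ⟨⟨-, -, hm⟩ | ⟨x, -, h3, h4⟩, -⟩
    · obtain rfl : m' = m := Fin.ext hm
      apply hne
      have hd := d.2
      congr 1
      refine Fin.ext ?_
      simp at hc hd
      simp [hc, hd]
    · simp [q] at h3 h4
      omega
  · simp

theorem PreinjBasis.d1_eq {n : ℕ} {a : ℕ → ℕ} {N : KRep k}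
    (bN : PreinjBasis N fun p : (Σ i : Fin (n + 1), Fin (a i)) => (p.1 : ℕ)) :
    N.d1 = ∑ i ∈ Finset.range (n + 1), i * a i := by
  rw [← card_filter_sigma_le a (fun i => i) le_rfl, Finset.filter_true_of_mem (fun x _ => by omega),
    Finset.card_univ, Fintype.card_congr bN.e1, Fintype.card_fin]

theorem sum_Icc_one_mul (a : ℕ → ℕ) (t : ℕ) :
    ∑ i ∈ Finset.Icc 1 t, i * a i = ∑ i ∈ Finset.range (t + 1), i * a i := by
  refine Finset.sum_subset (fun i hi => ?_) fun i hi hi' => ?_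
  · simp at hi ⊢
    omega
  · obtain rfl : i = 0 := by
      simp at hi hi'
      omega
    simp

/-- Criterion for a short exact sequence `0 → I′ → I → βI₀ → 0` (for some β)
between preinjective Kronecker representations. -/
theorem preinjective_ses_to_I0_criterion (n : ℕ) (a b : ℕ → ℕ) :
    (∃ β : ℕ, SES (KRep.multi k a n) (KRep.multi k b n)
        (KRep.dsumList (List.replicate β (KRep.Inj k 0)))) ↔
      a 0 ≤ b 0 ∧
      (∀ t, 1 ≤ t → t < n →
        (∑ i ∈ Finset.Icc 1 t, i * a i) ≤ ∑ i ∈ Finset.Icc 1 t, i * b i) ∧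
      (∑ i ∈ Finset.Icc 1 n, i * a i) = ∑ i ∈ Finset.Icc 1 n, i * b i := by
  simp only [exists_ses_semisimple_iff, sum_Icc_one_mul]
  obtain ⟨bN⟩ := KRep.nonempty_preinjBasis_multi (k := k) a n
  obtain ⟨bY⟩ := KRep.nonempty_preinjBasis_multi (k := k) b n
  constructor
  · rintro ⟨f, hf1, hf2⟩
    refine ⟨?_, fun t _ ht => ?_, ?_⟩
    · have := PreinjBasis.card_e2_le bN bY f hf2 0
      rw [card_filter_sigma_le a (fun i => i + 1) (Nat.zero_le n),
        card_filter_sigma_le b (fun i => i + 1) (Nat.zero_le n)] at this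
      simpa using this
    · have := PreinjBasis.card_e1_le bN bY f hf1.1 t
      rwa [card_filter_sigma_le a (fun i => i) ht.le,
        card_filter_sigma_le b (fun i => i) ht.le] at this
    · rw [← bN.d1_eq, ← bY.d1_eq]
      simpa using (LinearEquiv.ofBijective _ hf1).finrank_eq
  · rintro ⟨h0, hlt, heq⟩
    have hle : ∀ t ≤ n, ∑ i ∈ Finset.range (t + 1), i * a i ≤
        ∑ i ∈ Finset.range (t + 1), i * b i := by
      intro t ht
      rcases ht.lt_or_eq with ht | rfl
      · rcases Nat.eq_zero_or_pos t with rfl | hpos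
        · simp
        · exact hlt t hpos ht
      · exact heq.le
    obtain ⟨f, h1, h2⟩ := exists_hom_multi (k := k) n a b h0 hle heq
    refine ⟨f, ⟨h1, ?_⟩, h2⟩
    refine (LinearMap.injective_iff_surjective_of_finrank_eq_finrank ?_).1 h1
    simp [bN.d1_eq, bY.d1_eq, heq]
end

section
/- In the category of finite-dimensional Kronecker quiver representations, if 0 → Y → M → Y′ → 0 is a short exact sequence with Y and Y′ both preinjective (i.e., all indecomposable summands have defect +1, equivalently of the form Iₗ), then M is preinjective. -/
open Matrix Finset

variable {k : Type} [Field k]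

/-- `M` is preinjective: a direct sum of indecomposables `Iₗ`. -/
def KRep.Preinjective (M : KRep k) : Prop :=
  ∃ l : List ℕ, KIso M (KRep.dsumList (l.map (KRep.Inj k)))

/-- Bases adapted to a decomposition of the Kronecker module `A, B : V₂ → V₁` into
preinjective indecomposables of sizes `l i`. -/
structure ChainBasis {V₁ V₂ : Type} [AddCommGroup V₁] [Module k V₁] [AddCommGroup V₂] [Module k V₂]
    (A B : V₂ →ₗ[k] V₁) {ι : Type} (l : ι → ℕ) where
  b₁ : Module.Basis (Σ i, Fin (l i)) k V₁
  b₂ : Module.Basis (Σ i, Fin (l i + 1)) k V₂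
  map_A : ∀ i j, A (b₂ ⟨i, j⟩) = Fin.snoc (α := fun _ => V₁) (fun j' => b₁ ⟨i, j'⟩) 0 j
  map_B : ∀ i j, B (b₂ ⟨i, j⟩) = Fin.cons (α := fun _ => V₁) 0 (fun j' => b₁ ⟨i, j'⟩) j

/-- `A` is surjective and the only subspace `X` of `V₁` with `B (A⁻¹ X) ≤ X` is `V₁`. -/
def Exhausting {V₁ V₂ : Type} [AddCommGroup V₁] [Module k V₁] [AddCommGroup V₂] [Module k V₂]
    (A B : V₂ →ₗ[k] V₁) : Prop :=
  Function.Surjective A ∧ ∀ X : Submodule k V₁, (∀ v, A v ∈ X → B v ∈ X) → X = ⊤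

section

variable {V₁ V₂ W₁ W₂ : Type} [AddCommGroup V₁] [Module k V₁] [AddCommGroup V₂] [Module k V₂]
  [AddCommGroup W₁] [Module k W₁] [AddCommGroup W₂] [Module k W₂]
  {A B : V₂ →ₗ[k] V₁} {A' B' : W₂ →ₗ[k] W₁} {ι ι' : Type} {l : ι → ℕ} {l' : ι' → ℕ}

/-- Transport of a chain basis along an isomorphism. -/
noncomputable def ChainBasis.map (b : ChainBasis A B l) (e₁ : V₁ ≃ₗ[k] W₁) (e₂ : V₂ ≃ₗ[k] W₂)
    (hA : ∀ v, A' (e₂ v) = e₁ (A v)) (hB : ∀ v, B' (e₂ v) = e₁ (B v)) : ChainBasis A' B' l where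
  b₁ := b.b₁.map e₁
  b₂ := b.b₂.map e₂
  map_A i j := by
    refine Fin.lastCases ?_ (fun j => ?_) j <;> simp [hA, b.map_A]
  map_B i j := by
    refine Fin.cases ?_ (fun j => ?_) j <;> simp [hB, b.map_B]

/-- Reindexing of a chain basis. -/
noncomputable def ChainBasis.reindex (b : ChainBasis A B l) (e : ι' ≃ ι) :
    ChainBasis A B (l ∘ e) where
  b₁ := b.b₁.reindex (Equiv.sigmaCongrLeft (β := fun i => Fin (l i)) e).symm
  b₂ := b.b₂.reindex (Equiv.sigmaCongrLeft (β := fun i => Fin (l i + 1)) e).symm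
  map_A i j := by
    simp only [Module.Basis.reindex_apply, Equiv.symm_symm]
    exact b.map_A (e i) j
  map_B i j := by
    simp only [Module.Basis.reindex_apply, Equiv.symm_symm]
    exact b.map_B (e i) j

/-- The chain basis of a direct sum. -/
noncomputable def ChainBasis.prod (b : ChainBasis A B l) (b' : ChainBasis A' B' l') :
    ChainBasis (A.prodMap A') (B.prodMap B') (Sum.elim l l') where
  b₁ := (b.b₁.prod b'.b₁).reindex
    (Equiv.sumSigmaDistrib (fun i => Fin (Sum.elim l l' i))).symm
  b₂ := (b.b₂.prod b'.b₂).reindex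
    (Equiv.sumSigmaDistrib (fun i => Fin (Sum.elim l l' i + 1))).symm
  map_A i j := by
    rcases i with i | i
    · change Fin (l i + 1) at j
      refine Fin.lastCases ?_ (fun j => ?_) j <;> simp [b.map_A, Equiv.sumSigmaDistrib]
    · change Fin (l' i + 1) at j
      refine Fin.lastCases ?_ (fun j => ?_) j <;> simp [b'.map_A, Equiv.sumSigmaDistrib]
  map_B i j := by
    rcases i with i | i
    · change Fin (l i + 1) at j
      refine Fin.cases ?_ (fun j => ?_) j <;> simp [b.map_B, Equiv.sumSigmaDistrib]
    · change Fin (l' i + 1) at j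
      refine Fin.cases ?_ (fun j => ?_) j <;> simp [b'.map_B, Equiv.sumSigmaDistrib]

theorem ChainBasis.exists_equiv (b : ChainBasis A B l) (b' : ChainBasis A' B' l) :
    ∃ (e₁ : V₁ ≃ₗ[k] W₁) (e₂ : V₂ ≃ₗ[k] W₂),
      e₁.toLinearMap ∘ₗ A = A' ∘ₗ e₂.toLinearMap ∧
      e₁.toLinearMap ∘ₗ B = B' ∘ₗ e₂.toLinearMap := by
  refine ⟨b.b₁.equiv b'.b₁ (Equiv.refl _), b.b₂.equiv b'.b₂ (Equiv.refl _),
    b.b₂.ext fun ⟨i, j⟩ => ?_, b.b₂.ext fun ⟨i, j⟩ => ?_⟩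
  · refine Fin.lastCases ?_ (fun j => ?_) j <;> simp [b.map_A, b'.map_A]
  · refine Fin.cases ?_ (fun j => ?_) j <;> simp [b.map_B, b'.map_B]

theorem ChainBasis.exhausting (b : ChainBasis A B l) : Exhausting A B := by
  constructor
  · rw [← LinearMap.range_eq_top, eq_top_iff, ← b.b₁.span_eq, Submodule.span_le]
    rintro _ ⟨⟨i, j⟩, rfl⟩
    exact ⟨b.b₂ ⟨i, j.castSucc⟩, by simp [b.map_A]⟩
  · intro X hX
    rw [eq_top_iff, ← b.b₁.span_eq, Submodule.span_le]
    rintro _ ⟨⟨i, j⟩, rfl⟩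
    have key : ∀ j : Fin (l i + 1),
        Fin.snoc (α := fun _ => V₁) (fun j' => b.b₁ ⟨i, j'⟩) 0 j ∈ X := by
      intro j
      induction j using Fin.reverseInduction with
      | last => simp
      | cast j ih =>
        rw [← b.map_A] at ih
        simpa [b.map_B] using hX _ ih
    simpa using key j.castSucc

/-- Exhausting pairs are closed under extensions. -/
theorem Exhausting.extension {U₁ U₂ : Type} [AddCommGroup U₁] [Module k U₁] [AddCommGroup U₂]
    [Module k U₂] {A'' B'' : U₂ →ₗ[k] U₁} (h : Exhausting A B) (h'' : Exhausting A'' B'')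
    {f₁ : V₁ →ₗ[k] W₁} {f₂ : V₂ →ₗ[k] W₂} {g₁ : W₁ →ₗ[k] U₁} {g₂ : W₂ →ₗ[k] U₂}
    (hfA : ∀ v, f₁ (A v) = A' (f₂ v)) (hfB : ∀ v, f₁ (B v) = B' (f₂ v))
    (hgA : ∀ v, g₁ (A' v) = A'' (g₂ v)) (hgB : ∀ v, g₁ (B' v) = B'' (g₂ v))
    (hg₂ : Function.Surjective g₂) (hex : LinearMap.ker g₁ ≤ LinearMap.range f₁) :
    Exhausting A' B' := by
  constructor
  · intro w
    obtain ⟨u, hu⟩ := h''.1 (g₁ w)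
    obtain ⟨x, rfl⟩ := hg₂ u
    obtain ⟨v, hv⟩ := hex (show w - A' x ∈ LinearMap.ker g₁ by simp [hgA, hu])
    obtain ⟨y, rfl⟩ := h.1 v
    exact ⟨f₂ y + x, by rw [map_add, ← hfA, hv]; abel⟩
  · intro X hX
    have hf : LinearMap.range f₁ ≤ X := by
      have := h.2 (X.comap f₁) fun v hv => by
        simp only [Submodule.mem_comap, hfA, hfB] at hv ⊢
        exact hX _ hv
      rintro _ ⟨v, rfl⟩
      exact (this ▸ Submodule.mem_top : v ∈ X.comap f₁)
    have hker : ∀ w, ∀ x ∈ X, g₁ x = g₁ w → w ∈ X := fun w x hx hxw => by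
      simpa using X.add_mem (hf (hex (show w - x ∈ LinearMap.ker g₁ by simp [hxw]))) hx
    have hg := h''.2 (X.map g₁) fun u hu => by
      obtain ⟨w, rfl⟩ := hg₂ u
      obtain ⟨x, hx, hxw⟩ := hu
      exact ⟨B' w, hX w (hker _ x hx (by rw [hxw, hgA])), hgB w⟩
    refine eq_top_iff.2 fun w _ => ?_
    obtain ⟨x, hx, hxw⟩ := (hg ▸ Submodule.mem_top : g₁ w ∈ X.map g₁)
    exact hker w x hx hxw

theorem Exhausting.quotient (h : Exhausting A B) {R : Submodule k V₁} {C : V₁ →ₗ[k] V₁ ⧸ R}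
    (hC : ∀ v, C (A v) = R.mkQ (B v)) : Exhausting R.mkQ C := by
  refine ⟨Submodule.mkQ_surjective _, fun X hX => ?_⟩
  have := h.2 (X.comap R.mkQ) fun v hv => by
    rw [Submodule.mem_comap, ← hC]
    exact hX _ hv
  refine eq_top_iff.2 fun x _ => ?_
  obtain ⟨y, rfl⟩ := Submodule.mkQ_surjective _ x
  exact (this ▸ Submodule.mem_top : y ∈ X.comap R.mkQ)

/-- A chain basis of the reduced module `V₁ → V₁ ⧸ B (ker A)` lifts to one of `A, B`, with every
chain lengthened by one and finitely many chains of length zero added. -/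
theorem exists_chainBasis_of_quotient [Module.Finite k V₁] [Module.Finite k V₂] [Fintype ι]
    (hA : Function.Surjective A) {R : Submodule k V₁} (hR : (LinearMap.ker A).map B = R)
    {C : V₁ →ₗ[k] V₁ ⧸ R} (hC : ∀ v, C (A v) = R.mkQ (B v)) (b : ChainBasis R.mkQ C l) :
    ∃ m : ℕ, Nonempty (ChainBasis A B (Sum.elim (fun i => l i + 1) (fun _ : Fin m => 0))) := by
  obtain ⟨m, ⟨w⟩⟩ : ∃ m : ℕ,
      Nonempty (Module.Basis (Fin m) k (LinearMap.ker (B.domRestrict (LinearMap.ker A)))) :=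
    ⟨_, ⟨Module.finBasis k _⟩⟩
  refine ⟨m, ?_⟩
  let L : ι ⊕ Fin m → ℕ := Sum.elim (fun i => l i + 1) (fun _ => 0)
  have lift : ∀ x y, C x = R.mkQ y → ∃ v, A v = x ∧ B v = y := by
    intro x y hxy
    obtain ⟨v, rfl⟩ := hA x
    rw [hC, ← sub_eq_zero, ← map_sub, Submodule.mkQ_apply, Submodule.Quotient.mk_eq_zero,
      ← hR] at hxy
    obtain ⟨u, hu, huv⟩ := hxy
    exact ⟨v - u, by simpa using hu, by simp [huv]⟩
  have hv : ∀ i (j : Fin (l i + 2)), ∃ v,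
      A v = Fin.snoc (α := fun _ => V₁) (fun j' => b.b₂ ⟨i, j'⟩) 0 j ∧
      B v = Fin.cons (α := fun _ => V₁) 0 (fun j' => b.b₂ ⟨i, j'⟩) j := by
    intro i j
    apply lift
    refine Fin.cases ?_ (fun j => ?_) j
    · have := b.map_B i 0
      rw [← Fin.castSucc_zero, Fin.snoc_castSucc]
      simpa using this
    · rw [Fin.cons_succ, b.map_A]
      refine Fin.lastCases ?_ (fun j => ?_) j
      · simp
      · rw [Fin.succ_castSucc, Fin.snoc_castSucc, Fin.snoc_castSucc, b.map_B, Fin.cons_succ]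
  choose v hvA hvB using hv
  let F : (Σ s, Fin (L s + 1)) → V₂ := fun p => match p with
    | ⟨Sum.inl i, j⟩ => v i j
    | ⟨Sum.inr t, _⟩ => ((w t : LinearMap.ker A) : V₂)
  have hwA : ∀ t, A (w t : LinearMap.ker A) = 0 := fun t => (w t : LinearMap.ker A).2
  have hwB : ∀ t, B (w t : LinearMap.ker A) = 0 := fun t => (w t).2
  have hF : LinearIndependent k F := by
    rw [Fintype.linearIndependent_iff]
    intro g hg
    have hsum : ∑ i, (∑ j : Fin (l i + 1), g ⟨Sum.inl i, j.castSucc⟩ • v i j.castSucc +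
        g ⟨Sum.inl i, Fin.last (l i + 1)⟩ • v i (Fin.last (l i + 1))) +
        ∑ t, g ⟨Sum.inr t, (0 : Fin 1)⟩ • ((w t : LinearMap.ker A) : V₂) = 0 := by
      rw [← hg, Fintype.sum_sigma, Fintype.sum_sum_type]
      congr 1
      · exact Finset.sum_congr rfl fun i _ => (Fin.sum_univ_castSucc (n := l i + 1)
          fun j => g ⟨Sum.inl i, j⟩ • v i j).symm
      · exact Finset.sum_congr rfl fun t _ => (Fin.sum_univ_one
          fun j : Fin 1 => g ⟨Sum.inr t, j⟩ • ((w t : LinearMap.ker A) : V₂)).symm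
    have h₁ : ∀ i (j : Fin (l i + 1)), g ⟨Sum.inl i, j.castSucc⟩ = 0 := by
      have := congrArg A hsum
      simp only [map_add, map_sum, map_smul, hvA, hwA, Fin.snoc_castSucc, Fin.snoc_last,
        smul_zero, Finset.sum_const_zero, add_zero, map_zero] at this
      intro i j
      refine Fintype.linearIndependent_iff.1 b.b₂.linearIndependent
        (fun p => g ⟨Sum.inl p.1, p.2.castSucc⟩) ?_ ⟨i, j⟩
      rw [Fintype.sum_sigma]
      exact this
    simp only [h₁, zero_smul, Finset.sum_const_zero, zero_add] at hsum
    have h₂ : ∀ i, g ⟨Sum.inl i, Fin.last (l i + 1)⟩ = 0 := by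
      have := congrArg B hsum
      simp only [map_add, map_sum, map_smul, hvB, hwB, ← Fin.succ_last, Fin.cons_succ,
        smul_zero, Finset.sum_const_zero, add_zero, map_zero] at this
      exact Fintype.linearIndependent_iff.1 (b.b₂.linearIndependent.comp
        (fun i => ⟨i, Fin.last (l i)⟩) fun i j hij => congrArg Sigma.fst hij) _ this
    simp only [h₂, zero_smul, Finset.sum_const_zero, zero_add] at hsum
    have h₃ : ∀ t, g ⟨Sum.inr t, (0 : Fin 1)⟩ = 0 := by
      refine Fintype.linearIndependent_iff.1 w.linearIndependent _ ?_
      apply Subtype.ext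
      apply Subtype.ext
      simpa using hsum
    rintro ⟨i | t, j⟩
    · change Fin (l i + 2) at j
      exact Fin.lastCases (h₂ i) (h₁ i) j
    · change Fin 1 at j
      rw [Subsingleton.elim j 0]
      exact h₃ t
  have hcard : Fintype.card (Σ s, Fin (L s + 1)) = Module.finrank k V₂ := by
    have h₁ := LinearMap.finrank_range_add_finrank_ker A
    have h₂ := LinearMap.finrank_range_add_finrank_ker (B.domRestrict (LinearMap.ker A))
    have h₃ := R.finrank_quotient_add_finrank
    have h₄ := Module.finrank_eq_card_basis b.b₂
    rw [LinearMap.range_eq_top.2 hA, finrank_top] at h₁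
    rw [LinearMap.range_domRestrict, hR, Module.finrank_eq_card_basis w] at h₂
    rw [Module.finrank_eq_card_basis b.b₁] at h₃
    simp only [L, Fintype.card_sigma, Fintype.card_fin, Fintype.sum_sum_type, Sum.elim_inl,
      Sum.elim_inr, Finset.sum_add_distrib, Finset.sum_const, Finset.card_univ,
      Fintype.card_sum,
      smul_eq_mul, mul_one] at h₂ h₃ h₄ ⊢
    omega
  have : IsEmpty (Σ t : Fin m, Fin (L (Sum.inr t))) := ⟨fun p => p.2.elim0⟩
  let b₁ : Module.Basis (Σ s, Fin (L s)) k V₁ :=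
    b.b₂.reindex ((Equiv.sumEmpty _ (Σ t : Fin m, Fin (L (Sum.inr t)))).symm.trans
      (Equiv.sumSigmaDistrib (fun s => Fin (L s))).symm)
  have hb₁ : ∀ i j, b₁ ⟨Sum.inl i, j⟩ = b.b₂ ⟨i, j⟩ := fun i j =>
    Module.Basis.reindex_apply ..
  have hb₂ : ⇑(basisOfLinearIndependentOfCardEqFinrank' F hF hcard) = F :=
    coe_basisOfLinearIndependentOfCardEqFinrank' ..
  refine ⟨⟨b₁, basisOfLinearIndependentOfCardEqFinrank' F hF hcard, ?_, ?_⟩⟩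
  · rintro (i | t) j
    · simp only [hb₂, hb₁]
      exact hvA i j
    · change Fin 1 at j
      rw [hb₂, Subsingleton.elim j (Fin.last 0)]
      exact (hwA t).trans (Fin.snoc_last (n := 0) (α := fun _ => V₁) _ _).symm
  · rintro (i | t) j
    · simp only [hb₂, hb₁]
      exact hvB i j
    · change Fin 1 at j
      rw [hb₂, Subsingleton.elim j 0]
      exact hwB t

end

theorem Exhausting.exists_chainBasis {V₁ V₂ : Type} [AddCommGroup V₁] [Module k V₁]
    [AddCommGroup V₂] [Module k V₂] [Module.Finite k V₁] [Module.Finite k V₂]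
    {A B : V₂ →ₗ[k] V₁} (h : Exhausting A B) :
    ∃ (ι : Type) (_ : Fintype ι) (l : ι → ℕ), Nonempty (ChainBasis A B l) := by
  induction hn : Module.finrank k V₁ using Nat.strong_induction_on generalizing V₁ V₂ with
  | _ n ih =>
  rcases Nat.eq_zero_or_pos n with rfl | hpos
  · have := Module.finrank_zero_iff.1 hn
    have : IsEmpty (Σ _ : Fin (Module.finrank k V₂), Fin 0) := ⟨fun p => p.2.elim0⟩
    let b₂ := Module.finBasis k V₂
    exact ⟨Fin _, inferInstance, fun _ => 0, ⟨{
      b₁ := Module.Basis.empty V₁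
      b₂ := b₂.reindex (Equiv.sigmaUnique _ (fun _ => Fin 1)).symm
      map_A := fun i j => Subsingleton.elim _ _
      map_B := fun i j => Subsingleton.elim _ _ }⟩⟩
  · set R := (LinearMap.ker A).map B with hR
    obtain ⟨S, hS⟩ := A.exists_rightInverse_of_surjective (LinearMap.range_eq_top.2 h.1)
    have hC : ∀ v, (R.mkQ ∘ₗ B ∘ₗ S) (A v) = R.mkQ (B v) := fun v => by
      rw [← sub_eq_zero, LinearMap.comp_apply, ← map_sub, Submodule.mkQ_apply,
        Submodule.Quotient.mk_eq_zero]
      refine ⟨S (A v) - v, ?_, by simp⟩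
      have := LinearMap.congr_fun hS (A v)
      simp only [LinearMap.comp_apply, LinearMap.id_apply] at this
      simp [this]
    have hR0 : R ≠ ⊥ := fun h0 => by
      have : (⊥ : Submodule k V₁) = ⊤ := h.2 ⊥ fun v hv => by
        rw [← h0]
        exact ⟨v, by simpa using hv, rfl⟩
      rw [← finrank_top k V₁, ← this, finrank_bot] at hn
      omega
    have hlt : Module.finrank k (V₁ ⧸ R) < n := by
      have h₁ := R.finrank_quotient_add_finrank
      have h₂ := Submodule.one_le_finrank_iff.2 hR0
      omega
    obtain ⟨ι, _, l, ⟨b⟩⟩ := ih _ hlt (h.quotient hC) rfl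
    obtain ⟨m, hm⟩ := exists_chainBasis_of_quotient h.1 hR.symm hC b
    exact ⟨_, inferInstance, _, hm⟩

theorem exists_equiv_of_map_univ_eq {ι ι' α : Type*} [Fintype ι] [Fintype ι'] {l : ι → α}
    {l' : ι' → α} (h : Finset.univ.val.map l = Finset.univ.val.map l') :
    ∃ e : ι ≃ ι', l' ∘ e = l := by
  classical
  have hc : ∀ c, Fintype.card {i // l i = c} = Fintype.card {i // l' i = c} := fun c => by
    have := congrArg (Multiset.count c) h
    simp only [Multiset.count_map, eq_comm (a := c)] at this
    rw [Fintype.card_subtype, Fintype.card_subtype]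
    exact this
  exact ⟨Equiv.ofFiberEquiv fun c => Fintype.equivOfCardEq (hc c),
    funext fun i => Equiv.ofFiberEquiv_map _ i⟩

/-- A representation has chain bases with multiset of lengths `s`. -/
def KRep.HasChains (M : KRep k) (s : Multiset ℕ) : Prop :=
  ∃ (ι : Type) (_ : Fintype ι) (l : ι → ℕ), Finset.univ.val.map l = s ∧
    Nonempty (ChainBasis M.A.mulVecLin M.B.mulVecLin l)

theorem KRep.hasChains_zero : (KRep.zero : KRep k).HasChains 0 := by
  have : IsEmpty (Fin (KRep.zero : KRep k).d1) := inferInstanceAs (IsEmpty (Fin 0))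
  have : IsEmpty (Fin (KRep.zero : KRep k).d2) := inferInstanceAs (IsEmpty (Fin 0))
  exact ⟨Empty, inferInstance, Empty.elim, rfl,
    ⟨⟨Module.Basis.empty _, Module.Basis.empty _, fun i => i.elim, fun i => i.elim⟩⟩⟩

theorem KRep.hasChains_inj (n : ℕ) : (KRep.Inj k n).HasChains {n} := by
  let A : Matrix (Fin n) (Fin (n + 1)) k := (KRep.Inj k n).A
  let B : Matrix (Fin n) (Fin (n + 1)) k := (KRep.Inj k n).B
  let b (m : ℕ) : Module.Basis (Σ _ : Unit, Fin m) k (Fin m → k) :=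
    (Pi.basisFun k (Fin m)).reindex (Equiv.uniqueSigma (fun _ : Unit => Fin m)).symm
  have hb : ∀ m i j, b m ⟨i, j⟩ = Pi.single j 1 := fun m i j =>
    (Module.Basis.reindex_apply ..).trans (Pi.basisFun_apply ..)
  have c : ChainBasis A.mulVecLin B.mulVecLin (fun _ : Unit => n) :=
    { b₁ := b n
      b₂ := b (n + 1)
      map_A := fun i j => by
        simp only [hb, Matrix.mulVecLin_apply, Matrix.mulVec_single_one]
        ext x
        refine Fin.lastCases ?_ (fun j => ?_) j
        · simpa [A, KRep.Inj] using x.2.ne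
        · simp [A, KRep.Inj, Pi.single_apply, Fin.ext_iff]
      map_B := fun i j => by
        simp only [hb, Matrix.mulVecLin_apply, Matrix.mulVec_single_one]
        ext x
        refine Fin.cases ?_ (fun j => ?_) j
        · simp [B, KRep.Inj]
        · simp [B, KRep.Inj, Pi.single_apply, Fin.ext_iff] }
  exact ⟨Unit, inferInstance, fun _ => n, rfl, ⟨c⟩⟩

theorem KRep.HasChains.dsum {M N : KRep k} {s t : Multiset ℕ} (hM : M.HasChains s)
    (hN : N.HasChains t) : (M.dsum N).HasChains (s + t) := by
  obtain ⟨ι, _, l, rfl, ⟨b⟩⟩ := hM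
  obtain ⟨ι', _, l', rfl, ⟨b'⟩⟩ := hN
  let e (a c : ℕ) : ((Fin a → k) × (Fin c → k)) ≃ₗ[k] (Fin (a + c) → k) :=
    (LinearEquiv.sumArrowLequivProdArrow (Fin a) (Fin c) k k).symm.trans
      (LinearEquiv.funCongrLeft k k finSumFinEquiv.symm)
  have hmul {a₁ a₂ c₁ c₂ : ℕ} (X : Matrix (Fin a₁) (Fin a₂) k) (Z : Matrix (Fin c₁) (Fin c₂) k)
      (v : (Fin a₂ → k) × (Fin c₂ → k)) :
      (Matrix.reindex finSumFinEquiv finSumFinEquiv (Matrix.fromBlocks X 0 0 Z)).mulVecLin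
        (e a₂ c₂ v) = e a₁ c₁ (X.mulVecLin.prodMap Z.mulVecLin v) := by
    obtain ⟨x, y⟩ := v
    have he : ∀ (a c : ℕ) (x : Fin a → k) (y : Fin c → k),
        e a c (x, y) = Sum.elim x y ∘ finSumFinEquiv.symm := fun a c x y => rfl
    rw [LinearMap.prodMap_apply, he, he, Matrix.mulVecLin_apply, Matrix.reindex_apply,
      Matrix.submatrix_mulVec_equiv, Matrix.fromBlocks_mulVec]
    simp [Function.comp_assoc]
  refine ⟨ι ⊕ ι', inferInstance, Sum.elim l l', ?_,
    ⟨(b.prod b').map (e M.d1 N.d1) (e M.d2 N.d2) ?_ ?_⟩⟩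
  · rw [← Finset.univ_disjSum_univ, Finset.val_disjSum, Multiset.disjSum, Multiset.map_add,
      Multiset.map_map, Multiset.map_map]
    rfl
  · exact hmul M.A N.A
  · exact hmul M.B N.B

theorem KRep.hasChains_dsumList (L : List ℕ) :
    (KRep.dsumList (L.map (KRep.Inj k))).HasChains L := by
  induction L with
  | nil => exact KRep.hasChains_zero
  | cons n L ih => exact (KRep.hasChains_inj n).dsum ih

theorem KHom.map_A {M N : KRep k} (f : KHom M N) (v : Fin M.d2 → k) :
    f.f1.mulVecLin (M.A.mulVecLin v) = N.A.mulVecLin (f.f2.mulVecLin v) := by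
  simp only [Matrix.mulVecLin_apply, Matrix.mulVec_mulVec, f.comm_a]

theorem KHom.map_B {M N : KRep k} (f : KHom M N) (v : Fin M.d2 → k) :
    f.f1.mulVecLin (M.B.mulVecLin v) = N.B.mulVecLin (f.f2.mulVecLin v) := by
  simp only [Matrix.mulVecLin_apply, Matrix.mulVec_mulVec, f.comm_b]

theorem KRep.HasChains.kIso {M N : KRep k} {s : Multiset ℕ} (hM : M.HasChains s)
    (hN : N.HasChains s) : KIso M N := by
  obtain ⟨ι, _, l, rfl, ⟨b⟩⟩ := hM
  obtain ⟨ι', _, l', hl, ⟨b'⟩⟩ := hN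
  obtain ⟨e, rfl⟩ := exists_equiv_of_map_univ_eq hl.symm
  obtain ⟨e₁, e₂, hA, hB⟩ := b.exists_equiv (b'.reindex e)
  refine ⟨⟨LinearMap.toMatrix' e₁.toLinearMap, LinearMap.toMatrix' e₂.toLinearMap, ?_, ?_⟩, ?_, ?_⟩
  · have := congrArg LinearMap.toMatrix' hA
    rwa [LinearMap.toMatrix'_comp, LinearMap.toMatrix'_comp, ← Matrix.toLin'_apply',
      ← Matrix.toLin'_apply', LinearMap.toMatrix'_toLin', LinearMap.toMatrix'_toLin'] at this
  · have := congrArg LinearMap.toMatrix' hB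
    rwa [LinearMap.toMatrix'_comp, LinearMap.toMatrix'_comp, ← Matrix.toLin'_apply',
      ← Matrix.toLin'_apply', LinearMap.toMatrix'_toLin', LinearMap.toMatrix'_toLin'] at this
  · rw [← Matrix.toLin'_apply', Matrix.toLin'_toMatrix']
    exact e₁.bijective
  · rw [← Matrix.toLin'_apply', Matrix.toLin'_toMatrix']
    exact e₂.bijective

theorem KRep.Preinjective.exhausting {M : KRep k} (hM : M.Preinjective) :
    Exhausting M.A.mulVecLin M.B.mulVecLin := by
  obtain ⟨L, f, hf₁, hf₂⟩ := hM
  obtain ⟨ι, _, l, -, ⟨b⟩⟩ := KRep.hasChains_dsumList (k := k) L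
  let e₁ := LinearEquiv.ofBijective _ hf₁
  let e₂ := LinearEquiv.ofBijective _ hf₂
  refine (b.map e₁.symm e₂.symm (fun v => ?_) fun v => ?_).exhausting
  · rw [LinearEquiv.eq_symm_apply]
    exact (f.map_A _).trans (congrArg _ (e₂.apply_symm_apply v))
  · rw [LinearEquiv.eq_symm_apply]
    exact (f.map_B _).trans (congrArg _ (e₂.apply_symm_apply v))

/-- Preinjective Kronecker representations are closed under extensions. -/
theorem preinjective_extension_closed (Y M Y' : KRep k)
    (h : SES Y M Y') (hY : Y.Preinjective) (hY' : Y'.Preinjective) :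
    M.Preinjective := by
  obtain ⟨f, g, -, hg, hex, -⟩ := h
  obtain ⟨ι, _, l, hb⟩ := Exhausting.exists_chainBasis <|
    hY.exhausting.extension hY'.exhausting (A' := M.A.mulVecLin) (B' := M.B.mulVecLin)
      f.map_A f.map_B g.map_A g.map_B hg.2 hex.ge
  have hM : M.HasChains (Finset.univ.val.map l) := ⟨ι, _, l, rfl, hb⟩
  refine ⟨(Finset.univ.val.map l).toList, hM.kIso ?_⟩
  simpa using KRep.hasChains_dsumList (k := k) (Finset.univ.val.map l).toList
end

section
/- Let q > α > 0, d₁ ≥ … ≥ d_q ≥ 0 and c₁ ≥ … ≥ c_{q−α} ≥ 0 be integers. There is a short exact sequence 0 → αP₀ → I_{c₁} ⊕ … ⊕ I_{c_{q−α}} → I_{d₁} ⊕ … ⊕ I_{d_q} → 0 of Kronecker representations if and only if there is a short exact sequence 0 → I_{c₁+1} ⊕ … ⊕ I_{c_{q−α}+1} → I_{d₁+1} ⊕ … ⊕ I_{d_q+1} → αI₀ → 0. -/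
open Matrix Finset

variable {k : Type} [Field k]

namespace KRep

/-- The first structure map of a Kronecker representation, as a linear map. -/
abbrev a (M : KRep k) : (Fin M.d2 → k) →ₗ[k] (Fin M.d1 → k) := M.A.mulVecLin

/-- The second structure map of a Kronecker representation, as a linear map. -/
abbrev b (M : KRep k) : (Fin M.d2 → k) →ₗ[k] (Fin M.d1 → k) := M.B.mulVecLin

/-- `M'` is the reflection of `M`: after identifying `M'₁` with `M₂` there is a short exact
sequence `0 → M'₂ → M₂ × M₂ → M₁ → 0` with maps `w ↦ (a w, b w)` and `(x, y) ↦ b x - a y`. -/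
def IsShift (M M' : KRep k) : Prop :=
  ∃ e : (Fin M'.d1 → k) ≃ₗ[k] (Fin M.d2 → k),
    (∀ w, M'.a w = 0 → M'.b w = 0 → w = 0) ∧
    (∀ x y, M.b x = M.a y ↔ ∃ w, e (M'.a w) = x ∧ e (M'.b w) = y) ∧
    ∀ z, ∃ x y, M.b x - M.a y = z

end KRep

section LinearMaps

variable {U V W : Type*} [AddCommGroup U] [AddCommGroup V] [AddCommGroup W]
  [Module k U] [Module k V] [Module k W]

theorem LinearMap.exists_comp_eq_of_range_le (i : V →ₗ[k] W) (hi : ∀ v, i v = 0 → v = 0)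
    (q : U →ₗ[k] W) (h : ∀ u, ∃ v, i v = q u) : ∃ r : U →ₗ[k] V, ∀ u, i (r u) = q u := by
  obtain ⟨j, hj⟩ := i.exists_leftInverse_of_injective (LinearMap.ker_eq_bot'.2 hi)
  refine ⟨j ∘ₗ q, fun u => ?_⟩
  obtain ⟨v, hv⟩ := h u
  have : j (i v) = v := LinearMap.congr_fun hj v
  simp [← hv, this]

theorem LinearMap.exists_comp_eq_of_ker_le (p : U →ₗ[k] V) (hp : Function.Surjective p)
    (q : U →ₗ[k] W) (h : ∀ u, p u = 0 → q u = 0) : ∃ r : V →ₗ[k] W, ∀ u, r (p u) = q u := by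
  obtain ⟨j, hj⟩ := p.exists_rightInverse_of_surjective (LinearMap.range_eq_top.2 hp)
  refine ⟨q ∘ₗ j, fun u => ?_⟩
  have h1 : p (j (p u)) = p u := LinearMap.congr_fun hj (p u)
  have h2 := h (j (p u) - u) (by simp [h1])
  simpa [sub_eq_zero] using h2

end LinearMaps

/-- A short exact sequence of Kronecker representations in terms of linear maps. -/
theorem SES_iff (N Y M : KRep k) : SES N Y M ↔
    ∃ (f₁ : (Fin N.d1 → k) →ₗ[k] (Fin Y.d1 → k)) (f₂ : (Fin N.d2 → k) →ₗ[k] (Fin Y.d2 → k))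
      (g₁ : (Fin Y.d1 → k) →ₗ[k] (Fin M.d1 → k)) (g₂ : (Fin Y.d2 → k) →ₗ[k] (Fin M.d2 → k)),
      ((∀ x, f₁ (N.a x) = Y.a (f₂ x)) ∧ (∀ x, f₁ (N.b x) = Y.b (f₂ x)) ∧
        (∀ x, g₁ (Y.a x) = M.a (g₂ x)) ∧ (∀ x, g₁ (Y.b x) = M.b (g₂ x))) ∧
      ((∀ x, f₁ x = 0 → x = 0) ∧ (∀ x, f₂ x = 0 → x = 0)) ∧
      (Function.Surjective g₁ ∧ Function.Surjective g₂) ∧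
      (∀ y, g₁ y = 0 ↔ ∃ x, f₁ x = y) ∧ (∀ y, g₂ y = 0 ↔ ∃ x, f₂ x = y) := by
  constructor
  · rintro ⟨f, g, ⟨hf₁, hf₂⟩, hg, h₁, h₂⟩
    refine ⟨f.f1.mulVecLin, f.f2.mulVecLin, g.f1.mulVecLin, g.f2.mulVecLin,
      ⟨?_, ?_, ?_, ?_⟩, ⟨fun x hx => hf₁ (by simpa using hx), fun x hx => hf₂ (by simpa using hx)⟩,
      hg, fun y => ?_, fun y => ?_⟩
    · intro x; simp [f.comm_a]
    · intro x; simp [f.comm_b]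
    · intro x; simp [g.comm_a]
    · intro x; simp [g.comm_b]
    · rw [← LinearMap.mem_ker, ← h₁, LinearMap.mem_range]
    · rw [← LinearMap.mem_ker, ← h₂, LinearMap.mem_range]
  · rintro ⟨f₁, f₂, g₁, g₂, ⟨hfa, hfb, hga, hgb⟩, ⟨hf₁, hf₂⟩, ⟨hg₁, hg₂⟩, h₁, h₂⟩
    refine ⟨⟨LinearMap.toMatrix' f₁, LinearMap.toMatrix' f₂, ?_, ?_⟩,
      ⟨LinearMap.toMatrix' g₁, LinearMap.toMatrix' g₂, ?_, ?_⟩, ?_⟩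
    · exact Matrix.toLin'.injective (LinearMap.ext fun x => by
        simpa [Matrix.toLin'_mul] using hfa x)
    · exact Matrix.toLin'.injective (LinearMap.ext fun x => by
        simpa [Matrix.toLin'_mul] using hfb x)
    · exact Matrix.toLin'.injective (LinearMap.ext fun x => by
        simpa [Matrix.toLin'_mul] using hga x)
    · exact Matrix.toLin'.injective (LinearMap.ext fun x => by
        simpa [Matrix.toLin'_mul] using hgb x)
    simp only [KHom.Mono, KHom.Epi, ← Matrix.toLin'_apply', Matrix.toLin'_toMatrix']
    refine ⟨⟨?_, ?_⟩, ⟨hg₁, hg₂⟩, ?_, ?_⟩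
    · exact (injective_iff_map_eq_zero f₁).2 hf₁
    · exact (injective_iff_map_eq_zero f₂).2 hf₂
    · ext y; simp [h₁]
    · ext y; simp [h₂]

namespace KRep

theorem IsShift.ses_of_ses {N Y M N' Y' M' : KRep k} (hY : IsShift Y Y') (hM : IsShift M M')
    (hN : N.d2 = 0) (hN' : N'.d1 = 0) (hNN' : N'.d2 = N.d1) (h : SES N Y M) : SES Y' M' N' := by
  rw [SES_iff] at h ⊢
  obtain ⟨f₁, f₂, g₁, g₂, ⟨-, -, hga, hgb⟩, ⟨hf₁, -⟩, ⟨-, hg₂⟩, h₁, h₂⟩ := h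
  obtain ⟨eY, injY, exY, surjY⟩ := hY
  obtain ⟨eM, injM, exM, surjM⟩ := hM
  have : IsEmpty (Fin N.d2) := by rw [hN]; infer_instance
  have : IsEmpty (Fin N'.d1) := by rw [hN']; infer_instance
  have hg₂i : ∀ y, g₂ y = 0 → y = 0 := fun y hy => by
    obtain ⟨x, rfl⟩ := (h₂ y).1 hy
    rw [Subsingleton.elim x 0, map_zero]
  let γ := LinearEquiv.ofBijective g₂ ⟨(injective_iff_map_eq_zero g₂).2 hg₂i, hg₂⟩
  have hγ : ∀ x, g₂ (γ.symm x) = x := fun x => γ.apply_symm_apply x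
  let φ : (Fin Y'.d1 → k) ≃ₗ[k] (Fin M'.d1 → k) := eY ≪≫ₗ γ ≪≫ₗ eM.symm
  have hφ : ∀ x, eM (φ x) = g₂ (eY x) := fun x => eM.apply_symm_apply _
  have hinj : ∀ w, (M'.a.prod M'.b) w = 0 → w = 0 := fun w hw => by
    have hw' := Prod.ext_iff.1 hw
    exact injM w hw'.1 hw'.2
  obtain ⟨ψ, hψ⟩ := LinearMap.exists_comp_eq_of_range_le (M'.a.prod M'.b) hinj
    ((φ.toLinearMap ∘ₗ Y'.a).prod (φ.toLinearMap ∘ₗ Y'.b)) (fun w => by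
      obtain ⟨v, hv, hv'⟩ := (exM (g₂ (eY (Y'.a w))) (g₂ (eY (Y'.b w)))).1 (by
        rw [← hga, ← hgb, (exY _ _).2 ⟨w, rfl, rfl⟩])
      rw [← hφ] at hv hv'
      exact ⟨v, Prod.ext (eM.injective hv) (eM.injective hv')⟩)
  have hψa : ∀ w, M'.a (ψ w) = φ (Y'.a w) := fun w => (Prod.ext_iff.1 (hψ w)).1
  have hψb : ∀ w, M'.b (ψ w) = φ (Y'.b w) := fun w => (Prod.ext_iff.1 (hψ w)).2
  obtain ⟨δ, hδ⟩ := LinearMap.exists_comp_eq_of_range_le f₁ hf₁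
    (Y.b ∘ₗ γ.symm.toLinearMap ∘ₗ eM.toLinearMap ∘ₗ M'.a -
      Y.a ∘ₗ γ.symm.toLinearMap ∘ₗ eM.toLinearMap ∘ₗ M'.b) (fun w => (h₁ _).1 (by
      have := (exM _ _).2 ⟨w, rfl, rfl⟩
      simp only [LinearMap.sub_apply, LinearMap.comp_apply, LinearEquiv.coe_coe, map_sub, hga,
        hgb, hγ, this, sub_self]))
  replace hδ : ∀ w, f₁ (δ w) = Y.b (γ.symm (eM (M'.a w))) - Y.a (γ.symm (eM (M'.b w))) := hδ
  let s : (Fin N.d1 → k) ≃ₗ[k] (Fin N'.d2 → k) := LinearEquiv.funCongrLeft k k (finCongr hNN')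
  refine ⟨φ, ψ, 0, s.toLinearMap ∘ₗ δ,
    ⟨fun w => (hψa w).symm, fun w => (hψb w).symm, fun _ => Subsingleton.elim _ _,
      fun _ => Subsingleton.elim _ _⟩, ⟨fun x hx => by simpa using hx, fun w hw => ?_⟩,
    ⟨fun x => ⟨0, Subsingleton.elim _ _⟩, s.surjective.comp fun n => ?_⟩,
    fun y => ⟨fun _ => φ.surjective y, fun _ => rfl⟩, fun w => ?_⟩
  · refine injY w ?_ ?_
    · have := hψa w
      rw [hw, map_zero] at this
      exact φ.map_eq_zero_iff.1 this.symm
    · have := hψb w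
      rw [hw, map_zero] at this
      exact φ.map_eq_zero_iff.1 this.symm
  · obtain ⟨x, y, hxy⟩ := surjY (f₁ n)
    obtain ⟨w, hw, hw'⟩ := (exM (g₂ x) (g₂ y)).1 (by
      rw [← hga, ← hgb, ← sub_eq_zero, ← map_sub, hxy, (h₁ _).2 ⟨n, rfl⟩])
    refine ⟨w, (injective_iff_map_eq_zero f₁).2 hf₁ ?_⟩
    have hs : ∀ x, γ.symm (g₂ x) = x := fun x => γ.symm_apply_apply x
    change f₁ (δ w) = f₁ n
    rw [hδ, hw, hw', hs, hs, hxy]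
  · have h0 : (s.toLinearMap ∘ₗ δ) w = 0 ↔ f₁ (δ w) = 0 := by
      refine (s.map_eq_zero_iff (x := δ w)).trans ⟨fun h => by rw [h, map_zero], hf₁ _⟩
    rw [h0, hδ, sub_eq_zero, exY]
    refine exists_congr fun v => ⟨fun ⟨ha, hb⟩ => ?_, ?_⟩
    · refine sub_eq_zero.1 (hinj _ (Prod.ext ?_ ?_))
      · change M'.a (ψ v - w) = 0
        rw [map_sub, hψa, sub_eq_zero]
        apply eM.injective
        rw [hφ, ha, hγ]
      · change M'.b (ψ v - w) = 0
        rw [map_sub, hψb, sub_eq_zero]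
        apply eM.injective
        rw [hφ, hb, hγ]
    · rintro rfl
      have hs : ∀ x, γ.symm (g₂ x) = x := fun x => γ.symm_apply_apply x
      rw [hψa, hψb, hφ, hφ, hs, hs]
      exact ⟨rfl, rfl⟩

theorem IsShift.ses_of_ses_shift {N Y M N' Y' M' : KRep k} (hY : IsShift Y Y')
    (hM : IsShift M M') (hN : N.d2 = 0) (hN' : N'.d1 = 0) (hNN' : N'.d2 = N.d1)
    (h : SES Y' M' N') : SES N Y M := by
  rw [SES_iff] at h ⊢
  obtain ⟨f₁, f₂, g₁, g₂, ⟨hfa, hfb, -, -⟩, ⟨hf₁, -⟩, ⟨-, hg₂⟩, h₁, h₂⟩ := h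
  obtain ⟨eY, injY, exY, surjY⟩ := hY
  obtain ⟨eM, injM, exM, surjM⟩ := hM
  have : IsEmpty (Fin N.d2) := by rw [hN]; infer_instance
  have : IsEmpty (Fin N'.d1) := by rw [hN']; infer_instance
  let φ := LinearEquiv.ofBijective f₁ ⟨(injective_iff_map_eq_zero f₁).2 hf₁,
    fun y => (h₁ y).1 (Subsingleton.elim _ _)⟩
  let γ : (Fin Y.d2 → k) ≃ₗ[k] (Fin M.d2 → k) := eY.symm ≪≫ₗ φ ≪≫ₗ eM
  have hγ : ∀ x, γ (eY x) = eM (f₁ x) := fun x => by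
    simp only [γ, LinearEquiv.trans_apply, LinearEquiv.symm_apply_apply]
    rfl
  let πY : (Fin Y.d2 → k) × (Fin Y.d2 → k) →ₗ[k] (Fin Y.d1 → k) := Y.b.coprod (-Y.a)
  have hπY : ∀ x y, πY (x, y) = Y.b x - Y.a y := fun x y => by
    simp [πY, sub_eq_add_neg]
  have hπYs : Function.Surjective πY := fun z => by
    obtain ⟨x, y, h⟩ := surjY z
    exact ⟨(x, y), (hπY x y).trans h⟩
  obtain ⟨ρ, hρ⟩ := LinearMap.exists_comp_eq_of_ker_le πY hπYs
    ((M.b ∘ₗ γ.toLinearMap).coprod (-(M.a ∘ₗ γ.toLinearMap))) (by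
      rintro ⟨x, y⟩ hxy
      rw [hπY, sub_eq_zero, exY] at hxy
      obtain ⟨w, rfl, rfl⟩ := hxy
      have := (exM (γ (eY (Y'.a w))) (γ (eY (Y'.b w)))).2 ⟨f₂ w, by rw [hγ, hfa], by rw [hγ, hfb]⟩
      rw [← sub_eq_zero] at this
      rw [← this]
      simp [sub_eq_add_neg])
  replace hρ : ∀ x y, ρ (Y.b x - Y.a y) = M.b (γ x) - M.a (γ y) := fun x y => by
    rw [← hπY, hρ]; simp [sub_eq_add_neg]
  have hs : ∀ x, γ.symm (eM (f₁ x)) = eY x := fun x => by rw [← hγ, γ.symm_apply_apply]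
  obtain ⟨σ, hσ⟩ := LinearMap.exists_comp_eq_of_ker_le g₂ hg₂
    (Y.b ∘ₗ γ.symm.toLinearMap ∘ₗ eM.toLinearMap ∘ₗ M'.a -
      Y.a ∘ₗ γ.symm.toLinearMap ∘ₗ eM.toLinearMap ∘ₗ M'.b) (fun w hw => by
      obtain ⟨v, rfl⟩ := (h₂ w).1 hw
      change Y.b (γ.symm (eM (M'.a (f₂ v)))) - Y.a (γ.symm (eM (M'.b (f₂ v)))) = 0
      rw [sub_eq_zero, ← hfa, ← hfb, hs, hs, (exY _ _).2 ⟨v, rfl, rfl⟩])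
  replace hσ : ∀ w, σ (g₂ w) = Y.b (γ.symm (eM (M'.a w))) - Y.a (γ.symm (eM (M'.b w))) := hσ
  let s : (Fin N.d1 → k) ≃ₗ[k] (Fin N'.d2 → k) := LinearEquiv.funCongrLeft k k (finCongr hNN')
  refine ⟨σ ∘ₗ s.toLinearMap, 0, ρ, γ, ⟨fun x => ?_, fun x => ?_, fun x => ?_, fun x => ?_⟩,
    ⟨fun x hx => ?_, fun x _ => Subsingleton.elim _ _⟩, ⟨fun z => ?_, γ.surjective⟩,
    fun z => ⟨fun hz => ?_, ?_⟩, fun y => ⟨fun hy => ⟨0, ?_⟩, ?_⟩⟩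
  · rw [Subsingleton.elim x 0]; simp
  · rw [Subsingleton.elim x 0]; simp
  · have := hρ 0 x
    rwa [map_zero, map_zero, map_zero, zero_sub, zero_sub, map_neg, neg_inj] at this
  · have := hρ x 0
    rwa [map_zero, map_zero, map_zero, sub_zero, sub_zero] at this
  · refine s.map_eq_zero_iff.1 ?_
    obtain ⟨w, hw⟩ := hg₂ (s x)
    rw [LinearMap.comp_apply, LinearEquiv.coe_coe, ← hw, hσ, sub_eq_zero, exY] at hx
    obtain ⟨v, hv, hv'⟩ := hx
    rw [← hw, h₂]
    refine ⟨v, sub_eq_zero.1 (injM _ ?_ ?_)⟩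
    · rw [map_sub, ← hfa, sub_eq_zero]
      apply eM.injective
      rw [← hγ, hv, γ.apply_symm_apply]
    · rw [map_sub, ← hfb, sub_eq_zero]
      apply eM.injective
      rw [← hγ, hv', γ.apply_symm_apply]
  · obtain ⟨x, y, rfl⟩ := surjM z
    refine ⟨Y.b (γ.symm x) - Y.a (γ.symm y), ?_⟩
    rw [hρ, γ.apply_symm_apply, γ.apply_symm_apply]
  · obtain ⟨x, y, rfl⟩ := surjY z
    rw [hρ, sub_eq_zero, exM] at hz
    obtain ⟨w, hw, hw'⟩ := hz
    refine ⟨s.symm (g₂ w), ?_⟩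
    rw [LinearMap.comp_apply, LinearEquiv.coe_coe, s.apply_symm_apply, hσ, hw, hw',
      γ.symm_apply_apply, γ.symm_apply_apply]
  · rintro ⟨x, rfl⟩
    obtain ⟨w, hw⟩ := hg₂ (s x)
    rw [LinearMap.comp_apply, LinearEquiv.coe_coe, ← hw, hσ, hρ, γ.apply_symm_apply,
      γ.apply_symm_apply, (exM _ _).2 ⟨w, rfl, rfl⟩, sub_self]
  · exact (γ.map_eq_zero_iff.1 hy).symm
  · rintro ⟨x, rfl⟩
    simp

/-- Splitting a vector indexed by `Fin (m + n)` into its two blocks. -/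
def splitEquiv (k : Type) [Field k] (m n : ℕ) :
    (Fin (m + n) → k) ≃ₗ[k] (Fin m → k) × (Fin n → k) :=
  LinearEquiv.funCongrLeft k k finSumFinEquiv ≪≫ₗ LinearEquiv.sumArrowLequivProdArrow _ _ k k

theorem splitEquiv_mulVec {m n p q : ℕ} (A : Matrix (Fin m) (Fin p) k)
    (D : Matrix (Fin n) (Fin q) k) (w : Fin (p + q) → k) :
    splitEquiv k m n (Matrix.reindex finSumFinEquiv finSumFinEquiv
      (Matrix.fromBlocks A 0 0 D) *ᵥ w) =
      (A *ᵥ (splitEquiv k p q w).1, D *ᵥ (splitEquiv k p q w).2) := by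
  ext i <;> simp [splitEquiv, Matrix.mulVec, dotProduct, Fin.sum_univ_add,
    LinearEquiv.funCongrLeft]

/-- The degree one part of a direct sum of Kronecker representations. -/
def split₁ (M N : KRep k) : (Fin (M.dsum N).d1 → k) ≃ₗ[k] (Fin M.d1 → k) × (Fin N.d1 → k) :=
  splitEquiv k M.d1 N.d1

/-- The degree two part of a direct sum of Kronecker representations. -/
def split₂ (M N : KRep k) : (Fin (M.dsum N).d2 → k) ≃ₗ[k] (Fin M.d2 → k) × (Fin N.d2 → k) :=
  splitEquiv k M.d2 N.d2

theorem split₁_a (M N : KRep k) (w : Fin (M.dsum N).d2 → k) :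
    split₁ M N ((M.dsum N).a w) =
      (M.a (split₂ M N w).1, N.a (split₂ M N w).2) :=
  splitEquiv_mulVec M.A N.A w

theorem split₁_b (M N : KRep k) (w : Fin (M.dsum N).d2 → k) :
    split₁ M N ((M.dsum N).b w) =
      (M.b (split₂ M N w).1, N.b (split₂ M N w).2) :=
  splitEquiv_mulVec M.B N.B w

theorem IsShift.dsum {M M' N N' : KRep k} (hM : IsShift M M') (hN : IsShift N N') :
    IsShift (M.dsum N) (M'.dsum N') := by
  obtain ⟨eM, injM, exM, surjM⟩ := hM
  obtain ⟨eN, injN, exN, surjN⟩ := hN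
  refine ⟨split₁ M' N' ≪≫ₗ (eM.prodCongr eN) ≪≫ₗ (split₂ M N).symm,
    fun w ha hb => ?_, fun x y => ?_, fun z => ?_⟩
  · have ha' := split₁_a M' N' w
    have hb' := split₁_b M' N' w
    rw [ha, map_zero, Prod.ext_iff] at ha'
    rw [hb, map_zero, Prod.ext_iff] at hb'
    refine (split₂ M' N').map_eq_zero_iff.1 (Prod.ext ?_ ?_)
    · exact injM _ ha'.1.symm hb'.1.symm
    · exact injN _ ha'.2.symm hb'.2.symm
  · rw [← (split₁ M N).injective.eq_iff, split₁_a, split₁_b,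
      Prod.mk.injEq, exM, exN]
    have key : ∀ (u : Fin (M'.dsum N').d1 → k) (v : Fin (M.dsum N).d2 → k),
        (split₁ M' N' ≪≫ₗ (eM.prodCongr eN) ≪≫ₗ (split₂ M N).symm) u = v ↔
        eM (split₁ M' N' u).1 = (split₂ M N v).1 ∧
        eN (split₁ M' N' u).2 = (split₂ M N v).2 := fun u v => by
      simp [LinearEquiv.symm_apply_eq, Prod.ext_iff]
    constructor
    · rintro ⟨⟨w₁, h₁, h₁'⟩, w₂, h₂, h₂'⟩
      refine ⟨(split₂ M' N').symm (w₁, w₂), (key _ _).2 ?_, (key _ _).2 ?_⟩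
      · rw [split₁_a, LinearEquiv.apply_symm_apply]
        exact ⟨h₁, h₂⟩
      · rw [split₁_b, LinearEquiv.apply_symm_apply]
        exact ⟨h₁', h₂'⟩
    · rintro ⟨w, ha, hb⟩
      have ha' := (key _ _).1 ha
      have hb' := (key _ _).1 hb
      rw [split₁_a] at ha'
      rw [split₁_b] at hb'
      exact ⟨⟨_, ha'.1, hb'.1⟩, _, ha'.2, hb'.2⟩
  · obtain ⟨x₁, y₁, h₁⟩ := surjM (split₁ M N z).1
    obtain ⟨x₂, y₂, h₂⟩ := surjN (split₁ M N z).2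
    refine ⟨(split₂ M N).symm (x₁, x₂), (split₂ M N).symm (y₁, y₂),
      (split₁ M N).injective ?_⟩
    rw [map_sub, split₁_a, split₁_b, LinearEquiv.apply_symm_apply,
      LinearEquiv.apply_symm_apply]
    exact Prod.ext h₁ h₂

theorem IsShift.zero : IsShift (KRep.zero : KRep k) KRep.zero := by
  have : IsEmpty (Fin (KRep.zero : KRep k).d1) := inferInstanceAs (IsEmpty (Fin 0))
  have : IsEmpty (Fin (KRep.zero : KRep k).d2) := inferInstanceAs (IsEmpty (Fin 0))
  exact ⟨0, fun _ _ _ => Subsingleton.elim _ _,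
    fun _ _ => ⟨fun _ => ⟨0, Subsingleton.elim _ _, Subsingleton.elim _ _⟩,
      fun _ => Subsingleton.elim _ _⟩, fun _ => ⟨0, 0, Subsingleton.elim _ _⟩⟩

theorem Inj_a_apply (n : ℕ) (x : Fin (n + 1) → k) (i : Fin n) :
    (KRep.Inj k n).a x i = x i.castSucc := by
  have h : ∀ j : Fin (n + 1), ((i : ℕ) = j) ↔ i.castSucc = j := fun j => by simp [Fin.ext_iff]
  change ∑ j : Fin (n + 1), (if (i : ℕ) = j then (1 : k) else 0) * x j = _
  simp [h]

theorem Inj_b_apply (n : ℕ) (x : Fin (n + 1) → k) (i : Fin n) :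
    (KRep.Inj k n).b x i = x i.succ := by
  have h : ∀ j : Fin (n + 1), ((i : ℕ) + 1 = j) ↔ i.succ = j := fun j => by simp [Fin.ext_iff]
  change ∑ j : Fin (n + 1), (if (i : ℕ) + 1 = j then (1 : k) else 0) * x j = _
  simp [h]

theorem IsShift.inj (n : ℕ) : IsShift (KRep.Inj k n) (KRep.Inj k (n + 1)) := by
  refine ⟨LinearEquiv.refl k (Fin (n + 1) → k), fun w ha hb => ?_, fun x y => ⟨fun h => ?_, ?_⟩,
    fun z => ⟨Fin.cons 0 z, 0, ?_⟩⟩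
  · funext i
    refine Fin.cases ?_ (fun j => ?_) i
    · exact (Inj_a_apply (n + 1) w 0).symm.trans (congrFun ha _)
    · exact (Inj_b_apply (n + 1) w j).symm.trans (congrFun hb _)
  · refine ⟨Fin.cons (α := fun _ : Fin (n + 2) => k) (x (0 : Fin (n + 1))) y, funext fun i => ?_,
      funext fun i => ?_⟩
    · refine (Inj_a_apply (n + 1) _ i).trans ?_
      refine Fin.cases rfl (fun j => ?_) i
      exact (Inj_a_apply n y j).symm.trans ((congrFun h j).symm.trans (Inj_b_apply n x j))
    · exact (Inj_b_apply (n + 1) _ i).trans rfl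
  · rintro ⟨w, rfl, rfl⟩
    funext i
    refine (Inj_b_apply n _ i).trans ((Inj_a_apply (n + 1) w i.succ).trans ?_)
    exact ((Inj_a_apply n _ i).trans (Inj_b_apply (n + 1) w i.castSucc)).symm
  · rw [map_zero, sub_zero]
    funext i
    exact (Inj_b_apply n _ i).trans rfl

theorem IsShift.dsumList_ofFn_inj (n : ℕ) (c : Fin n → ℕ) :
    IsShift (KRep.dsumList (List.ofFn fun j => KRep.Inj k (c j)))
      (KRep.dsumList (List.ofFn fun j => KRep.Inj k (c j + 1))) := by
  induction n with
  | zero => exact IsShift.zero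
  | succ n ih =>
    rw [List.ofFn_succ, List.ofFn_succ]
    exact (IsShift.inj _).dsum (ih _)

theorem dsumList_replicate_d1 (n : ℕ) (M : KRep k) :
    (KRep.dsumList (List.replicate n M)).d1 = n * M.d1 := by
  induction n with
  | zero => exact (Nat.zero_mul _).symm
  | succ n ih =>
    change M.d1 + (KRep.dsumList (List.replicate n M)).d1 = _
    rw [ih]; ring

theorem dsumList_replicate_d2 (n : ℕ) (M : KRep k) :
    (KRep.dsumList (List.replicate n M)).d2 = n * M.d2 := by
  induction n with
  | zero => exact (Nat.zero_mul _).symm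
  | succ n ih =>
    change M.d2 + (KRep.dsumList (List.replicate n M)).d2 = _
    rw [ih]; ring

end KRep

/-- Equivalence of short exact sequences: `0 → αP₀ → ⊕I_{cⱼ} → ⊕I_{dᵢ} → 0`
exists iff `0 → ⊕I_{cⱼ+1} → ⊕I_{dᵢ+1} → αI₀ → 0` exists. -/
theorem ses_P0_shift_equivalence (q α : ℕ) (hα : 0 < α) (hq : α < q)
    (dv : Fin q → ℕ) (cv : Fin (q - α) → ℕ)
    (hdv : Antitone dv) (hcv : Antitone cv) :
    SES (KRep.dsumList (List.replicate α (KRep.P k 0)))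
        (KRep.dsumList (List.ofFn fun j => KRep.Inj k (cv j)))
        (KRep.dsumList (List.ofFn fun i => KRep.Inj k (dv i))) ↔
    SES (KRep.dsumList (List.ofFn fun j => KRep.Inj k (cv j + 1)))
        (KRep.dsumList (List.ofFn fun i => KRep.Inj k (dv i + 1)))
        (KRep.dsumList (List.replicate α (KRep.Inj k 0))) := by
  have hN : (KRep.dsumList (List.replicate α (KRep.P k 0))).d2 = 0 := by
    rw [KRep.dsumList_replicate_d2]; rfl
  have hN' : (KRep.dsumList (List.replicate α (KRep.Inj k 0))).d1 = 0 := by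
    rw [KRep.dsumList_replicate_d1]; rfl
  have hNN' : (KRep.dsumList (List.replicate α (KRep.Inj k 0))).d2 =
      (KRep.dsumList (List.replicate α (KRep.P k 0))).d1 := by
    rw [KRep.dsumList_replicate_d1, KRep.dsumList_replicate_d2]; rfl
  have hY := KRep.IsShift.dsumList_ofFn_inj (k := k) _ cv
  have hM := KRep.IsShift.dsumList_ofFn_inj (k := k) _ dv
  exact ⟨hY.ses_of_ses hM hN hN' hNN', hY.ses_of_ses_shift hM hN hN' hNN'⟩
end
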